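/- Every acyclic r-rooted digraph (possibly infinite) that does not contain backward-infinite paths admits a large flame. -/

import Mathlib

/-- A digraph on vertex type `V` with edge type `E` (parallel edges allowed, no loops). -/
structure MultiDigraph (V : Type*) (E : Type*) where
  tail : E → V
  head : E → V
  no_loops : ∀ e, tail e ≠ head e

namespace MultiDigraph

variable {V E : Type*}

/-- `p` is a (finite) directed path from `s` to `t` in the spanning subdigraph `D(L)`,
identified with its list of edges (consecutive edges are incident, visited vertices
are pairwise distinct). -/
def IsPathIn (D : MultiDigraph V E) (L : Set E) (s t : V) (p : List E) : Prop :=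
  ∃ hne : p ≠ [],
    D.tail (p.head hne) = s ∧
    D.head (p.getLast hne) = t ∧
    p.Chain' (fun e f => D.head e = D.tail f) ∧
    (s :: p.map D.head).Nodup ∧
    ∀ e ∈ p, e ∈ L

/-- `δ_{D(L)}(v)`: the set of ingoing edges of `v` lying in `L`. -/
def delta (D : MultiDigraph V E) (L : Set E) (v : V) : Set E :=
  {e | e ∈ L ∧ D.head e = v}

/-- `δ_{D(L)}(X)`: the set of edges of `D(L)` entering the vertex set `X`
(tail outside `X`, head inside `X`). -/
def edgesInto (D : MultiDigraph V E) (L : Set E) (X : Set V) : Set E :=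
  {e | e ∈ L ∧ D.tail e ∉ X ∧ D.head e ∈ X}

/-- `I ∈ 𝒢_{D(L)}(v)`: `I` is a set of ingoing edges of `v` in `D(L)` for which
there is a set of pairwise edge-disjoint `r`–`v` paths of `D(L)` covering `I`. -/
def MemGv (D : MultiDigraph V E) (L : Set E) (r v : V) (I : Set E) : Prop :=
  I ⊆ D.delta L v ∧
  ∃ Ps : Set (List E),
    (∀ p ∈ Ps, D.IsPathIn L r v p) ∧
    Ps.Pairwise (fun p q => p.Disjoint q) ∧
    ∀ e ∈ I, ∃ p ∈ Ps, e ∈ p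

/-- `L' ∈ 𝒢(D(L))`: `L'` is a union `⋃_{v ≠ r} I_v` with `I_v ∈ 𝒢_{D(L)}(v)`;
equivalently, every edge of `L'` has head distinct from `r` and for each `v ≠ r`
the set of ingoing edges of `v` in `L'` belongs to `𝒢_{D(L)}(v)`. -/
def MemG (D : MultiDigraph V E) (L : Set E) (r : V) (L' : Set E) : Prop :=
  L' ⊆ L ∧ (∀ e ∈ L', D.head e ≠ r) ∧
    ∀ v, v ≠ r → D.MemGv L r v (D.delta L' v)

/-- `F` is a flame: `F ∈ 𝒢(D(F))`. -/
def IsFlame (D : MultiDigraph V E) (r : V) (F : Set E) : Prop :=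
  D.MemG F r F

/-- `C` is a transversal of the set `Ps` of paths: `C` consists of exactly one
edge from each path in `Ps`. -/
def IsTransversal (Ps : Set (List E)) (C : Set E) : Prop :=
  (∀ p ∈ Ps, ∃! e, e ∈ C ∧ e ∈ p) ∧ ∀ e ∈ C, ∃ p ∈ Ps, e ∈ p

/-- `C` is an `s`–`t` cut in `D(L)`: every `s`–`t` path of `D(L)` meets `C`. -/
def IsCut (D : MultiDigraph V E) (L : Set E) (s t : V) (C : Set E) : Prop :=
  ∀ p, D.IsPathIn L s t p → ∃ e ∈ p, e ∈ C

/-- `L` is large at `v`: `D(L)` admits a set `Ps` of pairwise edge-disjoint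
`r`–`v` paths together with a transversal of `Ps` that is an `r`–`v` cut in `D`. -/
def LargeAt (D : MultiDigraph V E) (r v : V) (L : Set E) : Prop :=
  ∃ (Ps : Set (List E)) (C : Set E),
    (∀ p ∈ Ps, D.IsPathIn L r v p) ∧
    Ps.Pairwise (fun p q => p.Disjoint q) ∧
    IsTransversal Ps C ∧
    D.IsCut Set.univ r v C

/-- `L` is large: it is large at every `v ≠ r`. -/
def Large (D : MultiDigraph V E) (r : V) (L : Set E) : Prop :=
  ∀ v, v ≠ r → D.LargeAt r v L

/-- `D` contains a directed cycle. -/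
def HasCycle (D : MultiDigraph V E) : Prop :=
  ∃ (p : List E) (hne : p ≠ []),
    p.Chain' (fun e f => D.head e = D.tail f) ∧
    D.head (p.getLast hne) = D.tail (p.head hne) ∧
    (p.map D.head).Nodup

/-- `D` contains a backward-infinite path: edges `…, f 2, f 1, f 0` (with `f 0` the
last edge, so the path has a final vertex `D.head (f 0)` but no first vertex); the
visited vertices `D.head (f n)` are pairwise distinct. -/
def HasBackwardInfinitePath (D : MultiDigraph V E) : Prop :=
  ∃ f : ℕ → E,
    (∀ n, D.tail (f n) = D.head (f (n + 1))) ∧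
    Function.Injective (fun n => D.head (f n))

/-- `X ⊆ V \ {r}` is `v`-linked in `D(L)`: `v ∈ X` and there is a family
`{P e : e ∈ δ_{D(L)}(X)}` of pairwise edge-disjoint paths of `D(L)`, where `P e`
has `e` as its initial edge and `v` as its terminal vertex. -/
def VLinked (D : MultiDigraph V E) (L : Set E) (r v : V) (X : Set V) : Prop :=
  r ∉ X ∧ v ∈ X ∧
  ∃ P : E → List E,
    (∀ e ∈ D.edgesInto L X, D.IsPathIn L (D.tail e) v (P e) ∧ (P e).head? = some e) ∧
    (D.edgesInto L X).Pairwise (fun e f => (P e).Disjoint (P f))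

/-- `p` is an `r`–`X` path in `D(L)`: a path starting at `r` meeting `X` exactly
in its last vertex. -/
def IsRXPathIn (D : MultiDigraph V E) (L : Set E) (r : V) (X : Set V) (p : List E) : Prop :=
  ∃ hne : p ≠ [],
    D.tail (p.head hne) = r ∧
    D.head (p.getLast hne) ∈ X ∧
    (∀ e ∈ p.dropLast, D.head e ∉ X) ∧
    p.Chain' (fun e f => D.head e = D.tail f) ∧
    (r :: p.map D.head).Nodup ∧
    ∀ e ∈ p, e ∈ L

/-- `X` is fillable in `D(L)`: there is a set `Ps` of pairwise edge-disjoint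
`r`–`X` paths in `D(L)` whose set of terminal edges is exactly `δ_{D(L)}(X)`. -/
def Fillable (D : MultiDigraph V E) (L : Set E) (r : V) (X : Set V) : Prop :=
  ∃ Ps : Set (List E),
    (∀ p ∈ Ps, D.IsRXPathIn L r X p) ∧
    Ps.Pairwise (fun p q => p.Disjoint q) ∧
    {e | ∃ p ∈ Ps, p.getLast? = some e} = D.edgesInto L X

end MultiDigraph

section

open Cardinal Filter

universe u

namespace Web

variable {E : Type*}

/-- The vertices outside `L` adjacent to `Z` in the bipartite web `adj`. -/
def nb (adj : E → E → Prop) (L Z : Set E) : Set E := {b | b ∉ L ∧ ∃ a ∈ Z, adj a b}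

/-- Iterating `f` inside `D` yields no injective infinite sequence. -/
def NoRay (D : Set E) (f : E → E) : Prop :=
  ∀ u : ℕ → E, Function.Injective u → (∀ n, u n ∈ D ∧ u (n + 1) = f (u n)) → False

/-- `f` matches the neighbourhood of `Z` back into `Z` without rays, where the vertices in `K`
have been deleted on the left and those in `L` on the right. -/
structure IsWave (adj : E → E → Prop) (K L Z : Set E) (f : E → E) : Prop where
  notMem : ∀ a ∈ Z, a ∉ K
  maps : ∀ b ∈ nb adj L Z, f b ∈ Z
  rel : ∀ b ∈ nb adj L Z, adj (f b) b
  inj : Set.InjOn f (nb adj L Z)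
  noRay : NoRay (nb adj L Z) f

/-- The instance `(K, L)` has a wave that misses one of its own vertices. -/
def Hindered (adj : E → E → Prop) (K L : Set E) : Prop :=
  ∃ Z f, IsWave adj K L Z f ∧ ∃ x ∈ Z, ∀ b ∈ nb adj L Z, f b ≠ x

theorem nb_mono {adj : E → E → Prop} {L Z Z' : Set E} (h : Z ⊆ Z') :
    nb adj L Z ⊆ nb adj L Z' := fun _ hb => ⟨hb.1, hb.2.imp fun _ ha => ⟨h ha.1, ha.2⟩⟩

theorem mem_nb_self {adj : E → E → Prop} (hr : ∀ a, adj a a) {L Z : Set E} {a : E} (ha : a ∈ Z)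
    (hL : a ∉ L) : a ∈ nb adj L Z := ⟨hL, a, ha, hr a⟩

theorem NoRay.tail {D : Set E} {f : E → E} (h : NoRay D f) {u : ℕ → E}
    (hu : Function.Injective u) (N : ℕ) (hN : ∀ n ≥ N, u n ∈ D ∧ u (n + 1) = f (u n)) : False := by
  refine h (fun n => u (N + n)) (fun a b hab => ?_) fun n => hN (N + n) (by omega)
  have := hu hab
  omega

theorem NoRay.mix {D D' : Set E} {f g h : E → E} (hg : NoRay D' g) (hf : NoRay (D \ D') f)
    (hh : ∀ d ∈ D, d ∈ D' → h d = g d) (hh' : ∀ d ∈ D, d ∉ D' → h d = f d)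
    (hcl : ∀ d ∈ D, d ∈ D' → g d ∈ D → g d ∈ D') : NoRay D h := by
  intro u hu hD
  by_cases hex : ∃ N, u N ∈ D'
  · obtain ⟨N, hN⟩ := hex
    have key : ∀ n ≥ N, u n ∈ D' := by
      intro n hn
      induction n, hn using Nat.le_induction with
      | base => exact hN
      | succ n _ ih =>
        have h1 := (hD n).2.trans (hh _ (hD n).1 ih)
        rw [h1]
        exact hcl _ (hD n).1 ih (h1 ▸ (hD (n + 1)).1)
    exact hg.tail hu N fun n hn => ⟨key n hn, (hD n).2.trans (hh _ (hD n).1 (key n hn))⟩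
  · push Not at hex
    exact hf u hu fun n => ⟨⟨(hD n).1, hex n⟩, (hD n).2.trans (hh' _ (hD n).1 (hex n))⟩

theorem NoRay.of_finite {D D' : Set E} {f f' : E → E} (hf : NoRay D f)
    (hfin : {d | d ∈ D' ∧ ¬(d ∈ D ∧ f' d = f d)}.Finite) : NoRay D' f' := by
  intro u hu hD
  have h1 : (u ⁻¹' {d | d ∈ D' ∧ ¬(d ∈ D ∧ f' d = f d)}).Finite := hfin.preimage hu.injOn
  obtain ⟨N, hN⟩ := h1.bddAbove
  refine hf.tail hu (N + 1) fun n hn => ?_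
  by_contra hc
  have : n ≤ N := hN ⟨(hD n).1, fun h2 => hc ⟨h2.1, (hD n).2.trans h2.2⟩⟩
  omega

theorem NoRay.mono {D D' : Set E} {f f' : E → E} (hf : NoRay D f)
    (h : ∀ d ∈ D', d ∈ D ∧ f' d = f d) : NoRay D' f' := by
  refine hf.of_finite ?_
  convert Set.finite_empty (α := E)
  ext d
  simp only [Set.mem_ofPred_eq, Set.mem_empty_iff_false, iff_false]
  exact fun hd => hd.2 (h d hd.1)

section Coherent

variable {ι : Type*} [LinearOrder ι] [WellFoundedLT ι]

open Classical in
/-- Apply to `b` the function of the least index whose domain contains `b`. -/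
noncomputable def coh (D : ι → Set E) (f : ι → E → E) (b : E) : E :=
  if h : ∃ k, b ∈ D k then f (wellFounded_lt.min {k | b ∈ D k} h) b else b

theorem coh_spec {D : ι → Set E} {f : ι → E → E} {b : E} (h : ∃ k, b ∈ D k) :
    ∃ k, b ∈ D k ∧ coh D f b = f k b ∧ ∀ l < k, b ∉ D l := by
  refine ⟨wellFounded_lt.min {k | b ∈ D k} h, wellFounded_lt.min_mem {k | b ∈ D k} h,
    by rw [coh, dif_pos h], fun l hl hb => ?_⟩
  exact wellFounded_lt.not_lt_min {k | b ∈ D k} hb hl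

theorem coh_injOn {D : ι → Set E} {f : ι → E → E} (hinj : ∀ k, Set.InjOn (f k) (D k))
    (hA : ∀ k k' b b', k < k' → b ∈ D k → b' ∈ D k' → f k b = f k' b' → b' ∈ D k) :
    Set.InjOn (coh D f) (⋃ k, D k) := by
  intro b hb b' hb' h
  rw [Set.mem_iUnion] at hb hb'
  obtain ⟨k, hk, h1, h2⟩ := coh_spec (f := f) hb
  obtain ⟨k', hk', h1', h2'⟩ := coh_spec (f := f) hb'
  rw [h1, h1'] at h
  rcases lt_trichotomy k k' with hlt | rfl | hlt
  · exact absurd (hA _ _ _ _ hlt hk hk' h) (h2' _ hlt)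
  · exact hinj k hk hk' h
  · exact absurd (hA _ _ _ _ hlt hk' hk h.symm) (h2 _ hlt)

theorem coh_noRay {D : ι → Set E} {f : ι → E → E} (hray : ∀ k, NoRay (D k) (f k))
    (hB : ∀ k b, b ∈ D k → f k b ∈ (⋃ k, D k) → f k b ∈ D k) :
    NoRay (⋃ k, D k) (coh D f) := by
  intro u hu hD
  have hex : ∀ n, ∃ k, u n ∈ D k := fun n => Set.mem_iUnion.1 (hD n).1
  choose k hk h1 h2 using fun n => coh_spec (f := f) (hex n)
  have hanti : ∀ n, k (n + 1) ≤ k n := by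
    intro n
    by_contra! hlt
    refine h2 (n + 1) _ hlt ?_
    rw [(hD n).2, h1 n]
    refine hB _ _ (hk n) ?_
    rw [← h1 n, ← (hD n).2]
    exact (hD (n + 1)).1
  obtain ⟨N, hN⟩ := WellFoundedGT.monotone_chain_condition
    (α := ιᵒᵈ) ⟨fun n => OrderDual.toDual (k n), monotone_nat_of_le_succ hanti⟩
  refine (hray (k N)).tail hu N fun n hn => ?_
  have : k N = k n := hN n hn
  rw [this]
  exact ⟨hk n, (hD n).2.trans (h1 n)⟩

end Coherent

section Waves

variable {adj : E → E → Prop} {K L : Set E}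

theorem exists_largest (hr : ∀ a, adj a a) (K L : Set E) :
    ∃ Z f, IsWave adj K L Z f ∧ ∀ S g, IsWave adj K L S g → S ⊆ Z := by
  classical
  let ι := {p : Set E × (E → E) // IsWave adj K L p.1 p.2}
  let _ : LinearOrder ι := linearOrderOfSTO WellOrderingRel
  have : WellFoundedLT ι := ⟨(inferInstance : IsWellOrder ι WellOrderingRel).wf⟩
  let D : ι → Set E := fun k => nb adj L k.1.1
  let f : ι → E → E := fun k => k.1.2
  have hU : nb adj L (⋃ k : ι, k.1.1) = ⋃ k, D k := by
    ext b
    simp only [nb, Set.mem_iUnion, Set.mem_ofPred_eq, D]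
    constructor
    · rintro ⟨h, a, ⟨k, hk⟩, ha⟩; exact ⟨k, h, a, hk, ha⟩
    · rintro ⟨k, h, a, hk, ha⟩; exact ⟨h, a, ⟨k, hk⟩, ha⟩
  refine ⟨⋃ k : ι, k.1.1, coh D f, ⟨?_, ?_, ?_, ?_, ?_⟩, ?_⟩
  · intro a ha
    obtain ⟨k, hk⟩ := Set.mem_iUnion.1 ha
    exact k.2.notMem a hk
  · intro b hb
    rw [hU, Set.mem_iUnion] at hb
    obtain ⟨k, hk, h1, -⟩ := coh_spec (f := f) hb
    rw [h1]
    exact Set.mem_iUnion.2 ⟨k, k.2.maps b hk⟩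
  · intro b hb
    rw [hU, Set.mem_iUnion] at hb
    obtain ⟨k, hk, h1, -⟩ := coh_spec (f := f) hb
    rw [h1]
    exact k.2.rel b hk
  · rw [hU]
    refine coh_injOn (fun k => k.2.inj) fun k k' b b' _ hb hb' h => ?_
    exact ⟨hb'.1, f k b, k.2.maps b hb, h ▸ k'.2.rel b' hb'⟩
  · rw [hU]
    refine coh_noRay (fun k => k.2.noRay) fun k b hb h => ?_
    obtain ⟨k', hk'⟩ := Set.mem_iUnion.1 h
    exact mem_nb_self hr (k.2.maps b hb) hk'.1
  · intro S g h
    exact Set.subset_iUnion (fun k : ι => k.1.1) ⟨(S, g), h⟩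

theorem nb_union (Z S : Set E) :
    nb adj L (Z ∪ S) = nb adj L Z ∪ nb adj (L ∪ nb adj L Z) S := by
  ext b
  simp only [nb, Set.mem_union, Set.mem_ofPred_eq]
  grind

open Classical in
theorem IsWave.ext (hr : ∀ a, adj a a) {Z S : Set E} {f g : E → E} (hZ : IsWave adj K L Z f)
    (hS : IsWave adj K (L ∪ nb adj L Z) S g) :
    IsWave adj K L (Z ∪ S) (fun b => if b ∈ nb adj L Z then f b else g b) := by
  have hsplit : ∀ b ∈ nb adj L (Z ∪ S), b ∉ nb adj L Z → b ∈ nb adj (L ∪ nb adj L Z) S := by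
    intro b hb h
    rw [nb_union] at hb
    exact hb.resolve_left h
  have hgZ : ∀ b ∈ nb adj (L ∪ nb adj L Z) S, g b ∉ Z := fun b hb h =>
    hb.1 (Or.inr ⟨fun h' => hb.1 (Or.inl h'), g b, h, hS.rel b hb⟩)
  refine ⟨?_, ?_, ?_, ?_, ?_⟩
  · rintro a (h | h)
    exacts [hZ.notMem a h, hS.notMem a h]
  · intro b hb
    by_cases h : b ∈ nb adj L Z
    · simp only [h, if_true]; exact Or.inl (hZ.maps b h)
    · simp only [h, if_false]; exact Or.inr (hS.maps b (hsplit b hb h))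
  · intro b hb
    by_cases h : b ∈ nb adj L Z
    · simp only [h, if_true]; exact hZ.rel b h
    · simp only [h, if_false]; exact hS.rel b (hsplit b hb h)
  · intro b hb b' hb' he
    by_cases h : b ∈ nb adj L Z <;> by_cases h' : b' ∈ nb adj L Z <;>
      simp only [h, h', if_true, if_false] at he
    · exact hZ.inj h h' he
    · exact absurd (he ▸ hZ.maps b h) (hgZ b' (hsplit b' hb' h'))
    · exact absurd (he ▸ hZ.maps b' h') (hgZ b (hsplit b hb h))
    · exact hS.inj (hsplit b hb h) (hsplit b' hb' h') he
  · refine NoRay.mix hZ.noRay (f := g) (hS.noRay.mono fun d hd => ⟨hsplit d hd.1 hd.2, rfl⟩)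
      (fun d _ hd => by simp [hd]) (fun d _ hd => by simp [hd]) fun d _ hd hd' => ?_
    exact mem_nb_self hr (hZ.maps d hd) hd'.1

theorem IsWave.surj (hu : ¬ Hindered adj K L) {Z : Set E} {f : E → E} (hZ : IsWave adj K L Z f)
    {a : E} (ha : a ∈ Z) : ∃ b ∈ nb adj L Z, f b = a := by
  by_contra! h
  exact hu ⟨Z, f, hZ, a, ha, h⟩

theorem IsWave.weaken {K' Z : Set E} {f : E → E} (hZ : IsWave adj K' L Z f) (h : K ⊆ K') :
    IsWave adj K L Z f := ⟨fun a ha h' => hZ.notMem a ha (h h'), hZ.maps, hZ.rel, hZ.inj, hZ.noRay⟩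

theorem IsWave.sdiff_unhindered (hr : ∀ a, adj a a) (hu : ¬ Hindered adj K L) {Z : Set E}
    {f : E → E} (hZ : IsWave adj K L Z f) : ¬ Hindered adj (K ∪ Z) (L ∪ nb adj L Z) := by
  rintro ⟨S, g, hS, x, hx, hxg⟩
  have hxZ : x ∉ Z := fun h => hS.notMem x hx (Or.inr h)
  refine hu ⟨_, _, hZ.ext hr (hS.weaken Set.subset_union_left), x, Or.inr hx, fun b hb => ?_⟩
  by_cases h : b ∈ nb adj L Z
  · simp only [h, if_true]
    exact fun h' => hxZ (h' ▸ hZ.maps b h)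
  · simp only [h, if_false]
    rw [nb_union] at hb
    exact hxg b (hb.resolve_left h)

theorem IsWave.sdiff_eq_empty (hr : ∀ a, adj a a) {Z : Set E} {f : E → E}
    (hZ : IsWave adj K L Z f) (hmax : ∀ S g, IsWave adj K L S g → S ⊆ Z) {S : Set E} {g : E → E}
    (hS : IsWave adj (K ∪ Z) (L ∪ nb adj L Z) S g) : S = ∅ := by
  refine Set.eq_empty_of_forall_notMem fun x hx => hS.notMem x hx (Or.inr ?_)
  exact hmax _ _ (hZ.ext hr (hS.weaken Set.subset_union_left)) (Or.inr hx)

end Waves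

section Reroute

theorem exists_route {r : E → E → Prop} {x y : E} (h : Relation.ReflTransGen r x y) :
    ∃ t : List E, (x :: t).IsChain r ∧ (x :: t).Nodup ∧ (x :: t).getLast? = some y := by
  induction h using Relation.ReflTransGen.head_induction_on with
  | refl => exact ⟨[], by simp⟩
  | @head x z hxz _ ih =>
    obtain ⟨t, h1, h2, h3⟩ := ih
    by_cases hx : x ∈ z :: t
    · obtain ⟨s, t', he⟩ := List.append_of_mem hx
      rw [he] at h1 h2 h3
      refine ⟨t', h1.right_of_append, h2.of_append_right, ?_⟩
      simpa using h3
    · exact ⟨z :: t, h1.cons_cons hxz, List.nodup_cons.2 ⟨hx, h2⟩, by simpa using h3⟩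

theorem exists_reroute (I : Set E) (ρ : E → List E) (hnd : ∀ d ∈ I, (ρ d).Nodup)
    (hdj : ∀ d ∈ I, ∀ d' ∈ I, ∀ e, e ∈ ρ d → e ∈ ρ d' → d = d') :
    ∃ cyc : Equiv.Perm E, (∀ e, (∀ d ∈ I, e ∉ ρ d) → cyc e = e) ∧
      (∀ d ∈ I, ∀ e, cyc e ∈ ρ d ↔ e ∈ ρ d) ∧
      ∀ (R : E → E → Prop), ∀ d ∈ I, (ρ d).IsChain R →
        (∀ l ∈ (ρ d).getLast?, ∀ x ∈ (ρ d).head?, R l x) → ∀ e ∈ ρ d, R e (cyc e) := by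
  classical
  let F : Bool → E → E := fun s e =>
    if h : ∃ d ∈ I, e ∈ ρ d then (if s then (ρ h.choose).formPerm else (ρ h.choose).formPerm⁻¹) e
    else e
  have hF : ∀ d ∈ I, ∀ e ∈ ρ d, ∀ s,
      F s e = (if s then (ρ d).formPerm else (ρ d).formPerm⁻¹) e := by
    intro d hd e he s
    have h : ∃ d ∈ I, e ∈ ρ d := ⟨d, hd, he⟩
    have : h.choose = d := hdj _ h.choose_spec.1 _ hd _ h.choose_spec.2 he
    simp only [F, dif_pos h, this]
  have hF' : ∀ e, (∀ d ∈ I, e ∉ ρ d) → ∀ s, F s e = e := by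
    intro e he s
    have h : ¬ ∃ d ∈ I, e ∈ ρ d := by push Not; exact he
    simp only [F, dif_neg h]
  have hmem : ∀ d ∈ I, ∀ e ∈ ρ d, ∀ s, F s e ∈ ρ d := by
    intro d hd e he s
    rw [hF d hd e he]
    cases s
    · simp only [Bool.false_eq_true, if_false]
      rw [← List.formPerm_mem_iff_mem (l := ρ d)]
      simpa using he
    · simpa using List.formPerm_apply_mem_of_mem he
  have hinv : ∀ s e, F (!s) (F s e) = e := by
    intro s e
    by_cases h : ∃ d ∈ I, e ∈ ρ d
    · obtain ⟨d, hd, he⟩ := h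
      rw [hF d hd _ (hmem d hd e he s), hF d hd e he]
      cases s <;> simp
    · push Not at h
      rw [hF' e h, hF' e h]
  refine ⟨⟨F true, F false, hinv true, hinv false⟩, fun e he => hF' e he true, ?_, ?_⟩
  · intro d hd e
    refine ⟨fun h => ?_, fun h => hmem d hd e h true⟩
    have := hmem d hd _ h false
    simpa using (hinv true e) ▸ this
  · intro R d hd hc hlast e he
    change R e (F true e)
    rw [hF d hd e he]
    simp only [if_true]
    obtain ⟨i, hi, rfl⟩ := List.getElem_of_mem he
    rw [List.formPerm_apply_getElem _ (hnd d hd)]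
    by_cases h : i + 1 < (ρ d).length
    · simp only [Nat.mod_eq_of_lt h]
      exact List.isChain_iff_getElem.1 hc i h
    · have hil : i + 1 = (ρ d).length := by omega
      simp only [hil, Nat.mod_self]
      refine hlast _ ?_ _ ?_
      · rw [List.getLast?_eq_getElem?]
        simp [← hil]
      · rw [List.head?_eq_getElem?]
        simp

end Reroute

end Web

namespace Web

variable {E : Type*}

theorem mem_of_isChain_cons {r : E → E → Prop} {D : Set E} {x : E} {t : List E}
    (h : (x :: t).IsChain r) (hr : ∀ d d', r d d' → d' ∈ D) : ∀ e ∈ t, e ∈ D := by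
  induction t generalizing x with
  | nil => simp
  | cons z t ih =>
    rw [List.isChain_cons_cons] at h
    intro e he
    rcases List.mem_cons.1 he with rfl | he
    exacts [hr _ _ h.1, ih h.2 e he]

section Hindrance

variable {adj : E → E → Prop} {K L : Set E}

theorem IsWave.of_reroute {S : Set E} {h : E → E} (I : Set E) (ρ : E → List E)
    (hnd : ∀ d ∈ I, (ρ d).Nodup) (hdj : ∀ d ∈ I, ∀ d' ∈ I, ∀ e, e ∈ ρ d → e ∈ ρ d' → d = d')
    (hK : ∀ a ∈ S, a ∉ K) (hsub : ∀ d ∈ I, ∀ e ∈ ρ d, e ∈ nb adj L S)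
    (hmaps : ∀ b ∈ nb adj L S, h b ∈ S) (hinj : Set.InjOn h (nb adj L S))
    (hrel : ∀ b ∈ nb adj L S, (∀ d ∈ I, b ∉ ρ d) → adj (h b) b)
    (hchain : ∀ d ∈ I, (ρ d).IsChain fun e e' => adj (h e') e)
    (hlast : ∀ d ∈ I, ∀ l ∈ (ρ d).getLast?, ∀ x ∈ (ρ d).head?, adj (h x) l)
    (hray : ∀ c : E → E, (∀ e, (∀ d ∈ I, e ∉ ρ d) → c e = e) →
      (∀ d ∈ I, ∀ e, c e ∈ ρ d ↔ e ∈ ρ d) → NoRay (nb adj L S) fun b => h (c b)) :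
    ∃ g, IsWave adj K L S g ∧ ∀ b ∈ nb adj L S, ∃ b' ∈ nb adj L S, g b = h b' := by
  obtain ⟨c, hc1, hc2, hc3⟩ := exists_reroute I ρ hnd hdj
  have hcD : ∀ b ∈ nb adj L S, c b ∈ nb adj L S := by
    intro b hb
    by_cases hex : ∃ d ∈ I, b ∈ ρ d
    · obtain ⟨d, hd, hbd⟩ := hex
      exact hsub d hd _ ((hc2 d hd b).2 hbd)
    · push Not at hex
      rwa [hc1 b hex]
  refine ⟨fun b => h (c b), ⟨hK, fun b hb => hmaps _ (hcD b hb), fun b hb => ?_, ?_,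
    hray c hc1 hc2⟩, fun b hb => ⟨c b, hcD b hb, rfl⟩⟩
  · by_cases hex : ∃ d ∈ I, b ∈ ρ d
    · obtain ⟨d, hd, hbd⟩ := hex
      exact hc3 (fun e e' => adj (h e') e) d hd (hchain d hd) (hlast d hd) b hbd
    · push Not at hex
      simp only [hc1 b hex]
      exact hrel b hb hex
  · intro b hb b' hb' he
    exact c.injective (hinj (hcD b hb) (hcD b' hb') he)

theorem IsWave.mono_right {L' Z : Set E} {f : E → E} (hZ : IsWave adj K L Z f) (h : L ⊆ L') :
    IsWave adj K L' Z f := by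
  have hs : nb adj L' Z ⊆ nb adj L Z := fun b hb => ⟨fun h' => hb.1 (h h'), hb.2⟩
  exact ⟨hZ.notMem, fun b hb => hZ.maps b (hs hb), fun b hb => hZ.rel b (hs hb), hZ.inj.mono hs,
    hZ.noRay.mono fun b hb => ⟨hs hb, rfl⟩⟩

theorem nb_eq_of_notMem {Z : Set E} {b : E} (hb : b ∉ nb adj L Z) :
    nb adj (L ∪ {b}) Z = nb adj L Z := by
  ext d
  constructor
  · exact fun h => ⟨fun h' => h.1 (Or.inl h'), h.2⟩
  · refine fun h => ⟨?_, h.2⟩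
    rintro (hL | rfl)
    exacts [h.1 hL, hb h]

/-- Deleting a right vertex outside the neighbourhood of a largest wave creates no hindrance. -/
theorem not_hindered_insert_right (hr : ∀ a, adj a a) (hu : ¬ Hindered adj K L) {W : Set E}
    {f : E → E} (hW : IsWave adj K L W f) (hmax : ∀ S g, IsWave adj K L S g → S ⊆ W) {b : E}
    (hb : b ∉ nb adj L W) : ¬ Hindered adj K (L ∪ {b}) := by
  classical
  rintro ⟨S₀, g₀, hS₀, x, hx₀, hxg₀⟩
  obtain ⟨S, g, hS, hx, hxg, hWS⟩ : ∃ S g, IsWave adj K (L ∪ {b}) S g ∧ x ∈ S ∧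
      (∀ d ∈ nb adj (L ∪ {b}) S, g d ≠ x) ∧ W ⊆ S := by
    refine ⟨_, _, hS₀.ext hr (hW.mono_right (L' := L ∪ {b} ∪ nb adj (L ∪ {b}) S₀) ?_),
      Or.inl hx₀, fun d hd => ?_, Set.subset_union_right⟩
    · exact fun d hd => Or.inl (Or.inl hd)
    · by_cases h : d ∈ nb adj (L ∪ {b}) S₀
      · simp only [h, if_true]
        exact hxg₀ d h
      · simp only [h, if_false]
        rw [nb_union] at hd
        have hd' := hd.resolve_left h
        intro h'
        refine h ⟨hd.elim (fun h => h.1) (fun h hh => h.1 (Or.inl hh)), x, hx₀, ?_⟩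
        rw [← h']
        refine hW.rel d ⟨fun hL => hd'.1 (Or.inl (Or.inl hL)), hd'.2⟩
  by_cases hbS : b ∈ nb adj L S
  swap
  · refine hu ⟨S, g, ?_, x, hx, ?_⟩
    · have h := nb_eq_of_notMem hbS
      exact ⟨hS.notMem, h ▸ hS.maps, h ▸ hS.rel, h ▸ hS.inj, h ▸ hS.noRay⟩
    · rwa [nb_eq_of_notMem hbS] at hxg
  set D := nb adj (L ∪ {b}) S with hD
  have hDb : ∀ d, d ∈ nb adj L S → d ≠ b → d ∈ D := fun d hd hdb => ⟨by
    rintro (h | h)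
    exacts [hd.1 h, hdb h], hd.2⟩
  have hDL : D ⊆ nb adj L S := fun d hd => ⟨fun h => hd.1 (Or.inl h), hd.2⟩
  have hbD : b ∉ D := fun h => h.1 (Or.inr rfl)
  let r : E → E → Prop := fun d d' => d' ∈ D ∧ adj (g d') d
  by_cases hcase : ∃ a ∈ S, (∃ d, Relation.ReflTransGen r b d ∧ adj a d) ∧ ∀ d ∈ D, g d ≠ a
  · obtain ⟨a, haS, ⟨d, hbd, had⟩, hag⟩ := hcase
    obtain ⟨t, ht1, ht2, ht3⟩ := exists_route hbd
    have htD : ∀ e ∈ t, e ∈ D := mem_of_isChain_cons ht1 fun _ _ h => h.1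
    let h : E → E := Function.update g b a
    have hbt : b ∉ t := (List.nodup_cons.1 ht2).1
    have hh : ∀ d ∈ D, h d = g d := fun d hd =>
      Function.update_of_ne (by rintro rfl; exact hbD hd) _ _
    have hhb : h b = a := Function.update_self _ _ _
    obtain ⟨k, hk, -⟩ := IsWave.of_reroute (adj := adj) (K := K) (L := L) (S := S) (h := h) {b}
      (fun _ => b :: t) (fun _ _ => ht2) (fun d hd d' hd' _ _ _ => hd.trans hd'.symm) hS.notMem
      (fun _ _ e he => (List.mem_cons.1 he).elim (fun h => h ▸ hbS) fun h => hDL (htD e h))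
      (fun d hd => by
        by_cases hdb : d = b
        · rw [hdb, hhb]; exact haS
        · rw [hh d (hDb d hd hdb)]; exact hS.maps d (hDb d hd hdb))
      (fun d hd d' hd' he => by
        by_cases hdb : d = b <;> by_cases hdb' : d' = b
        · rw [hdb, hdb']
        · rw [hdb, hhb, hh _ (hDb d' hd' hdb')] at he
          exact absurd he.symm (hag _ (hDb d' hd' hdb'))
        · rw [hdb', hhb, hh _ (hDb d hd hdb)] at he
          exact absurd he (hag _ (hDb d hd hdb))
        · rw [hh _ (hDb d hd hdb), hh _ (hDb d' hd' hdb')] at he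
          exact hS.inj (hDb d hd hdb) (hDb d' hd' hdb') he)
      (fun d hd hdn => by
        have hdD := hDb d hd fun h => hdn b rfl (h ▸ List.mem_cons_self)
        rw [hh d hdD]; exact hS.rel d hdD)
      (fun _ _ => ht1.imp fun e e' hee => by rw [hh e' hee.1]; exact hee.2)
      (fun _ _ l hl x hx => by
        simp only [List.head?_cons, Option.mem_def, Option.some.injEq] at hx
        rw [ht3] at hl
        simp only [Option.mem_def, Option.some.injEq] at hl
        rw [← hx, hhb, ← hl]; exact had)
      (fun c hc1 hc2 => hS.noRay.of_finite ((b :: t).finite_toSet.subset fun d hd => by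
        by_contra hdn
        have hdn' : d ∉ b :: t := hdn
        have hdD := hDb d hd.1 fun h => hdn' (h ▸ List.mem_cons_self)
        refine hd.2 ⟨hdD, ?_⟩
        simp only [hc1 d fun _ _ => hdn', hh d hdD]))
    exact hb (nb_mono (hmax S k hk) hbS)
  · push Not at hcase
    set R : Set E := {a | ∃ d, Relation.ReflTransGen r b d ∧ adj a d} with hR
    have hsub : nb adj L (S \ R) ⊆ D := by
      intro d hd
      refine hDb d (nb_mono Set.sdiff_subset hd) ?_
      rintro rfl
      obtain ⟨-, a, ha, had⟩ := hd
      exact ha.2 ⟨d, .refl, had⟩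
    refine hu ⟨S \ R, g, ⟨fun a ha => hS.notMem a ha.1, fun d hd => ⟨hS.maps d (hsub hd), ?_⟩,
      fun d hd => hS.rel d (hsub hd), hS.inj.mono hsub,
      hS.noRay.mono fun d hd => ⟨hsub hd, rfl⟩⟩, x, ⟨hx, ?_⟩, fun d hd => hxg d (hsub hd)⟩
    · rintro ⟨d', hd', had'⟩
      obtain ⟨-, a, ha, had⟩ := id hd
      exact ha.2 ⟨d, hd'.tail ⟨hsub hd, had'⟩, had⟩
    · rintro ⟨d, hd, hxd⟩
      obtain ⟨d', hd', he⟩ := hcase x hx ⟨d, hd, hxd⟩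
      exact hxg d' hd' he

/-- In an unhindered instance every left vertex can be matched so that the rest is unhindered. -/
theorem exists_match_not_hindered (hr : ∀ a, adj a a) (hu : ¬ Hindered adj K L) {a : E}
    (ha : a ∉ K) : ∃ b, b ∉ L ∧ adj a b ∧ ¬ Hindered adj (K ∪ {a}) (L ∪ {b}) := by
  classical
  obtain ⟨W, f, hW, hmax⟩ := exists_largest hr K L
  by_cases haW : a ∈ W
  · obtain ⟨b, hb, hba⟩ := hW.surj hu haW
    refine ⟨b, hb.1, hba ▸ hW.rel b hb, ?_⟩
    rintro ⟨S, g, hS, x, hx, hxg⟩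
    have haS : a ∉ S := fun h => hS.notMem a h (Or.inr rfl)
    set D := nb adj (L ∪ {b}) S with hD
    have hbD : b ∉ D := fun h => h.1 (Or.inr rfl)
    have hsplit : ∀ d ∈ nb adj L (S ∪ W), d ∉ D → d ∈ nb adj L W := by
      rintro d ⟨hdL, a', ha' | ha', had⟩ hd
      · by_cases hdb : d = b
        · exact hdb ▸ hb
        · exact absurd ⟨by rintro (h | h); exacts [hdL h, hdb h], a', ha', had⟩ hd
      · exact ⟨hdL, a', ha', had⟩
    have hfS : ∀ d ∈ nb adj L W, d ∉ D → f d ∉ S := by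
      intro d hd hdD h
      by_cases hdb : d = b
      · rw [hdb, hba] at h
        exact haS h
      · exact hdD ⟨by rintro (h | h); exacts [hd.1 h, hdb h], f d, h, hW.rel d hd⟩
    refine hu ⟨S ∪ W, fun d => if d ∈ D then g d else f d, ⟨?_, ?_, ?_, ?_, ?_⟩, x, Or.inl hx, ?_⟩
    · rintro e (h | h)
      exacts [fun h' => hS.notMem e h (Or.inl h'), hW.notMem e h]
    · intro d hd
      by_cases h : d ∈ D <;> simp only [h, if_true, if_false]
      exacts [Or.inl (hS.maps d h), Or.inr (hW.maps d (hsplit d hd h))]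
    · intro d hd
      by_cases h : d ∈ D <;> simp only [h, if_true, if_false]
      exacts [hS.rel d h, hW.rel d (hsplit d hd h)]
    · intro d hd d' hd' he
      by_cases h : d ∈ D <;> by_cases h' : d' ∈ D <;> simp only [h, h', if_true, if_false] at he
      · exact hS.inj h h' he
      · exact absurd (he ▸ hS.maps d h) (hfS d' (hsplit d' hd' h') h')
      · exact absurd (he ▸ hS.maps d' h') (hfS d (hsplit d hd h) h)
      · exact hW.inj (hsplit d hd h) (hsplit d' hd' h') he
    · have hray : NoRay (nb adj L (S ∪ W) \ {b}) fun d => if d ∈ D then g d else f d := by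
        refine NoRay.mix (D' := D) (f := f) hS.noRay
          (hW.noRay.mono fun d hd => ⟨hsplit d hd.1.1 hd.2, rfl⟩) (fun d _ hd => by simp [hd])
          (fun d _ hd => by simp [hd]) fun d hd hdD hd' => ?_
        exact mem_nb_self hr (hS.maps d hdD) (by
          rintro (h | h)
          exacts [hd'.1.1 h, hd'.2 h])
      refine hray.of_finite ((Set.finite_singleton b).subset fun d hd => ?_)
      by_contra h
      exact hd.2 ⟨⟨hd.1, h⟩, rfl⟩
    · intro d hd
      by_cases h : d ∈ D <;> simp only [h, if_true, if_false]
      · exact hxg d h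
      · exact fun h' => hfS d (hsplit d hd h) h (h' ▸ hx)
  · obtain ⟨b, hb, hbW⟩ : ∃ b ∈ nb adj L {a}, b ∉ nb adj L W := by
      by_contra! hcon
      have heq : nb adj L (W ∪ {a}) = nb adj L W := by
        refine Set.Subset.antisymm ?_ (nb_mono Set.subset_union_left)
        rintro d ⟨hdL, a', ha' | ha', had⟩
        exacts [⟨hdL, a', ha', had⟩, hcon d ⟨hdL, a', ha', had⟩]
      refine hu ⟨W ∪ {a}, f, ⟨?_, ?_, heq ▸ hW.rel, heq ▸ hW.inj, heq ▸ hW.noRay⟩, a, Or.inr rfl,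
        ?_⟩
      · rintro e (h | h)
        exacts [hW.notMem e h, h ▸ ha]
      · rw [heq]
        exact fun d hd => Or.inl (hW.maps d hd)
      · rw [heq]
        exact fun d hd h => haW (h ▸ hW.maps d hd)
    obtain ⟨hbL, a', ha', hab⟩ := hb
    refine ⟨b, hbL, ha' ▸ hab, ?_⟩
    rintro ⟨S, g, hS, hx⟩
    exact not_hindered_insert_right hr hu hW hmax hbW
      ⟨S, g, hS.weaken Set.subset_union_left, hx⟩

/-- `b` is reachable from `a` by an alternating route with matching edges `G` on `D`. -/
def Rt (adj : E → E → Prop) (D : Set E) (G : E → E) (a b : E) : Prop :=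
  ∃ d, Relation.ReflTransGen (fun d d' => d' ∈ D ∧ adj (G d') d) b d ∧ adj a d

/-- A wave containing a hindrance becomes a hindrance after changing countably many values. -/
theorem IsWave.exists_hindrance (hr : ∀ a, adj a a) {Z S : Set E} {F g : E → E} {x : E}
    (hZ : IsWave adj K L Z F) (hS : IsWave adj K L S g) (hSZ : S ⊆ Z) (hx : x ∈ S)
    (hxg : ∀ b ∈ nb adj L S, g b ≠ x) :
    ∃ (Ω : Set E) (G : E → E), Ω.Countable ∧ Ω ⊆ nb adj L Z ∧ (∀ b ∉ Ω, G b = F b) ∧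
      IsWave adj K L Z G ∧ (∀ b ∈ nb adj L Z, G b ≠ x) ∧ (∀ b ∈ Ω, G b ∉ L → G b ∈ Ω) ∧
      ∀ b ∈ Ω, Rt adj (nb adj L Z) G x b := by
  classical
  let A : ℕ → Set E := fun n => Nat.rec {b | b ∈ nb adj L Z ∧ F b = x}
    (fun _ X => ⋃ b ∈ X, {b' | b' ∈ nb adj L Z ∧ F b' = g b} ∪ {b' | b' ∉ L ∧ b' = g b}) n
  have hA : ∀ n, A (n + 1) =
    ⋃ b ∈ A n, {b' | b' ∈ nb adj L Z ∧ F b' = g b} ∪ {b' | b' ∉ L ∧ b' = g b} := fun n => rfl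
  have hsub1 : ∀ y, {b' | b' ∈ nb adj L Z ∧ F b' = y}.Subsingleton :=
    fun y b hb b' hb' => hZ.inj hb.1 hb'.1 (hb.2.trans hb'.2.symm)
  have hcount : ∀ n, (A n).Countable := by
    intro n
    induction n with
    | zero => exact (hsub1 x).countable
    | succ n ih =>
      rw [hA]
      refine ih.biUnion fun b _ => (hsub1 _).countable.union ?_
      exact (Set.countable_singleton (g b)).mono fun d hd => hd.2
  have hAS : ∀ n, A n ⊆ nb adj L S := by
    intro n
    induction n with
    | zero => exact fun b hb => ⟨hb.1.1, x, hx, hb.2 ▸ hZ.rel b hb.1⟩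
    | succ n ih =>
      rw [hA]
      intro b' hb'
      simp only [Set.mem_iUnion] at hb'
      obtain ⟨b, hb, h | h⟩ := hb'
      · exact ⟨h.1.1, g b, hS.maps b (ih hb), h.2 ▸ hZ.rel b' h.1⟩
      · exact mem_nb_self hr (h.2 ▸ hS.maps b (ih hb)) h.1
  let Ω : Set E := ⋃ n, A n
  have hΩS : Ω ⊆ nb adj L S := Set.iUnion_subset hAS
  have hΩx : ∀ b ∈ nb adj L Z, F b = x → b ∈ Ω := fun b hb h => Set.mem_iUnion.2 ⟨0, hb, h⟩
  have hΩF : ∀ b ∈ Ω, ∀ b' ∈ nb adj L Z, F b' = g b → b' ∈ Ω := by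
    intro b hb b' hb' h
    obtain ⟨n, hn⟩ := Set.mem_iUnion.1 hb
    refine Set.mem_iUnion.2 ⟨n + 1, ?_⟩
    rw [hA]
    exact Set.mem_biUnion hn (Or.inl ⟨hb', h⟩)
  have hΩg : ∀ b ∈ Ω, g b ∉ L → g b ∈ Ω := by
    intro b hb h
    obtain ⟨n, hn⟩ := Set.mem_iUnion.1 hb
    refine Set.mem_iUnion.2 ⟨n + 1, ?_⟩
    rw [hA]
    exact Set.mem_biUnion hn (Or.inr ⟨h, rfl⟩)
  have hSZ' : nb adj L S ⊆ nb adj L Z := nb_mono hSZ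
  let G : E → E := fun b => if b ∈ Ω then g b else F b
  have hG1 : ∀ b ∈ Ω, G b = g b := fun b hb => if_pos hb
  have hG2 : ∀ b ∉ Ω, G b = F b := fun b hb => if_neg hb
  refine ⟨Ω, G, Set.countable_iUnion hcount, hΩS.trans hSZ', hG2, ⟨hZ.notMem, ?_, ?_, ?_, ?_⟩,
    ?_, ?_, ?_⟩
  · intro b hb
    by_cases h : b ∈ Ω
    · rw [hG1 b h]; exact hSZ (hS.maps b (hΩS h))
    · rw [hG2 b h]; exact hZ.maps b hb
  · intro b hb
    by_cases h : b ∈ Ω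
    · rw [hG1 b h]; exact hS.rel b (hΩS h)
    · rw [hG2 b h]; exact hZ.rel b hb
  · intro b hb b' hb' he
    by_cases h : b ∈ Ω <;> by_cases h' : b' ∈ Ω
    · rw [hG1 b h, hG1 b' h'] at he
      exact hS.inj (hΩS h) (hΩS h') he
    · rw [hG1 b h, hG2 b' h'] at he
      exact absurd (hΩF b h b' hb' he.symm) h'
    · rw [hG2 b h, hG1 b' h'] at he
      exact absurd (hΩF b' h' b hb he) h
    · rw [hG2 b h, hG2 b' h'] at he
      exact hZ.inj hb hb' he
  · refine NoRay.mix (D' := Ω) (f := F) (g := g) (hS.noRay.mono fun d hd => ⟨hΩS hd, rfl⟩)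
      (hZ.noRay.mono fun d hd => ⟨hd.1, rfl⟩) (fun d _ hd => hG1 d hd) (fun d _ hd => hG2 d hd)
      fun d _ hd hd' => hΩg d hd hd'.1
  · intro b hb
    by_cases h : b ∈ Ω
    · rw [hG1 b h]; exact hxg b (hΩS h)
    · rw [hG2 b h]; exact fun h' => h (hΩx b hb h')
  · intro b hb
    rw [hG1 b hb]
    exact hΩg b hb
  · have key : ∀ n, ∀ b ∈ A n, Rt adj (nb adj L Z) G x b := by
      intro n
      induction n with
      | zero => exact fun b hb => ⟨b, .refl, hb.2 ▸ hZ.rel b hb.1⟩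
      | succ n ih =>
        intro b' hb'
        rw [hA] at hb'
        simp only [Set.mem_iUnion] at hb'
        obtain ⟨b, hb, h⟩ := hb'
        have hbΩ : b ∈ Ω := Set.mem_iUnion.2 ⟨n, hb⟩
        obtain ⟨d, hd, hxd⟩ := ih b hb
        refine ⟨d, .head ⟨hSZ' (hΩS hbΩ), ?_⟩ hd, hxd⟩
        rw [hG1 b hbΩ]
        rcases h with h | h
        · exact h.2 ▸ hZ.rel b' h.1
        · rw [h.2]; exact hr _
    intro b hb
    obtain ⟨n, hn⟩ := Set.mem_iUnion.1 hb
    exact key n b hn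

end Hindrance

end Web

namespace Web

/-- A well-order `ι` of the type of the regular uncountable cardinal `μ`. -/
structure RegularOrder (μ : Cardinal.{u}) (ι : Type u) [LinearOrder ι] : Prop where
  isRegular : μ.IsRegular
  aleph0_lt : ℵ₀ < μ
  wf : WellFoundedLT ι
  nonempty : Nonempty ι
  mk_le : #ι = μ
  mk_Iio_lt : ∀ j : ι, #(Set.Iio j) < μ
  exists_gt : ∀ s : Set ι, #s < μ → ∃ j, ∀ i ∈ s, i < j

theorem exists_regularOrder {μ : Cardinal.{u}} (h : μ.IsRegular) (h0 : ℵ₀ < μ) :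
    ∃ (ι : Type u) (_ : LinearOrder ι), RegularOrder μ ι := by
  refine ⟨μ.ord.ToType, inferInstance, h, h0, inferInstance, ?_, by simp,
    fun j => by simpa using mk_Iio_lt j (by simp), fun s hs => ?_⟩
  · rw [← mk_ne_zero_iff]
    simpa using (aleph0_pos.trans h0).ne'
  · by_contra! hc
    have h1 : Order.cof μ.ord.ToType ≤ #s := Order.cof_le fun j => by
      obtain ⟨i, hi, hij⟩ := hc j
      exact ⟨i, hi, hij⟩
    rw [Ordinal.cof_toType, h.cof_ord] at h1
    exact absurd hs h1.not_gt

variable {ι : Type u} [LinearOrder ι]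

/-- `j` is closed under `h`. -/
def IsCl (h : ι → ι) (j : ι) : Prop := ∀ i < j, h i < j

/-- The filter generated by the sets of points closed under a function. -/
def clubF (ι : Type u) [LinearOrder ι] : Filter ι where
  sets := {s | ∃ h : ι → ι, ∀ j, (∃ i, i < j) → IsCl h j → j ∈ s}
  univ_sets := ⟨id, fun _ _ _ => trivial⟩
  sets_of_superset := fun ⟨h, hs⟩ hst => ⟨h, fun j hj hj' => hst (hs j hj hj')⟩
  inter_sets := fun ⟨h, hs⟩ ⟨h', hs'⟩ => ⟨fun i => max (h i) (h' i), fun j hj hj' =>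
    ⟨hs j hj fun i hi => (le_max_left _ _).trans_lt (hj' i hi),
      hs' j hj fun i hi => (le_max_right _ _).trans_lt (hj' i hi)⟩⟩

theorem eventually_clubF {p : ι → Prop} :
    (∀ᶠ j in clubF ι, p j) ↔ ∃ h : ι → ι, ∀ j, (∃ i, i < j) → IsCl h j → p j := Iff.rfl

theorem eventually_clubF_gt (i : ι) : ∀ᶠ j in clubF ι, i < j :=
  ⟨fun _ => i, fun _ ⟨k, hk⟩ h => h k hk⟩

theorem frequently_exists_gt {p : ι → Prop} (hp : ∃ᶠ j in clubF ι, p j) (i : ι) :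
    ∃ j, i < j ∧ p j :=
  (hp.and_eventually (eventually_clubF_gt i)).exists.imp fun _ h => ⟨h.2, h.1⟩

namespace RegularOrder

variable {μ : Cardinal.{u}} (H : RegularOrder μ ι)
include H

theorem mk_Iic_lt (j : ι) : #(Set.Iic j) < μ := by
  rw [← Set.Iio_insert]
  refine (mk_insert_le).trans_lt (add_lt_of_lt H.aleph0_lt.le (H.mk_Iio_lt j) ?_)
  exact one_lt_aleph0.trans H.aleph0_lt

theorem exists_gt_image {α : Type u} (s : Set α) (hs : #s < μ) (f : α → ι) :
    ∃ j, ∀ a ∈ s, f a < j := by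
  obtain ⟨j, hj⟩ := H.exists_gt (f '' s) (mk_image_le.trans_lt hs)
  exact ⟨j, fun a ha => hj _ ⟨a, ha, rfl⟩⟩

theorem exists_gt' (i : ι) : ∃ j, i < j := by
  obtain ⟨j, hj⟩ := H.exists_gt {i} (by simpa using one_lt_aleph0.trans H.aleph0_lt)
  exact ⟨j, hj i rfl⟩

theorem exists_isCl (h : ι → ι) (i₀ : ι) : ∃ j, i₀ < j ∧ IsCl h j := by
  have hex : ∀ i, ∃ j, i < j ∧ ∀ k ≤ i, h k < j := by
    intro i
    obtain ⟨j, hj⟩ := H.exists_gt_image (Set.Iic i) (H.mk_Iic_lt i) h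
    obtain ⟨j', hj'⟩ := H.exists_gt' (max i j)
    exact ⟨j', (le_max_left _ _).trans_lt hj',
      fun k hk => (hj k hk).trans ((le_max_right _ _).trans_lt hj')⟩
  choose n hn hn' using hex
  let c : ℕ → ι := fun m => n^[m] i₀
  have hc : ∀ m, c (m + 1) = n (c m) := fun m => Function.iterate_succ_apply' n m i₀
  have hne : {j | ∀ m, c m < j}.Nonempty := by
    obtain ⟨b, hb⟩ := H.exists_gt (Set.range c)
      ((Set.countable_range c).le_aleph0.trans_lt H.aleph0_lt)
    exact ⟨b, fun m => hb _ ⟨m, rfl⟩⟩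
  have := H.wf
  let j := wellFounded_lt.min _ hne
  have hj : ∀ m, c m < j := wellFounded_lt.min_mem _ hne
  refine ⟨j, hj 0, fun i hi => ?_⟩
  have : ∃ m, i ≤ c m := by
    by_contra! hc'
    exact wellFounded_lt.not_lt_min {j | ∀ m, c m < j} hc' hi
  obtain ⟨m, hm⟩ := this
  calc h i < n (c m) := hn' _ _ hm
    _ = c (m + 1) := (hc m).symm
    _ < j := hj _

theorem neBot : (clubF ι).NeBot := by
  refine Filter.neBot_iff.2 fun hb => ?_
  have h : ∀ᶠ _ in clubF ι, False := by rw [hb]; exact Filter.eventually_bot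
  obtain ⟨h, hh⟩ := h
  obtain ⟨i⟩ := H.nonempty
  obtain ⟨j, hj, hj'⟩ := H.exists_isCl h i
  exact hh j ⟨i, hj⟩ hj'

theorem eventually_limit : ∀ᶠ j in clubF ι, ∀ i < j, ∃ m, i < m ∧ m < j := by
  choose s hs using H.exists_gt'
  exact ⟨s, fun j _ hj i hi => ⟨s i, hs i, hj i hi⟩⟩

theorem eventually_forall_lt {p : ι → ι → Prop} (hp : ∀ i, ∀ᶠ j in clubF ι, p i j) :
    ∀ᶠ j in clubF ι, ∀ i < j, p i j := by
  choose h hh using hp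
  have hex : ∀ k, ∃ b, ∀ i ≤ k, ∀ k' ≤ k, h i k' < b := by
    intro k
    have : ∀ i, ∃ b, ∀ k' ≤ k, h i k' < b := fun i =>
      H.exists_gt_image (Set.Iic k) (H.mk_Iic_lt k) (h i)
    choose b hb using this
    obtain ⟨b', hb'⟩ := H.exists_gt_image (Set.Iic k) (H.mk_Iic_lt k) b
    exact ⟨b', fun i hi k' hk' => (hb i k' hk').trans (hb' i hi)⟩
  choose b hb using hex
  refine ⟨b, fun j hj hcl i hi => hh i j hj fun k hk => ?_⟩
  exact (hb (max i k) i (le_max_left _ _) k (le_max_right _ _)).trans (hcl _ (max_lt hi hk))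

theorem eventually_forall_mem {α : Type u} {s : Set α} (hs : #s < μ) {p : α → ι → Prop}
    (hp : ∀ a ∈ s, ∀ᶠ j in clubF ι, p a j) : ∀ᶠ j in clubF ι, ∀ a ∈ s, p a j := by
  have hp' : ∀ a, ∃ h : ι → ι, a ∈ s → ∀ j, (∃ i, i < j) → IsCl h j → p a j := by
    intro a
    by_cases ha : a ∈ s
    · obtain ⟨h, hh⟩ := hp a ha
      exact ⟨h, fun _ => hh⟩
    · exact ⟨id, fun h => absurd h ha⟩
  choose h hh using hp'
  have hex : ∀ k, ∃ b, ∀ a ∈ s, h a k < b := fun k => H.exists_gt_image s hs fun a => h a k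
  choose b hb using hex
  exact ⟨b, fun j hj hcl a ha => hh a ha j hj fun k hk => (hb k a ha).trans (hcl k hk)⟩

theorem eventually_forall_mem_iUnion {α : Type u} {S : ι → Set α} (hS : ∀ i, #(S i) < μ)
    {p : α → ι → Prop} (hp : ∀ a ∈ ⋃ i, S i, ∀ᶠ j in clubF ι, p a j) :
    ∀ᶠ j in clubF ι, ∀ a ∈ ⋃ i < j, S i, p a j := by
  filter_upwards [H.eventually_forall_lt fun i => H.eventually_forall_mem (hS i) fun a ha =>
    hp a (Set.mem_iUnion.2 ⟨i, ha⟩)] with j hj a ha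
  simp only [Set.mem_iUnion] at ha
  obtain ⟨i, hi, ha⟩ := ha
  exact hj i hi a ha

theorem mk_biUnion_lt {α : Type u} {S : ι → Set α} (hS : ∀ i, #(S i) < μ) (j : ι) :
    #(⋃ i < j, S i : Set α) < μ := by
  have : #(⋃ i ∈ Set.Iio j, S i : Set α) < μ :=
    (card_biUnion_lt_iff_forall_of_isRegular H.isRegular (H.mk_Iio_lt j)).2 fun i _ => hS i
  exact this

theorem exists_chain {α : Type u} (P : (ι → Set α) → ι → Set α → Prop)
    (hP : ∀ U i, (∀ k, #(U k) < μ) → ∃ s : Set α, #s < μ ∧ P U i s) :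
    ∃ S : ι → Set α, (∀ i, #(S i) < μ) ∧ ∀ i, P (fun k => ⋃ l < min k i, S l) i (S i) := by
  classical
  have := H.wf
  have hP' : ∀ U i, ∃ s : Set α, #s < μ ∧ ((∀ k, #(U k) < μ) → P U i s) := by
    intro U i
    by_cases h : ∀ k, #(U k) < μ
    · obtain ⟨s, hs, hs'⟩ := hP U i h
      exact ⟨s, hs, fun _ => hs'⟩
    · exact ⟨∅, by simpa using aleph0_pos.trans H.aleph0_lt, fun h' => absurd h' h⟩
  choose s hs hsP using hP'
  let G : (i : ι) → ((l : ι) → l < i → Set α) → Set α := fun i rec =>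
    s (fun k => ⋃ l, ⋃ h : l < min k i, rec l (h.trans_le (min_le_right _ _))) i
  let S : ι → Set α := wellFounded_lt.fix G
  have hS : ∀ i, S i = s (fun k => ⋃ l < min k i, S l) i := fun i => wellFounded_lt.fix_eq G i
  have hsm : ∀ i, #(S i) < μ := fun i => by rw [hS]; exact hs _ _
  refine ⟨S, hsm, fun i => ?_⟩
  have h1 := hsP (fun k => ⋃ l < min k i, S l) i fun k => H.mk_biUnion_lt hsm _
  rwa [← hS] at h1

theorem exists_injective_choice {α : Type u} (hα : #α ≤ μ) (T : α → Set ι)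
    (hT : ∀ a i, ∃ j ∈ T a, i < j) : ∃ φ : α → ι, Function.Injective φ ∧ ∀ a, φ a ∈ T a := by
  classical
  have := H.wf
  obtain ⟨e⟩ : Nonempty (α ↪ ι) := by rwa [← H.mk_le] at hα
  have hwf : WellFounded (InvImage (· < ·) e) := InvImage.wf e wellFounded_lt
  have hsm : ∀ a, #{b // e b < e a} < μ := by
    intro a
    refine lt_of_le_of_lt ?_ (H.mk_Iio_lt (e a))
    exact mk_le_of_injective (f := fun b : {b // e b < e a} => (⟨e b, b.2⟩ : Set.Iio (e a)))
      fun b c h => Subtype.ext (e.injective (congrArg Subtype.val h))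
  have hex : ∀ a (rec : (b : α) → InvImage (· < ·) e b a → ι), ∃ j ∈ T a, ∀ b h, rec b h < j := by
    intro a rec
    obtain ⟨i, hi⟩ := H.exists_gt (Set.range fun b : {b // e b < e a} => rec b.1 b.2)
      (mk_range_le.trans_lt (hsm a))
    obtain ⟨j, hj, hij⟩ := hT a i
    exact ⟨j, hj, fun b h => (hi _ ⟨⟨b, h⟩, rfl⟩).trans hij⟩
  choose G hG1 hG2 using hex
  let φ : α → ι := hwf.fix G
  have hφ : ∀ a, φ a = G a fun b _ => φ b := fun a => hwf.fix_eq G a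
  have hlt : ∀ a b, e b < e a → φ b < φ a := by
    intro a b h
    rw [hφ a]
    exact hG2 a (fun b _ => φ b) b h
  refine ⟨φ, fun a b h => ?_, fun a => by rw [hφ]; exact hG1 _ _⟩
  rcases lt_trichotomy (e a) (e b) with h' | h' | h'
  · exact absurd h (hlt _ _ h').ne
  · exact e.injective h'
  · exact absurd h.symm (hlt _ _ h').ne

theorem exists_greatest_isCl (h : ι → ι) (l : ι) :
    ∃ i ≤ l, IsCl h i ∧ ∀ k, IsCl h k → k ≤ l → k ≤ i := by
  have := H.wf
  have hne : {i | ∀ k, IsCl h k → k ≤ l → k ≤ i}.Nonempty := ⟨l, fun k _ hk => hk⟩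
  refine ⟨wellFounded_lt.min _ hne, wellFounded_lt.min_le (fun k _ hk => hk),
    fun i hi => ?_, wellFounded_lt.min_mem _ hne⟩
  have : ¬ ∀ k, IsCl h k → k ≤ l → k ≤ i := fun h' =>
    wellFounded_lt.not_lt_min {i | ∀ k, IsCl h k → k ≤ l → k ≤ i} h' hi
  push Not at this
  obtain ⟨k, hk, hkl, hik⟩ := this
  exact (hk i hik).trans_le (wellFounded_lt.min_mem _ hne k hk hkl)

end RegularOrder

end Web

namespace Web

variable {E : Type u}

section LargestWave

variable (adj : E → E → Prop) (K L : Set E)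

open Classical in
/-- A largest wave of `(K, L)`. -/
noncomputable def largestWave : Set E × (E → E) :=
  Classical.epsilon (h := ⟨(∅, id)⟩) fun p : Set E × (E → E) =>
    IsWave adj K L p.1 p.2 ∧ ∀ S g, IsWave adj K L S g → S ⊆ p.1

/-- The vertex set of a largest wave after deleting both copies of `A`. -/
noncomputable def waveSet (A : Set E) : Set E := (largestWave adj (K ∪ A) (L ∪ A)).1

/-- The matching of a largest wave after deleting both copies of `A`. -/
noncomputable def waveFun (A : Set E) : E → E := (largestWave adj (K ∪ A) (L ∪ A)).2

/-- The right vertices matched by a largest wave after deleting both copies of `A`. -/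
def waveDom (A : Set E) : Set E := nb adj (L ∪ A) (waveSet adj K L A)

variable {adj K L}

theorem largestWave_spec (hr : ∀ a, adj a a) : IsWave adj K L (largestWave adj K L).1
    (largestWave adj K L).2 ∧ ∀ S g, IsWave adj K L S g → S ⊆ (largestWave adj K L).1 := by
  obtain ⟨Z, f, h⟩ := exists_largest hr K L
  exact Classical.epsilon_spec (p := fun p : Set E × (E → E) =>
    IsWave adj K L p.1 p.2 ∧ ∀ S g, IsWave adj K L S g → S ⊆ p.1) ⟨(Z, f), h⟩

theorem isWave_waveSet (hr : ∀ a, adj a a) (A : Set E) :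
    IsWave adj (K ∪ A) (L ∪ A) (waveSet adj K L A) (waveFun adj K L A) := (largestWave_spec hr).1

theorem subset_waveSet (hr : ∀ a, adj a a) {A S : Set E} {g : E → E}
    (h : IsWave adj (K ∪ A) (L ∪ A) S g) : S ⊆ waveSet adj K L A := (largestWave_spec hr).2 S g h

end LargestWave

/-- `t` is the list of inner vertices of an alternating route from `a` to `b`. -/
structure IsRoute (adj : E → E → Prop) (D : Set E) (G : E → E) (a b : E) (t : List E) : Prop where
  chain : (b :: t).IsChain fun d d' => d' ∈ D ∧ adj (G d') d
  nodup : (b :: t).Nodup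
  last : ∀ l ∈ (b :: t).getLast?, adj a l

theorem Rt.exists_isRoute {adj : E → E → Prop} {D : Set E} {G : E → E} {a b : E}
    (h : Rt adj D G a b) : ∃ t, IsRoute adj D G a b t := by
  obtain ⟨d, hd, had⟩ := h
  obtain ⟨t, h1, h2, h3⟩ := exists_route hd
  exact ⟨t, h1, h2, fun l hl => by rw [h3] at hl; cases hl; exact had⟩

theorem IsRoute.mem {adj : E → E → Prop} {D : Set E} {G : E → E} {a b : E} {t : List E}
    (h : IsRoute adj D G a b t) : ∀ e ∈ t, e ∈ D := mem_of_isChain_cons h.chain fun _ _ h => h.1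

theorem IsRoute.congr {adj : E → E → Prop} {D : Set E} {G G' : E → E} {a b : E} {t : List E}
    (h : IsRoute adj D G a b t) (hG : ∀ d ∈ D, G d = G' d) : IsRoute adj D G' a b t :=
  ⟨h.chain.imp fun a b (hab : b ∈ D ∧ adj (G b) a) => ⟨hab.1, hG _ hab.1 ▸ hab.2⟩, h.nodup, h.last⟩

theorem Rt.congr {adj : E → E → Prop} {D : Set E} {G G' : E → E} {a b : E}
    (h : Rt adj D G a b) (hG : ∀ d ∈ D, G d = G' d) : Rt adj D G' a b := by
  obtain ⟨d, hd, had⟩ := h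
  exact ⟨d, Relation.ReflTransGen.mono (fun _ _ h => ⟨h.1, hG _ h.1 ▸ h.2⟩) _ _ hd, had⟩

/-- The data of a hindrance `(Z, G)` missing `x` that differs from `F` only on `Ω`. -/
structure HindData (adj : E → E → Prop) (K L Z : Set E) (F : E → E) (x : E) (Ω : Set E)
    (G : E → E) : Prop where
  mem : x ∈ Z
  subset : Ω ⊆ nb adj L Z
  eq : ∀ b ∉ Ω, G b = F b
  wave : IsWave adj K L Z G
  ne : ∀ b ∈ nb adj L Z, G b ≠ x
  closed : ∀ b ∈ Ω, G b ∉ L → G b ∈ Ω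
  reach : ∀ b ∈ Ω, Rt adj (nb adj L Z) G x b

theorem HindData.congr {adj : E → E → Prop} {K L Z : Set E} {F F' : E → E} {x : E} {Ω : Set E}
    {G : E → E} (h : HindData adj K L Z F x Ω G) (hF : ∀ b ∈ nb adj L Z, F b = F' b) :
    ∃ G', HindData adj K L Z F' x Ω G' ∧ ∀ b ∈ nb adj L Z, G' b = G b := by
  classical
  have hG : ∀ b ∈ nb adj L Z, (if b ∈ Ω then G b else F' b) = G b := by
    intro b hb
    by_cases hΩ : b ∈ Ω <;> simp only [hΩ, if_true, if_false]
    rw [h.eq b hΩ, hF b hb]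
  refine ⟨fun b => if b ∈ Ω then G b else F' b, ⟨h.mem, h.subset, fun b hb => if_neg hb,
    ⟨h.wave.notMem, ?_, ?_, ?_, h.wave.noRay.mono fun d hd => ⟨hd, hG d hd⟩⟩, ?_, ?_, ?_⟩, hG⟩
  · intro b hb; rw [hG b hb]; exact h.wave.maps b hb
  · intro b hb; rw [hG b hb]; exact h.wave.rel b hb
  · intro b hb b' hb' he
    exact h.wave.inj hb hb' (by rwa [← hG b hb, ← hG b' hb'])
  · intro b hb; rw [hG b hb]; exact h.ne b hb
  · intro b hb; rw [hG b (h.subset hb)]; exact h.closed b hb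
  · exact fun b hb => (h.reach b hb).congr fun d hd => (hG d hd).symm

theorem IsWave.exists_hindData {adj : E → E → Prop} (hr : ∀ a, adj a a) {K L Z : Set E}
    {F : E → E} (hZ : IsWave adj K L Z F) (hh : Hindered adj K L)
    (hmax : ∀ S g, IsWave adj K L S g → S ⊆ Z) :
    ∃ x Ω G, Ω.Countable ∧ HindData adj K L Z F x Ω G := by
  obtain ⟨S, g, hS, x, hx, hxg⟩ := hh
  obtain ⟨Ω, G, h1, h2, h3, h4, h5, h6, h7⟩ := hZ.exists_hindrance hr hS (hmax S g hS) hx hxg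
  exact ⟨x, Ω, G, h1, hmax S g hS hx, h2, h3, h4, h5, h6, h7⟩

variable {ι : Type u} [LinearOrder ι] {μ : Cardinal.{u}}

theorem RegularOrder.mk_union_lt (H : RegularOrder μ ι) {s t : Set E} (hs : #s < μ)
    (ht : #t < μ) : #(s ∪ t : Set E) < μ :=
  (mk_union_le s t).trans_lt (add_lt_of_lt H.aleph0_lt.le hs ht)

theorem RegularOrder.mk_iUnion_lt (H : RegularOrder μ ι) {α : Type u} {s : Set α} (hs : #s < μ)
    {f : α → Set E} (hf : ∀ a, #(f a) < μ) : #(⋃ a ∈ s, f a : Set E) < μ :=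
  (card_biUnion_lt_iff_forall_of_isRegular H.isRegular hs).2 fun a _ => hf a

theorem RegularOrder.mk_countable_lt (H : RegularOrder μ ι) {s : Set E} (hs : s.Countable) :
    #s < μ := hs.le_aleph0.trans_lt H.aleph0_lt

theorem RegularOrder.exists_small_routes (H : RegularOrder μ ι) {adj : E → E → Prop}
    {A : Set E} (hA : #A < μ)
    (D : Set E) (G : E → E) (a : E) : ∃ s : Set E, #s < μ ∧ ∀ b ∈ A, Rt adj D G a b →
      ∃ t, IsRoute adj D G a b t ∧ ∀ e ∈ t, e ∈ s := by
  classical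
  have hex : ∀ b, ∃ t, Rt adj D G a b → IsRoute adj D G a b t := by
    intro b
    by_cases h : Rt adj D G a b
    · obtain ⟨t, ht⟩ := h.exists_isRoute
      exact ⟨t, fun _ => ht⟩
    · exact ⟨[], fun h' => absurd h' h⟩
  choose t ht using hex
  refine ⟨⋃ b ∈ A, {e | e ∈ t b},
    H.mk_iUnion_lt hA fun b => H.mk_countable_lt (t b).finite_toSet.countable, fun b hb hR => ?_⟩
  exact ⟨t b, ht b hR, fun e he => Set.mem_biUnion hb he⟩

section Chain

variable (adj : E → E → Prop) (K L : Set E)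

/-- The requirements on the `i`-th increment `s` of the chain `U`. -/
structure Stage (X : ι → Set E) (U : ι → Set E) (F : E → E) (i : ι) (s : Set E) : Prop where
  subset : U i ⊆ s
  target : X i ⊆ s
  image : ∀ k ≤ i, ∀ b ∈ waveDom adj K L (U k), b ∈ U i → waveFun adj K L (U k) b ∈ s
  preimage : ∀ k ≤ i, ∀ b ∈ waveDom adj K L (U k), waveFun adj K L (U k) b ∈ U i → b ∈ s
  route : ∀ a ∈ U i, ∀ b ∈ U i, Rt adj (waveDom adj K L (U i)) F a b →
    ∃ t, IsRoute adj (waveDom adj K L (U i)) F a b t ∧ ∀ e ∈ t, e ∈ s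
  rich : ∀ a ∈ U i, (∃ y ∈ nb adj (L ∪ U i) {a}, y ∉ waveDom adj K L (U i)) →
    ∃ y ∈ nb adj (L ∪ U i) {a}, y ∉ waveDom adj K L (U i) ∧ y ∈ s
  hind : Hindered adj (K ∪ U i) (L ∪ U i) →
    IsWave adj (K ∪ U i) (L ∪ U i) (waveSet adj K L (U i)) F →
    ∃ x Ω G, HindData adj (K ∪ U i) (L ∪ U i) (waveSet adj K L (U i)) F x Ω G ∧
      Ω ⊆ s ∧ (∀ b ∈ Ω, G b ∈ s) ∧ x ∈ s ∧
      ∀ b ∈ U i, Rt adj (waveDom adj K L (U i)) G x b →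
        ∃ t, IsRoute adj (waveDom adj K L (U i)) G x b t ∧ ∀ e ∈ t, e ∈ s

variable {adj K L}

theorem RegularOrder.exists_stage (H : RegularOrder μ ι) (hr : ∀ a, adj a a) {X : ι → Set E}
    (hX : ∀ i, #(X i) < μ) (U : ι → Set E) (i : ι) (hU : ∀ k, #(U k) < μ) (F : E → E) :
    ∃ s : Set E, #s < μ ∧ Stage adj K L X U F i s := by
  classical
  have hi := H.mk_Iic_lt i
  have hpre : ∀ k, #{b | b ∈ waveDom adj K L (U k) ∧ waveFun adj K L (U k) b ∈ U i} < μ := by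
    intro k
    refine lt_of_le_of_lt ?_ (hU i)
    refine mk_le_of_injective (f := fun b => (⟨waveFun adj K L (U k) b.1, b.2.2⟩ : U i)) ?_
    intro b b' h
    exact Subtype.ext ((isWave_waveSet hr (U k)).inj b.2.1 b'.2.1 (congrArg Subtype.val h))
  choose s₄ hs₄ hs₄' using fun a => H.exists_small_routes (adj := adj) (hU i)
    (waveDom adj K L (U i)) F a
  have hrich : ∀ a, ∃ y, (∃ y ∈ nb adj (L ∪ U i) {a}, y ∉ waveDom adj K L (U i)) →
      y ∈ nb adj (L ∪ U i) {a} ∧ y ∉ waveDom adj K L (U i) := by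
    intro a
    by_cases h : ∃ y ∈ nb adj (L ∪ U i) {a}, y ∉ waveDom adj K L (U i)
    · exact ⟨h.choose, fun _ => h.choose_spec⟩
    · exact ⟨a, fun h' => absurd h' h⟩
  choose y hy using hrich
  obtain ⟨s₆, hs₆, hs₆'⟩ : ∃ s : Set E, #s < μ ∧ (Hindered adj (K ∪ U i) (L ∪ U i) →
    IsWave adj (K ∪ U i) (L ∪ U i) (waveSet adj K L (U i)) F →
    ∃ x Ω G, HindData adj (K ∪ U i) (L ∪ U i) (waveSet adj K L (U i)) F x Ω G ∧
      Ω ⊆ s ∧ (∀ b ∈ Ω, G b ∈ s) ∧ x ∈ s ∧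
      ∀ b ∈ U i, Rt adj (waveDom adj K L (U i)) G x b →
        ∃ t, IsRoute adj (waveDom adj K L (U i)) G x b t ∧ ∀ e ∈ t, e ∈ s) := by
    by_cases hh : Hindered adj (K ∪ U i) (L ∪ U i) ∧
      IsWave adj (K ∪ U i) (L ∪ U i) (waveSet adj K L (U i)) F
    · obtain ⟨x, Ω, G, hΩ, hG⟩ := hh.2.exists_hindData hr hh.1 fun S g h => subset_waveSet hr h
      obtain ⟨s, hs, hs'⟩ := H.exists_small_routes (adj := adj) (hU i)
        (waveDom adj K L (U i)) G x
      refine ⟨Ω ∪ G '' Ω ∪ {x} ∪ s, H.mk_union_lt (H.mk_countable_lt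
        ((hΩ.union (hΩ.image G)).union (Set.countable_singleton x))) hs, fun _ _ =>
        ⟨x, Ω, G, hG, fun b hb => by simp [hb], fun b hb => ?_, by simp, fun b hb hR => ?_⟩⟩
      · exact Or.inl (Or.inl (Or.inr ⟨b, hb, rfl⟩))
      · obtain ⟨t, ht, ht'⟩ := hs' b hb hR
        exact ⟨t, ht, fun e he => Or.inr (ht' e he)⟩
    · exact ⟨∅, by simpa using aleph0_pos.trans H.aleph0_lt, fun h1 h2 => absurd ⟨h1, h2⟩ hh⟩
  refine ⟨U i ∪ X i ∪ (⋃ k ∈ Set.Iic i, waveFun adj K L (U k) '' U i) ∪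
    (⋃ k ∈ Set.Iic i, {b | b ∈ waveDom adj K L (U k) ∧ waveFun adj K L (U k) b ∈ U i}) ∪
    (⋃ a ∈ U i, s₄ a) ∪ y '' U i ∪ s₆, ?_, ?_⟩
  · exact H.mk_union_lt (H.mk_union_lt (H.mk_union_lt (H.mk_union_lt (H.mk_union_lt
      (H.mk_union_lt (hU i) (hX i)) (H.mk_iUnion_lt hi fun k => mk_image_le.trans_lt (hU i)))
      (H.mk_iUnion_lt hi hpre)) (H.mk_iUnion_lt (hU i) hs₄)) (mk_image_le.trans_lt (hU i))) hs₆
  · constructor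
    · exact fun a ha => by simp [ha]
    · exact fun a ha => by simp [ha]
    · intro k hk b _ hb
      refine Or.inl (Or.inl (Or.inl (Or.inl (Or.inr ?_))))
      exact Set.mem_biUnion (Set.mem_Iic.2 hk) ⟨b, hb, rfl⟩
    · intro k hk b hb hb'
      refine Or.inl (Or.inl (Or.inl (Or.inr ?_)))
      exact Set.mem_biUnion (Set.mem_Iic.2 hk) ⟨hb, hb'⟩
    · intro a ha b hb hR
      obtain ⟨t, ht, ht'⟩ := hs₄' a b hb hR
      exact ⟨t, ht, fun e he => Or.inl (Or.inl (Or.inr (Set.mem_biUnion ha (ht' e he))))⟩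
    · intro a ha h
      exact ⟨y a, (hy a h).1, (hy a h).2, Or.inl (Or.inr ⟨a, ha, rfl⟩)⟩
    · intro h1 h2
      obtain ⟨x, Ω, G, h3, h4, h5, h6, h7⟩ := hs₆' h1 h2
      refine ⟨x, Ω, G, h3, fun b hb => Or.inr (h4 hb), fun b hb => Or.inr (h5 b hb), Or.inr h6,
        fun b hb hR => ?_⟩
      obtain ⟨t, ht, ht'⟩ := h7 b hb hR
      exact ⟨t, ht, fun e he => Or.inr (ht' e he)⟩

variable [WellFoundedLT ι]

variable (adj K L) in
/-- The matching that uses, on each vertex, the first largest wave matching it. -/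
noncomputable def chainFun (U : ι → Set E) : E → E :=
  coh (fun k => waveDom adj K L (U k)) fun k => waveFun adj K L (U k)

variable (μ adj K L) in
/-- A chain `U` with increments `S` satisfying the requirements at every stage. -/
structure IsTower (X S U : ι → Set E) : Prop where
  eq : ∀ k, U k = ⋃ l < k, S l
  small : ∀ i, #(S i) < μ
  stage : ∀ i, Stage adj K L X U (chainFun adj K L U) i (S i)

theorem chainFun_min_eq {U : ι → Set E} {i k : ι} (hk : k ≤ i) {b : E}
    (hb : b ∈ waveDom adj K L (U k)) :
    chainFun adj K L (fun k => U (min k i)) b = chainFun adj K L U b := by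
  obtain ⟨k₁, h1, h2, h3⟩ := coh_spec (D := fun k => waveDom adj K L (U k))
    (f := fun k => waveFun adj K L (U k)) ⟨k, hb⟩
  obtain ⟨k₂, h1', h2', h3'⟩ := coh_spec (D := fun k => waveDom adj K L (U (min k i)))
    (f := fun k => waveFun adj K L (U (min k i))) (b := b) ⟨k, by simpa [hk] using hb⟩
  have hk₁ : k₁ ≤ k := by
    by_contra! h
    exact h3 k h hb
  have hk₂ : k₂ ≤ k := by
    by_contra! h
    exact h3' k h (by simpa [hk] using hb)
  have e1 : min k₁ i = k₁ := min_eq_left (hk₁.trans hk)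
  have e2 : min k₂ i = k₂ := min_eq_left (hk₂.trans hk)
  rw [e2] at h1' h2'
  have : k₁ = k₂ := by
    rcases lt_trichotomy k₁ k₂ with h | h | h
    · exact absurd (by simpa only [e1] using h1) (h3' k₁ h)
    · exact h
    · exact absurd h1' (h3 k₂ h)
  subst this
  exact h2'.trans h2.symm

theorem RegularOrder.exists_tower (H : RegularOrder μ ι) (hr : ∀ a, adj a a) {X : ι → Set E}
    (hX : ∀ i, #(X i) < μ) : ∃ S U, IsTower μ adj K L X S U := by
  obtain ⟨S, hS, hS'⟩ := H.exists_chain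
    (fun U i s => Stage adj K L X U (chainFun adj K L U) i s)
    fun U i hU => H.exists_stage hr hX U i hU _
  let U : ι → Set E := fun k => ⋃ l < k, S l
  refine ⟨S, U, fun k => rfl, hS, fun i => ?_⟩
  have h : Stage adj K L X (fun k => U (min k i)) (chainFun adj K L fun k => U (min k i)) i (S i) :=
    hS' i
  have hmin : ∀ k ≤ i, U (min k i) = U k := fun k hk => by rw [min_eq_left hk]
  have hF : ∀ b ∈ waveDom adj K L (U i),
      chainFun adj K L (fun k => U (min k i)) b = chainFun adj K L U b :=
    fun b hb => chainFun_min_eq le_rfl hb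
  obtain ⟨h1, h2, h3, h4, h5, h6, h7⟩ := h
  simp only [min_self] at h1 h2 h3 h4 h5 h6 h7
  refine ⟨h1, h2, ?_, ?_, ?_, h6, ?_⟩
  · intro k hk b hb; have := h3 k hk b; rw [hmin k hk] at this; exact this hb
  · intro k hk b hb; have := h4 k hk b; rw [hmin k hk] at this; exact this hb
  · intro a ha b hb hR
    obtain ⟨t, ht, ht'⟩ := h5 a ha b hb (hR.congr fun d hd => (hF d hd).symm)
    exact ⟨t, ht.congr hF, ht'⟩
  · intro hh hw
    obtain ⟨x, Ω, G, hG, g1, g2, g3, g4⟩ := h7 hh ⟨hw.notMem,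
      fun b hb => by rw [hF b hb]; exact hw.maps b hb,
      fun b hb => by rw [hF b hb]; exact hw.rel b hb,
      fun b hb b' hb' he => by
        rw [hF b hb, hF b' hb'] at he; exact hw.inj hb hb' he,
      hw.noRay.mono fun d hd => ⟨hd, hF d hd⟩⟩
    obtain ⟨G', hG', hGG⟩ := hG.congr hF
    refine ⟨x, Ω, G', hG', g1, fun b hb => ?_, g3, fun b hb hR => ?_⟩
    · rw [hGG b (hG.subset hb)]; exact g2 b hb
    · obtain ⟨t, ht, ht'⟩ := g4 b hb (hR.congr hGG)
      exact ⟨t, ht.congr fun d hd => (hGG d hd).symm, ht'⟩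

end Chain

end Web

namespace Web

/-- Rays cannot use the special values of a function whose special values sit on disjoint levels
preserved by all steps. -/
theorem NoRay.of_levels {E : Type u} {ι : Type u} [LinearOrder ι]
    {U : ι → Set E} {D : Set E} {F h : E → E} {Lv : Set ι} {R : ι → Set E}
    (hR : ∀ l ∈ Lv, R l ∩ U l = ∅)
    (hR' : ∀ l ∈ Lv, ∀ k, l < k → R l ⊆ U k)
    (hstep : ∀ l ∈ Lv, ∀ d ∈ D, h d ∈ D → (h d ∈ U l ↔ d ∈ U l)) (hF : NoRay D F)
    (heq : ∀ d ∈ D, (∀ l ∈ Lv, d ∉ R l) → h d = F d)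
    (hlev : ∀ l ∈ Lv, ∃ f, NoRay D f ∧
      ∀ d ∈ D, (∀ l' ∈ Lv, l' ≠ l → d ∉ R l') → h d = f d) : NoRay D h := by
  intro u hu hD
  by_cases hex : ∃ N, ∃ l ∈ Lv, u N ∈ R l
  · obtain ⟨N, l, hl, hN⟩ := hex
    obtain ⟨f, hf, hff⟩ := hlev l hl
    have key : ∀ l' ∈ Lv, ∀ n ≥ N, (u n ∈ U l' ↔ u N ∈ U l') := by
      intro l' hl' n hn
      induction n, hn using Nat.le_induction with
      | base => rfl
      | succ n _ ih =>
        rw [← ih, (hD n).2]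
        exact hstep l' hl' _ (hD n).1 ((hD n).2 ▸ (hD (n + 1)).1)
    refine hf.tail hu N fun n hn => ⟨(hD n).1, (hD n).2.trans (hff _ (hD n).1 ?_)⟩
    intro l' hl' hne hmem
    rcases lt_or_gt_of_ne hne with hlt | hlt
    · have h1 : u N ∈ U l := (key l hl n hn).1 (hR' l' hl' l hlt hmem)
      exact (hR l hl).le ⟨hN, h1⟩
    · have h1 : u n ∈ U l' := (key l' hl' n hn).2 (hR' l hl l' hlt hN)
      exact (hR l' hl').le ⟨hmem, h1⟩
  · push Not at hex
    exact hF u hu fun n => ⟨(hD n).1, (hD n).2.trans (heq _ (hD n).1 fun l hl => hex n l hl)⟩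

theorem notMem_of_mem_waveDom {E : Type u} {adj : E → E → Prop} {K L A : Set E} {b : E}
    (hb : b ∈ waveDom adj K L A) :
    b ∉ L ∧ b ∉ A := ⟨fun h => hb.1 (Or.inl h), fun h => hb.1 (Or.inr h)⟩

theorem waveFun_notMem {E : Type u} {adj : E → E → Prop} {K L : Set E} (hr : ∀ a, adj a a)
    {A : Set E} {b : E} (hb : b ∈ waveDom adj K L A) :
    waveFun adj K L A b ∉ A := fun h =>
  (isWave_waveSet hr A).notMem _ ((isWave_waveSet hr A).maps b hb) (Or.inr h)

variable {E : Type u} {ι : Type u} [LinearOrder ι] [WellFoundedLT ι] {μ : Cardinal.{u}}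
  {adj : E → E → Prop} {K L : Set E} {X S U : ι → Set E}

theorem chainFun_spec {b : E} (hb : b ∈ ⋃ k, waveDom adj K L (U k)) :
    ∃ k, b ∈ waveDom adj K L (U k) ∧ chainFun adj K L U b = waveFun adj K L (U k) b ∧
      ∀ l < k, b ∉ waveDom adj K L (U l) := coh_spec (Set.mem_iUnion.1 hb)

theorem chainFun_noRay (hr : ∀ a, adj a a) :
    NoRay (⋃ k, waveDom adj K L (U k)) (chainFun adj K L U) := by
  refine coh_noRay (fun k => (isWave_waveSet hr (U k)).noRay) fun k b hb h => ?_
  obtain ⟨k', hk'⟩ := Set.mem_iUnion.1 h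
  refine mem_nb_self hr ((isWave_waveSet hr (U k)).maps b hb) ?_
  rintro (h' | h')
  exacts [(notMem_of_mem_waveDom hk').1 h', waveFun_notMem hr hb h']

theorem chainFun_rel (hr : ∀ a, adj a a) {b : E} (hb : b ∈ ⋃ k, waveDom adj K L (U k)) :
    adj (chainFun adj K L U b) b := by
  obtain ⟨k, hk, h1, -⟩ := chainFun_spec hb
  rw [h1]
  exact (isWave_waveSet hr (U k)).rel b hk

/-- `j` is not a successor. -/
def IsLim (j : ι) : Prop := ∀ i < j, ∃ m, i < m ∧ m < j

namespace IsTower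

variable (T : IsTower μ adj K L X S U)
include T

theorem subset_of_lt {i j : ι} (h : i < j) : S i ⊆ U j := by
  rw [T.eq j]
  exact Set.subset_biUnion_of_mem (u := S) (show i ∈ {l | l < j} from h)

theorem mono {i j : ι} (h : i ≤ j) : U i ⊆ U j := by
  rcases h.lt_or_eq with h | rfl
  · exact (T.stage i).subset.trans (T.subset_of_lt h)
  · exact subset_rfl

theorem exists_mem {j : ι} {a : E} (ha : a ∈ U j) : ∃ i < j, a ∈ S i := by
  rw [T.eq j] at ha
  simpa using ha

theorem exists_lt_mem {j : ι} (hj : IsLim j) {a : E} (ha : a ∈ U j) {k : ι} (hk : k < j) :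
    ∃ i, k < i ∧ i < j ∧ a ∈ U i := by
  obtain ⟨i, hi, ha⟩ := T.exists_mem ha
  obtain ⟨m, hm, hmj⟩ := hj (max i k) (max_lt hi hk)
  exact ⟨m, (le_max_right _ _).trans_lt hm, hmj,
    T.subset_of_lt ((le_max_left _ _).trans_lt hm) ha⟩

theorem waveFun_mem_iff {j : ι} (hj : IsLim j) {k : ι} (hk : k < j) {b : E}
    (hb : b ∈ waveDom adj K L (U k)) : waveFun adj K L (U k) b ∈ U j ↔ b ∈ U j := by
  constructor
  · intro h
    obtain ⟨i, hki, hij, h⟩ := T.exists_lt_mem hj h hk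
    exact T.subset_of_lt hij ((T.stage i).preimage k hki.le b hb h)
  · intro h
    obtain ⟨i, hki, hij, h⟩ := T.exists_lt_mem hj h hk
    exact T.subset_of_lt hij ((T.stage i).image k hki.le b hb h)

section

variable (hr : ∀ a, adj a a)
include hr

theorem chainFun_mem_iff {j : ι} (hj : IsLim j) {b : E} (hb : b ∈ ⋃ k, waveDom adj K L (U k)) :
    chainFun adj K L U b ∈ U j ↔ b ∈ U j := by
  obtain ⟨k, hk, h1, -⟩ := chainFun_spec hb
  rw [h1]
  rcases lt_or_ge k j with h | h
  · exact T.waveFun_mem_iff hj h hk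
  · exact iff_of_false (fun h' => waveFun_notMem hr hk (T.mono h h'))
      fun h' => (notMem_of_mem_waveDom hk).2 (T.mono h h')

theorem injOn : Set.InjOn (chainFun adj K L U) (⋃ k, waveDom adj K L (U k)) := by
  refine coh_injOn (fun k => (isWave_waveSet hr (U k)).inj) fun k k' b b' hk hb hb' h => ?_
  refine ⟨?_, waveFun adj K L (U k) b, (isWave_waveSet hr (U k)).maps b hb, ?_⟩
  · have := notMem_of_mem_waveDom hb'
    rintro (h' | h')
    exacts [this.1 h', this.2 (T.mono hk.le h')]
  · rw [h]
    exact (isWave_waveSet hr (U k')).rel b' hb'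

theorem waveSet_diff_subset {j : ι} (hj : IsLim j) {k : ι} (hk : k ≤ j) :
    waveSet adj K L (U k) \ U j ⊆ waveSet adj K L (U j) := by
  rcases hk.lt_or_eq with hk | rfl
  swap
  · exact Set.sdiff_subset
  have hW := isWave_waveSet (K := K) (L := L) hr (U k)
  have hsub : nb adj (L ∪ U j) (waveSet adj K L (U k) \ U j) ⊆ waveDom adj K L (U k) := by
    rintro b ⟨hb, a, ha, hab⟩
    refine ⟨?_, a, ha.1, hab⟩
    rintro (h | h)
    exacts [hb (Or.inl h), hb (Or.inr (T.mono hk.le h))]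
  refine subset_waveSet hr (g := waveFun adj K L (U k)) ⟨?_, fun b hb => ⟨hW.maps b (hsub hb), ?_⟩,
    fun b hb => hW.rel b (hsub hb), hW.inj.mono hsub, hW.noRay.mono fun b hb => ⟨hsub hb, rfl⟩⟩
  · rintro a ha (h | h)
    exacts [hW.notMem a ha.1 (Or.inl h), ha.2 h]
  · rw [T.waveFun_mem_iff hj hk (hsub hb)]
    exact fun h => hb.1 (Or.inr h)

theorem waveDom_diff_subset {j : ι} (hj : IsLim j) {k : ι} (hk : k ≤ j) :
    waveDom adj K L (U k) \ U j ⊆ waveDom adj K L (U j) := by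
  rcases hk.lt_or_eq with hk' | rfl
  swap
  · exact Set.sdiff_subset
  rintro b ⟨hb, hbj⟩
  have hW := isWave_waveSet (K := K) (L := L) hr (U k)
  refine ⟨?_, _, T.waveSet_diff_subset hr hj hk ⟨hW.maps b hb, ?_⟩, hW.rel b hb⟩
  · rintro (h | h)
    exacts [(notMem_of_mem_waveDom hb).1 h, hbj h]
  · rwa [T.waveFun_mem_iff hj hk' hb]

theorem isWave_chainFun {j : ι} (hj : IsLim j) :
    IsWave adj (K ∪ U j) (L ∪ U j) (waveSet adj K L (U j)) (chainFun adj K L U) := by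
  have hsub : nb adj (L ∪ U j) (waveSet adj K L (U j)) ⊆ ⋃ k, waveDom adj K L (U k) :=
    Set.subset_iUnion (fun k => waveDom adj K L (U k)) j
  refine ⟨(isWave_waveSet hr (U j)).notMem, fun b hb => ?_, fun b hb => chainFun_rel hr (hsub hb),
    (T.injOn hr).mono hsub, (chainFun_noRay hr).mono fun b hb => ⟨hsub hb, rfl⟩⟩
  obtain ⟨k, hk, h1, h2⟩ := chainFun_spec (hsub hb)
  have hkj : k ≤ j := by
    by_contra! h
    exact h2 j h hb
  refine T.waveSet_diff_subset hr hj hkj ⟨?_, ?_⟩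
  · rw [h1]; exact (isWave_waveSet hr (U k)).maps b hk
  · rw [T.chainFun_mem_iff hr hj (hsub hb)]
    exact fun h => hb.1 (Or.inr h)

end

end IsTower

end Web

namespace Web

theorem NoRay.of_step {E : Type*} {D D' : Set E} {h : E → E} (hh : NoRay D' h)
    (hs : ∀ d ∈ D, h d ∈ D → h d ∈ D') : NoRay D h := fun u hu hD =>
  hh.tail hu 1 fun n hn => ⟨by
    obtain ⟨m, rfl⟩ : ∃ m, n = m + 1 := ⟨n - 1, by omega⟩
    rw [(hD m).2]
    exact hs _ (hD m).1 ((hD m).2 ▸ (hD (m + 1)).1), (hD n).2⟩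

theorem Rt.step {E : Type*} {adj : E → E → Prop} {D : Set E} {G : E → E} {a b b' : E}
    (h : Rt adj D G a b') (hb : b' ∈ D) (hab : adj (G b') b) : Rt adj D G a b :=
  h.imp fun _ hd => ⟨.head ⟨hb, hab⟩ hd.1, hd.2⟩

theorem Rt.of_adj {E : Type*} {adj : E → E → Prop} {D : Set E} {G : E → E} {a b : E}
    (h : adj a b) : Rt adj D G a b := ⟨b, .refl, h⟩

theorem IsRoute.rt {E : Type u} {adj : E → E → Prop} {D : Set E} {G : E → E} {a b : E}
    {t : List E} (h : IsRoute adj D G a b t) : ∀ e ∈ b :: t, Rt adj D G a e := by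
  obtain ⟨h1, -, h3⟩ := h
  induction t generalizing b with
  | nil =>
    intro e he
    rw [List.mem_singleton.1 he]
    exact Rt.of_adj (h3 b (by simp))
  | cons z t ih =>
    rw [List.isChain_cons_cons] at h1
    have := ih h1.2 fun l hl => h3 l (by simpa using hl)
    intro e he
    rcases List.mem_cons.1 he with rfl | he
    · exact (this z (by simp)).step h1.1.1 h1.1.2
    · exact this e he

theorem RegularOrder.mk_iUnion_le {E ι : Type u} [LinearOrder ι] {μ : Cardinal.{u}}
    (H : RegularOrder μ ι) {S : ι → Set E} (hS : ∀ i, #(S i) < μ) : #(⋃ i, S i : Set E) ≤ μ := by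
  refine (Cardinal.mk_iUnion_le _).trans ?_
  rw [H.mk_le]
  exact mul_le_of_le H.aleph0_lt.le le_rfl (ciSup_le' fun i => (hS i).le)

variable {E : Type u} {ι : Type u} [LinearOrder ι] [WellFoundedLT ι] {μ : Cardinal.{u}}
  {adj : E → E → Prop} {K L : Set E} {X S U : ι → Set E}

namespace IsTower

variable (T : IsTower μ adj K L X S U)
include T

theorem level_eq {e : E} {l l' : ι} (h : e ∈ S l) (h' : e ∉ U l) (g : e ∈ S l') (g' : e ∉ U l') :
    l = l' := by
  rcases lt_trichotomy l l' with hl | hl | hl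
  · exact absurd (T.subset_of_lt hl h) g'
  · exact hl
  · exact absurd (T.subset_of_lt hl g) h'

theorem mem_iff_of_level {e : E} {l l' : ι} (h : e ∈ S l) (h' : e ∉ U l) : e ∈ U l' ↔ l < l' := by
  refine ⟨fun g => ?_, fun g => T.subset_of_lt g h⟩
  by_contra! hl
  exact h' (T.mono hl g)

theorem eventually_mem {b : E} (hb : b ∈ ⋃ i, S i) : ∀ᶠ j in clubF ι, b ∈ U j := by
  obtain ⟨i, hi⟩ := Set.mem_iUnion.1 hb
  filter_upwards [eventually_clubF_gt i] with j hj
  exact T.subset_of_lt hj hi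

theorem eventually_forall (H : RegularOrder μ ι) {p : E → ι → Prop}
    (hp : ∀ a ∈ ⋃ i, S i, ∀ᶠ j in clubF ι, p a j) : ∀ᶠ j in clubF ι, ∀ a ∈ U j, p a j := by
  filter_upwards [H.eventually_forall_mem_iUnion T.small hp] with j hj
  rwa [T.eq j]

/-- Deleting both copies of a stage of the tower creates no hindrance, for almost all stages. -/
theorem eventually_not_hindered (H : RegularOrder μ ι) (hr : ∀ a, adj a a)
    (hu : ¬ Hindered adj K L) : ∀ᶠ j in clubF ι, ¬ Hindered adj (K ∪ U j) (L ∪ U j) := by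
  classical
  by_contra hfreq
  have hfreq : ∃ᶠ j in clubF ι, Hindered adj (K ∪ U j) (L ∪ U j) := by
    exact (Filter.not_eventually.1 hfreq).mono fun _ h => not_not.1 h
  have := H.neBot
  set F := chainFun adj K L U with hF
  let B : ι → Prop := fun j => IsLim j ∧ Hindered adj (K ∪ U j) (L ∪ U j)
  have hB : ∃ᶠ j in clubF ι, B j :=
    (hfreq.and_eventually H.eventually_limit).mono fun j hj => ⟨hj.2, hj.1⟩
  let dm : ι → Set E := fun j => waveDom adj K L (U j)
  have hex : ∀ j, ∃ x Ω G, B j → HindData adj (K ∪ U j) (L ∪ U j) (waveSet adj K L (U j)) F x Ω G ∧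
      Ω ⊆ S j ∧ (∀ b ∈ Ω, G b ∈ S j) ∧ x ∈ S j ∧
      ∀ b ∈ U j, Rt adj (dm j) G x b → ∃ t, IsRoute adj (dm j) G x b t ∧ ∀ e ∈ t, e ∈ S j := by
    intro j
    by_cases hj : B j
    · obtain ⟨x, Ω, G, h⟩ := (T.stage j).hind hj.2 (T.isWave_chainFun hr hj.1)
      exact ⟨x, Ω, G, fun _ => h⟩
    · by_cases hE : Nonempty E
      · exact ⟨hE.some, ∅, id, fun h => absurd h hj⟩
      · obtain ⟨j', hj'⟩ := hB.exists
        obtain ⟨_, _, _, x, -⟩ := hj'.2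
        exact absurd ⟨x⟩ hE
  choose x Ω G hdat hΩS hGS hxS hroute using hex
  let pop : E → Prop := fun b => ∃ᶠ j in clubF ι, B j ∧ Rt adj (dm j) (G j) (x j) b
  let J : Set ι := {j | B j ∧ ∀ b ∈ U j, Rt adj (dm j) (G j) (x j) b → pop b}
  have hJev : ∀ᶠ j in clubF ι, B j → j ∈ J := by
    have := T.eventually_forall H (p := fun b j => B j ∧ Rt adj (dm j) (G j) (x j) b → pop b) ?_
    · filter_upwards [this] with j hj hBj
      exact ⟨hBj, fun b hb hR => hj b hb ⟨hBj, hR⟩⟩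
    · intro b _
      by_cases hp : pop b
      · exact Eventually.of_forall fun _ _ => hp
      · filter_upwards [not_frequently.1 hp] with j hj h
        exact absurd h hj
  have hJ : ∃ᶠ j in clubF ι, j ∈ J := (hB.and_eventually hJev).mono fun j hj => hj.2 hj.1
  have hdm : ∀ j, ∀ b ∈ dm j, b ∉ L ∧ b ∉ U j := fun j b hb => notMem_of_mem_waveDom hb
  have hdmU : ∀ j, dm j ⊆ ⋃ k, waveDom adj K L (U k) := fun j =>
    Set.subset_iUnion (fun k => waveDom adj K L (U k)) j
  have hΩdm : ∀ j, B j → Ω j ⊆ dm j := fun j hj => (hdat j hj).subset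
  have hΩU : ∀ j, B j → ∀ b ∈ Ω j, b ∉ U j := fun j hj b hb => (hdm j b (hΩdm j hj hb)).2
  have hZU : ∀ j, ∀ a ∈ waveSet adj K L (U j), a ∉ K ∧ a ∉ U j := fun j a ha =>
    ⟨fun h => (isWave_waveSet hr (U j)).notMem a ha (Or.inl h),
      fun h => (isWave_waveSet hr (U j)).notMem a ha (Or.inr h)⟩
  have hxU : ∀ j, B j → x j ∉ U j := fun j hj => (hZU j _ (hdat j hj).mem).2
  have hGZ : ∀ j, B j → ∀ b ∈ dm j, G j b ∈ waveSet adj K L (U j) := fun j hj b hb =>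
    (hdat j hj).wave.maps b hb
  have hGU : ∀ j, B j → ∀ b ∈ dm j, G j b ∉ U j := fun j hj b hb => (hZU j _ (hGZ j hj b hb)).2
  have hZdm : ∀ j, ∀ a ∈ waveSet adj K L (U j), a ∉ L → a ∈ dm j := fun j a ha haL =>
    mem_nb_self hr ha (by rintro (h | h); exacts [haL h, (hZU j a ha).2 h])
  -- reachable vertices
  let R : ι → Set E := fun j =>
    {a | a = x j ∨ ∃ b ∈ dm j, G j b = a ∧ Rt adj (dm j) (G j) (x j) b}
  have hRZ : ∀ j, B j → R j ⊆ waveSet adj K L (U j) := by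
    rintro j hj a (rfl | ⟨b, hb, rfl, -⟩)
    exacts [(hdat j hj).mem, hGZ j hj b hb]
  have hRR : ∀ j, B j → ∀ a ∈ R j, ∀ b, adj a b → Rt adj (dm j) (G j) (x j) b := by
    rintro j hj a (rfl | ⟨b', hb', rfl, hR⟩) b hab
    exacts [Rt.of_adj hab, hR.step hb' hab]
  let Z : Set E := ⋃ j ∈ J, R j
  let D : Set E := nb adj L Z
  let D₁ : Set E := {b | ∃ j ∈ J, b ∈ dm j ∧ Rt adj (dm j) (G j) (x j) b}
  have hZD₁ : ∀ a ∈ Z, a ∉ L → a ∈ D₁ := by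
    intro a ha haL
    simp only [Z, Set.mem_iUnion] at ha
    obtain ⟨j, hj, ha⟩ := ha
    exact ⟨j, hj, hZdm j a (hRZ j hj.1 ha) haL, hRR j hj.1 a ha a (hr a)⟩
  have hRmem : ∀ j ∈ J, R j ⊆ Z := fun j hj => Set.subset_biUnion_of_mem (u := R) hj
  have hD₁D : D₁ ⊆ D := by
    rintro b ⟨j, hj, hb, hR⟩
    exact ⟨(hdm j b hb).1, G j b, hRmem j hj (Or.inr ⟨b, hb, rfl, hR⟩),
      (hdat j hj.1).wave.rel b hb⟩
  have hD₁F : D₁ ⊆ ⋃ k, waveDom adj K L (U k) := fun b ⟨j, _, hb, _⟩ => hdmU j hb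
  have hQ : ∀ b ∈ D, b ∉ D₁ → b ∈ (⋃ i, S i) ∧ pop b := by
    rintro b ⟨hbL, a, ha, hab⟩ hbD
    simp only [Z, Set.mem_iUnion] at ha
    obtain ⟨j, hj, ha⟩ := ha
    have hR := hRR j hj.1 a ha b hab
    by_cases hbU : b ∈ U j
    · obtain ⟨i, -, hi⟩ := T.exists_mem hbU
      exact ⟨Set.mem_iUnion.2 ⟨i, hi⟩, hj.2 b hbU hR⟩
    · refine absurd ⟨j, hj, ⟨?_, a, hRZ j hj.1 ha, hab⟩, hR⟩ hbD
      rintro (h | h)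
      exacts [hbL h, hbU h]
  -- the combined matching
  let Ft : E → E := fun b => if h : ∃ j ∈ J, b ∈ Ω j then G h.choose b else F b
  have hΩeq : ∀ j ∈ J, ∀ j' ∈ J, ∀ b ∈ Ω j, b ∈ Ω j' → j = j' := fun j hj j' hj' b hb hb' =>
    T.level_eq (hΩS j hj.1 hb) (hΩU j hj.1 b hb) (hΩS j' hj'.1 hb') (hΩU j' hj'.1 b hb')
  have hFt1 : ∀ j ∈ J, ∀ b ∈ Ω j, Ft b = G j b := by
    intro j hj b hb
    have h : ∃ j ∈ J, b ∈ Ω j := ⟨j, hj, hb⟩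
    have : h.choose = j := hΩeq _ h.choose_spec.1 _ hj b h.choose_spec.2 hb
    simp only [Ft, dif_pos h, this]
  have hFt2 : ∀ b, (∀ j ∈ J, b ∉ Ω j) → Ft b = F b := by
    intro b hb
    have h : ¬ ∃ j ∈ J, b ∈ Ω j := by push Not; exact hb
    simp only [Ft, dif_neg h]
  have hFtG : ∀ j ∈ J, ∀ b ∈ S j, b ∉ U j → Ft b = G j b := by
    intro j hj b hb hbU
    by_cases h : b ∈ Ω j
    · exact hFt1 j hj b h
    · rw [hFt2 b, (hdat j hj.1).eq b h]
      intro j' hj' hb'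
      rw [T.level_eq (hΩS j' hj'.1 hb') (hΩU j' hj'.1 b hb') hb hbU] at hb'
      exact h hb'
  have hFtZ : ∀ b ∈ D₁, Ft b ∈ Z := by
    rintro b ⟨j, hj, hb, hR⟩
    by_cases h : ∃ j' ∈ J, b ∈ Ω j'
    · obtain ⟨j', hj', hb'⟩ := h
      rw [hFt1 j' hj' b hb']
      exact hRmem j' hj' (Or.inr ⟨b, hΩdm j' hj'.1 hb', rfl, (hdat j' hj'.1).reach b hb'⟩)
    · push Not at h
      rw [hFt2 b h, ← (hdat j hj.1).eq b (h j hj)]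
      exact hRmem j hj (Or.inr ⟨b, hb, rfl, hR⟩)
  have hFtrel : ∀ b ∈ D₁, adj (Ft b) b := by
    intro b hb
    by_cases h : ∃ j' ∈ J, b ∈ Ω j'
    · obtain ⟨j', hj', hb'⟩ := h
      rw [hFt1 j' hj' b hb']
      exact (hdat j' hj'.1).wave.rel b (hΩdm j' hj'.1 hb')
    · push Not at h
      rw [hFt2 b h]
      exact chainFun_rel hr (hD₁F hb)
  -- a vertex matched by `F` into level `j` lies in the domain at level `j`
  have hFdm : ∀ j ∈ J, ∀ b ∈ D₁, F b ∈ waveSet adj K L (U j) → b ∈ dm j := by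
    intro j hj b hb h
    refine ⟨?_, F b, h, chainFun_rel hr (hD₁F hb)⟩
    rintro (h' | h')
    · exact (hD₁D hb).1 h'
    · exact (hZU j _ h).2 ((T.chainFun_mem_iff hr hj.1.1 (hD₁F hb)).2 h')
  have hGne : ∀ j ∈ J, ∀ b ∈ Ω j, ∀ b' ∈ D₁, (∀ j ∈ J, b' ∉ Ω j) → G j b ≠ F b' := by
    intro j hj b hb b' hb' hn he
    have h1 := hGZ j hj.1 b (hΩdm j hj.1 hb)
    have h2 : b' ∈ dm j := hFdm j hj b' hb' (he ▸ h1)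
    rw [← (hdat j hj.1).eq b' (hn j hj)] at he
    exact hn j hj ((hdat j hj.1).wave.inj (hΩdm j hj.1 hb) h2 he ▸ hb)
  have hFtinj : Set.InjOn Ft D₁ := by
    intro b hb b' hb' he
    by_cases h : ∃ j ∈ J, b ∈ Ω j <;> by_cases h' : ∃ j ∈ J, b' ∈ Ω j
    · obtain ⟨j, hj, hbj⟩ := h
      obtain ⟨j', hj', hbj'⟩ := h'
      rw [hFt1 j hj b hbj, hFt1 j' hj' b' hbj'] at he
      have hjj : j = j' := T.level_eq (hGS j hj.1 b hbj)
        (hGU j hj.1 b (hΩdm j hj.1 hbj)) (he ▸ hGS j' hj'.1 b' hbj')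
        (he ▸ hGU j' hj'.1 b' (hΩdm j' hj'.1 hbj'))
      subst hjj
      exact (hdat j hj.1).wave.inj (hΩdm j hj.1 hbj) (hΩdm j hj.1 hbj') he
    · obtain ⟨j, hj, hbj⟩ := h
      push Not at h'
      rw [hFt1 j hj b hbj, hFt2 b' h'] at he
      exact absurd he (hGne j hj b hbj b' hb' h')
    · obtain ⟨j, hj, hbj⟩ := h'
      push Not at h
      rw [hFt1 j hj b' hbj, hFt2 b h] at he
      exact absurd he.symm (hGne j hj b' hbj b hb h)
    · push Not at h h'
      rw [hFt2 b h, hFt2 b' h'] at he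
      exact T.injOn hr (hD₁F hb) (hD₁F hb') he
  have hFtx : ∀ l ∈ J, ∀ b ∈ D₁, Ft b ≠ x l := by
    intro l hl b hb he
    by_cases h : ∃ j ∈ J, b ∈ Ω j
    · obtain ⟨j, hj, hbj⟩ := h
      rw [hFt1 j hj b hbj] at he
      have hjj : j = l := T.level_eq (hGS j hj.1 b hbj)
        (hGU j hj.1 b (hΩdm j hj.1 hbj)) (he ▸ hxS l hl.1) (he ▸ hxU l hl.1)
      subst hjj
      exact (hdat j hj.1).ne b (hΩdm j hj.1 hbj) he
    · push Not at h
      rw [hFt2 b h] at he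
      have h2 := hFdm l hl b hb (he ▸ (hdat l hl.1).mem)
      rw [← (hdat l hl.1).eq b (h l hl)] at he
      exact (hdat l hl.1).ne b h2 he
  have hxinj : ∀ l ∈ J, ∀ l' ∈ J, x l = x l' → l = l' := fun l hl l' hl' he =>
    T.level_eq (hxS l hl.1) (hxU l hl.1) (he ▸ hxS l' hl'.1) (he ▸ hxU l' hl'.1)
  have hFtU : ∀ l ∈ J, ∀ b ∈ D₁, (Ft b ∈ U l ↔ b ∈ U l) := by
    intro l hl b hb
    by_cases h : ∃ j ∈ J, b ∈ Ω j
    · obtain ⟨j, hj, hbj⟩ := h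
      rw [hFt1 j hj b hbj, T.mem_iff_of_level (hΩS j hj.1 hbj) (hΩU j hj.1 b hbj),
        T.mem_iff_of_level (hGS j hj.1 b hbj) (hGU j hj.1 b (hΩdm j hj.1 hbj))]
    · push Not at h
      rw [hFt2 b h]
      exact T.chainFun_mem_iff hr hl.1.1 (hD₁F hb)
  -- distinct levels for the remaining vertices
  let Q : Set E := {b | b ∈ D ∧ b ∉ D₁}
  have hQcard : #(Option Q) ≤ μ := by
    rw [mk_option]
    refine add_le_of_le H.aleph0_lt.le ?_ (one_lt_aleph0.le.trans H.aleph0_lt.le)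
    exact (mk_le_mk_of_subset fun b hb => (hQ b hb.1 hb.2).1).trans (H.mk_iUnion_le T.small)
  obtain ⟨φ, hφinj, hφ⟩ := H.exists_injective_choice hQcard
    (fun o => {j | j ∈ J ∧ ∀ b ∈ o, b.1 ∈ U j ∧ Rt adj (dm j) (G j) (x j) b.1}) (by
      rintro (_ | b) i
      · obtain ⟨j, hij, hj⟩ := frequently_exists_gt hJ i
        exact ⟨j, ⟨hj, by simp⟩, hij⟩
      · obtain ⟨h1, h2⟩ := hQ b.1 b.2.1 b.2.2
        obtain ⟨j, hij, ⟨⟨hj1, hj2⟩, hj3⟩, hj4⟩ := frequently_exists_gt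
          ((Frequently.and_eventually h2 hJev).and_eventually (T.eventually_mem h1)) i
        refine ⟨j, ⟨hj3 hj1, fun b' hb' => ?_⟩, hij⟩
        obtain rfl : b = b' := by simpa using hb'
        exact ⟨hj4, hj2⟩)
  let ψ : E → ι := fun b => if h : b ∈ Q then φ (some ⟨b, h⟩) else φ none
  have hψ : ∀ b (h : b ∈ Q), ψ b = φ (some ⟨b, h⟩) := fun b h => dif_pos h
  have hψJ : ∀ b ∈ Q, ψ b ∈ J := fun b h => by rw [hψ b h]; exact (hφ _).1
  have hψinj : ∀ b ∈ Q, ∀ b' ∈ Q, ψ b = ψ b' → b = b' := by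
    intro b hb b' hb' h
    rw [hψ b hb, hψ b' hb'] at h
    simpa using hφinj h
  have hψnone : ∀ b ∈ Q, ψ b ≠ φ none := by
    intro b hb h
    rw [hψ b hb] at h
    simpa using hφinj h
  have hex : ∀ b, ∃ t, b ∈ Q → IsRoute adj (dm (ψ b)) (G (ψ b)) (x (ψ b)) b t ∧
      ∀ e ∈ t, e ∈ S (ψ b) := by
    intro b
    by_cases hb : b ∈ Q
    · have h := (hφ (some ⟨b, hb⟩)).2 ⟨b, hb⟩ rfl
      rw [← hψ b hb] at h
      obtain ⟨t, ht⟩ := hroute _ (hψJ b hb).1 b h.1 h.2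
      exact ⟨t, fun _ => ht⟩
    · exact ⟨[], fun h => absurd h hb⟩
  choose t ht htS using hex
  have htdm : ∀ b ∈ Q, ∀ e ∈ t b, e ∈ dm (ψ b) := fun b hb e he => (ht b hb).mem e he
  have htU : ∀ b ∈ Q, ∀ e ∈ t b, e ∉ U (ψ b) := fun b hb e he => (hdm _ e (htdm b hb e he)).2
  have htD₁ : ∀ b ∈ Q, ∀ e ∈ t b, e ∈ D₁ := fun b hb e he =>
    ⟨ψ b, hψJ b hb, htdm b hb e he, (ht b hb).rt e (List.mem_cons_of_mem _ he)⟩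
  have hteq : ∀ b ∈ Q, ∀ b' ∈ Q, ∀ e, e ∈ t b → e ∈ t b' → b = b' := fun b hb b' hb' e he he' =>
    hψinj b hb b' hb' (T.level_eq (htS b hb e he) (htU b hb e he) (htS b' hb' e he')
      (htU b' hb' e he'))
  let h : E → E := fun b => if b ∈ D₁ then Ft b else x (ψ b)
  have hh1 : ∀ b ∈ D₁, h b = Ft b := fun b hb => if_pos hb
  have hh2 : ∀ b ∈ Q, h b = x (ψ b) := fun b hb => if_neg hb.2
  have hhZ : ∀ b ∈ D, h b ∈ Z := by
    intro b hb
    by_cases hb1 : b ∈ D₁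
    · rw [hh1 b hb1]; exact hFtZ b hb1
    · rw [hh2 b ⟨hb, hb1⟩]; exact hRmem _ (hψJ b ⟨hb, hb1⟩) (Or.inl rfl)
  have hxne : ∀ b ∈ D, h b ≠ x (φ none) := by
    intro b hb
    by_cases hb1 : b ∈ D₁
    · rw [hh1 b hb1]; exact hFtx _ (hφ none).1 b hb1
    · rw [hh2 b ⟨hb, hb1⟩]
      exact fun he => hψnone b ⟨hb, hb1⟩ (hxinj _ (hψJ b ⟨hb, hb1⟩) _ (hφ none).1 he)
  have hhinj : Set.InjOn h D := by
    intro b hb b' hb' he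
    by_cases h1 : b ∈ D₁ <;> by_cases h1' : b' ∈ D₁
    · rw [hh1 b h1, hh1 b' h1'] at he
      exact hFtinj h1 h1' he
    · rw [hh1 b h1, hh2 b' ⟨hb', h1'⟩] at he
      exact absurd he (hFtx _ (hψJ b' ⟨hb', h1'⟩) b h1)
    · rw [hh2 b ⟨hb, h1⟩, hh1 b' h1'] at he
      exact absurd he.symm (hFtx _ (hψJ b ⟨hb, h1⟩) b' h1')
    · rw [hh2 b ⟨hb, h1⟩, hh2 b' ⟨hb', h1'⟩] at he
      exact hψinj b ⟨hb, h1⟩ b' ⟨hb', h1'⟩ (hxinj _ (hψJ b ⟨hb, h1⟩) _ (hψJ b' ⟨hb', h1'⟩) he)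
  have key := fun hray => IsWave.of_reroute (adj := adj) (K := K) (L := L) (S := Z) (h := h) Q
    (fun b => b :: t b) (fun b hb => (ht b hb).nodup)
    (fun b hb b' hb' e he he' => by
      rcases List.mem_cons.1 he with rfl | he <;> rcases List.mem_cons.1 he' with rfl | he'
      · rfl
      · exact absurd (htD₁ b' hb' _ he') hb.2
      · exact absurd (htD₁ b hb _ he) hb'.2
      · exact hteq b hb b' hb' e he he')
    (fun a ha => by
      simp only [Z, Set.mem_iUnion] at ha
      obtain ⟨j, hj, ha⟩ := ha
      exact (hZU j a (hRZ j hj.1 ha)).1)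
    (fun b hb e he => by
      rcases List.mem_cons.1 he with rfl | he
      exacts [hb.1, hD₁D (htD₁ b hb e he)])
    hhZ hhinj
    (fun b hb hn => by
      by_cases hb1 : b ∈ D₁
      · rw [hh1 b hb1]; exact hFtrel b hb1
      · exact absurd List.mem_cons_self (hn b ⟨hb, hb1⟩))
    (fun b hb => by
      have h1 := (ht b hb).chain
      have h2 := htD₁ b hb
      have h3 := htS b hb
      have h4 := htU b hb
      refine List.isChain_iff_getElem.2 fun i hi => ?_
      have h5 := List.isChain_iff_getElem.1 h1 i hi
      have hmem : (b :: t b)[i + 1] ∈ t b := by simp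
      rw [hh1 _ (h2 _ hmem), hFtG _ (hψJ b hb) _ (h3 _ hmem) (h4 _ hmem)]
      exact h5.2)
    (fun b hb l hl y hy => by
      obtain rfl : b = y := by simpa using hy
      rw [hh2 b hb]
      exact (ht b hb).last l hl)
    hray
  suffices hray : _ by
    obtain ⟨k, hk, hkh⟩ := key hray
    refine hu ⟨Z, k, hk, x (φ none), hRmem _ (hφ none).1 (Or.inl rfl), fun b hb he => ?_⟩
    obtain ⟨b', hb', he'⟩ := hkh b hb
    exact hxne b' hb' (he' ▸ he)
  · intro c hc1 hc2
    have hcD : ∀ b ∈ D₁, (∀ q ∈ Q, b ∉ t q) → c b = b := by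
      intro b hb hn
      refine hc1 b fun q hq hbq => ?_
      rcases List.mem_cons.1 hbq with rfl | hbq
      exacts [hq.2 hb, hn q hq hbq]
    have hcD' : ∀ b ∈ D, c b ∈ D := by
      intro b hb
      by_cases hex : ∃ q ∈ Q, b ∈ q :: t q
      · obtain ⟨q, hq, hbq⟩ := hex
        rcases List.mem_cons.1 ((hc2 q hq b).2 hbq) with h' | h'
        exacts [h' ▸ hq.1, hD₁D (htD₁ q hq _ h')]
      · push Not at hex
        rwa [hc1 b hex]
    refine NoRay.of_step (D' := D₁) ?_ fun b hb hb' => hZD₁ _ (hhZ _ (hcD' b hb)) hb'.1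
    refine NoRay.of_levels (U := U) (F := F) (Lv := J)
      (R := fun l => Ω l ∪ {e | ∃ b ∈ Q, ψ b = l ∧ e ∈ t b}) ?_ ?_ ?_
      ((chainFun_noRay hr).mono fun b hb => ⟨hD₁F hb, rfl⟩) ?_ ?_
    · intro l hl
      refine Set.eq_empty_of_forall_notMem ?_
      rintro e ⟨he | ⟨b, hb, rfl, he⟩, heU⟩
      exacts [hΩU l hl.1 e he heU, htU b hb e he heU]
    · rintro l hl k hk e (he | ⟨b, hb, rfl, he⟩)
      exacts [T.subset_of_lt hk (hΩS l hl.1 he), T.subset_of_lt hk (htS b hb e he)]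
    · intro l hl b hb _
      by_cases hex : ∃ q ∈ Q, b ∈ t q
      · obtain ⟨q, hq, hbq⟩ := hex
        rw [T.mem_iff_of_level (htS q hq b hbq) (htU q hq b hbq)]
        rcases List.mem_cons.1 ((hc2 q hq b).2 (List.mem_cons_of_mem _ hbq)) with h' | h'
        · rw [h', hh2 q hq, T.mem_iff_of_level (hxS _ (hψJ q hq).1) (hxU _ (hψJ q hq).1)]
        · rw [hh1 _ (htD₁ q hq _ h'), hFtU l hl _ (htD₁ q hq _ h'),
            T.mem_iff_of_level (htS q hq _ h') (htU q hq _ h')]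
      · push Not at hex
        rw [hcD b hb hex, hh1 b hb, hFtU l hl b hb]
    · intro b hb hn
      rw [hcD b hb fun q hq hbq => hn _ (hψJ q hq) (Or.inr ⟨q, hq, rfl, hbq⟩), hh1 b hb]
      exact hFt2 b fun j hj hbj => hn j hj (Or.inl hbj)
    · intro l hl
      have hGl : NoRay D₁ (G l) := by
        refine NoRay.mix (D' := Ω l) (g := G l) (f := F)
          ((hdat l hl.1).wave.noRay.mono fun b hb => ⟨hΩdm l hl.1 hb, rfl⟩)
          ((chainFun_noRay hr).mono fun b hb => ⟨hD₁F hb.1, rfl⟩) (fun _ _ _ => rfl)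
          (fun b _ hb => (hdat l hl.1).eq b hb) fun b _ hb hb' => ?_
        refine (hdat l hl.1).closed b hb ?_
        rintro (h' | h')
        exacts [(hD₁D hb').1 h', hGU l hl.1 b (hΩdm l hl.1 hb) h']
      have hfin : {e | ∃ b ∈ Q, ψ b = l ∧ e ∈ t b}.Finite := by
        by_cases hex : ∃ q ∈ Q, ψ q = l
        · obtain ⟨q, hq, hql⟩ := hex
          refine (t q).finite_toSet.subset ?_
          rintro e ⟨b, hb, hbl, he⟩
          rw [hψinj b hb q hq (hbl.trans hql.symm)] at he
          exact he
        · refine Set.finite_empty.subset ?_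
          rintro e ⟨b, hb, hbl, -⟩
          exact hex ⟨b, hb, hbl⟩
      refine ⟨fun b => if b ∈ Ω l ∪ {e | ∃ b ∈ Q, ψ b = l ∧ e ∈ t b} then h (c b) else F b,
        hGl.of_finite (hfin.subset ?_), ?_⟩
      · rintro b ⟨hb, hb'⟩
        by_contra hbt
        refine hb' ⟨hb, ?_⟩
        by_cases hbΩ : b ∈ Ω l
        · have hn : ∀ q ∈ Q, b ∉ t q := by
            intro q hq hbq
            refine hbt ⟨q, hq, ?_, hbq⟩
            exact T.level_eq (htS q hq b hbq) (htU q hq b hbq) (hΩS l hl.1 hbΩ) (hΩU l hl.1 b hbΩ)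
          simp only [Set.mem_union, hbΩ, true_or, if_true, hcD b hb hn, hh1 b hb, hFt1 l hl b hbΩ]
        · have : b ∉ Ω l ∪ {e | ∃ b ∈ Q, ψ b = l ∧ e ∈ t b} := by
            rintro (h' | h')
            exacts [hbΩ h', hbt h']
          simp only [this, if_false, (hdat l hl.1).eq b hbΩ]
      · intro b hb hn
        by_cases hbl : b ∈ Ω l ∪ {e | ∃ b ∈ Q, ψ b = l ∧ e ∈ t b}
        · simp only [hbl, if_true]
        · simp only [hbl, if_false]
          have hn' : ∀ l' ∈ J, b ∉ Ω l' ∪ {e | ∃ b ∈ Q, ψ b = l' ∧ e ∈ t b} := by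
            intro l' hl'
            by_cases hll : l' = l
            · rw [hll]; exact hbl
            · exact hn l' hl' hll
          rw [hcD b hb fun q hq hbq => hn' _ (hψJ q hq) (Or.inr ⟨q, hq, rfl, hbq⟩), hh1 b hb]
          exact hFt2 b fun j hj hbj => hn' j hj (Or.inl hbj)

end IsTower

end Web

namespace Web

variable {E : Type u} {ι : Type u} [LinearOrder ι] [WellFoundedLT ι] {μ : Cardinal.{u}}
  {adj : E → E → Prop} {K L : Set E} {X S U : ι → Set E}

/-- From almost all stages on, all neighbours of `a` are matched by the largest wave. -/
def Poor (adj : E → E → Prop) (K L : Set E) (U : ι → Set E) (a : E) : Prop :=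
  ∀ᶠ j in clubF ι, nb adj (L ∪ U j) {a} ⊆ waveDom adj K L (U j)

/-- `a` and `b` are joined by alternating routes at stationarily many stages. -/
def Virt (adj : E → E → Prop) (K L : Set E) (U : ι → Set E) (a b : E) : Prop :=
  ∃ᶠ l in clubF ι, Rt adj (waveDom adj K L (U l)) (chainFun adj K L U) a b

/-- The adjacency `adj` extended by the pairs joined by routes at stationarily many stages. -/
def AdjVirt (adj : E → E → Prop) (K L : Set E) (U : ι → Set E) (a b : E) : Prop :=
  adj a b ∨ Virt adj K L U a b

variable (adj K L U) in
/-- The stage `j` reflects richness and the existence of routes. -/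
structure Reflects (j : ι) : Prop where
  isLim : IsLim j
  poor : ∀ a ∈ U j, Poor adj K L U a → nb adj (L ∪ U j) {a} ⊆ waveDom adj K L (U j)
  virt : ∀ a ∈ U j, ∀ b ∈ U j, Rt adj (waveDom adj K L (U j)) (chainFun adj K L U) a b →
    Virt adj K L U a b

namespace IsTower

variable (T : IsTower μ adj K L X S U)
include T

theorem eventually_reflects (H : RegularOrder μ ι) : ∀ᶠ j in clubF ι, Reflects adj K L U j := by
  have h1 := T.eventually_forall H (p := fun a j => Poor adj K L U a →
    nb adj (L ∪ U j) {a} ⊆ waveDom adj K L (U j)) (fun a _ => by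
      by_cases h : Poor adj K L U a
      · filter_upwards [h] with j hj _ using hj
      · exact Eventually.of_forall fun _ h' => absurd h' h)
  have h2 := T.eventually_forall H (p := fun a j => ∀ b ∈ U j,
    Rt adj (waveDom adj K L (U j)) (chainFun adj K L U) a b → Virt adj K L U a b) (fun a _ =>
      T.eventually_forall H (p := fun b j =>
        Rt adj (waveDom adj K L (U j)) (chainFun adj K L U) a b → Virt adj K L U a b) fun b _ => by
      by_cases h : Virt adj K L U a b
      · exact Eventually.of_forall fun _ _ => h
      · filter_upwards [not_frequently.1 h] with j hj h' using absurd h' hj)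
  filter_upwards [H.eventually_limit, h1, h2] with j a b c using ⟨a, b, c⟩

/-- Routes at distinct limit stages joining given pairs. -/
theorem exists_routes (H : RegularOrder μ ι) {α : Type u} (hα : #α ≤ μ) (p q : α → E)
    (hp : ∀ d, p d ∈ ⋃ i, S i) (hq : ∀ d, q d ∈ ⋃ i, S i) (hpq : ∀ d, Virt adj K L U (p d) (q d))
    {good : ι → Prop} (hg : ∀ᶠ l in clubF ι, good l) :
    ∃ (φ : α → ι) (t : α → List E), Function.Injective φ ∧ ∀ d, good (φ d) ∧
      IsRoute adj (waveDom adj K L (U (φ d))) (chainFun adj K L U) (p d) (q d) (t d) ∧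
      ∀ e ∈ t d, e ∈ S (φ d) := by
  obtain ⟨φ, hφ, hφ'⟩ := H.exists_injective_choice hα
    (fun d => {l | good l ∧ p d ∈ U l ∧ q d ∈ U l ∧
      Rt adj (waveDom adj K L (U l)) (chainFun adj K L U) (p d) (q d)}) (fun d i => by
      obtain ⟨j, hj, ⟨⟨⟨h1, h2⟩, h3⟩, h4⟩⟩ := frequently_exists_gt
        ((((hpq d).and_eventually hg).and_eventually (T.eventually_mem (hp d))).and_eventually
          (T.eventually_mem (hq d))) i
      exact ⟨j, ⟨h2, h3, h4, h1⟩, hj⟩)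
  choose t ht ht' using fun d =>
    (T.stage (φ d)).route _ (hφ' d).2.1 _ (hφ' d).2.2.1 (hφ' d).2.2.2
  exact ⟨φ, t, hφ, fun d => ⟨(hφ' d).1, ht d, ht' d⟩⟩

theorem not_hindered_adjVirt (H : RegularOrder μ ι) (hr : ∀ a, adj a a) {i j : ι}
    (hj : Reflects adj K L U j) (hij : i < j) (hi : IsLim i)
    (hui : ¬ Hindered adj (K ∪ U i) (L ∪ U i)) {Y : Set E} (hY : Y ⊆ U j)
    (hu : ¬ Hindered adj (K ∪ U i ∪ waveSet adj K L (U i)) (L ∪ U i ∪ waveDom adj K L (U i) ∪ Y)) :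
    ¬ Hindered (AdjVirt adj K L U)
      {a | a ∈ U j ∧ a ∉ K ∪ U i ∪ waveSet adj K L (U i) ∧ Poor adj K L U a}ᶜ
      {b | b ∈ U j ∧ b ∉ L ∪ U i ∪ waveDom adj K L (U i) ∪ Y}ᶜ := by
  classical
  rintro ⟨P, g, hP, x, hx, hxg⟩
  have := H.neBot
  set F := chainFun adj K L U with hF
  set dm : ι → Set E := fun j => waveDom adj K L (U j) with hdm
  set L' := L ∪ U i ∪ dm i ∪ Y with hL'
  set Dg := nb (AdjVirt adj K L U) {b | b ∈ U j ∧ b ∉ L'}ᶜ P with hDg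
  have hPp : ∀ a ∈ P, a ∈ U j ∧ a ∉ K ∪ U i ∪ waveSet adj K L (U i) ∧ Poor adj K L U a :=
    fun a ha => not_not.1 (hP.notMem a ha)
  have hDgU : ∀ b ∈ Dg, b ∈ U j ∧ b ∉ L' := fun b hb => not_not.1 hb.1
  have hwj := T.isWave_chainFun (K := K) (L := L) hr hj.isLim
  have hwi := T.isWave_chainFun (K := K) (L := L) hr hi
  have hdmU : ∀ k, dm k ⊆ ⋃ k, waveDom adj K L (U k) := fun k =>
    Set.subset_iUnion (fun k => waveDom adj K L (U k)) k
  have hdmi : ∀ b ∈ ⋃ k, waveDom adj K L (U k), F b ∈ waveSet adj K L (U i) → b ∈ dm i := by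
    intro b hb h
    obtain ⟨b', hb', he⟩ := hwi.surj hui h
    rwa [← T.injOn hr (hdmU i hb') hb he]
  let R : Set E := {b | b ∈ dm j ∧ b ∉ dm i ∧ ∃ a ∈ P, Rt adj (dm j) F a b}
  have hRU : ∀ b ∈ R, b ∉ U j := fun b hb => (notMem_of_mem_waveDom hb.1).2
  have hRF : R ⊆ ⋃ k, waveDom adj K L (U k) := fun b hb => hdmU j hb.1
  have hFU : ∀ b ∈ R, F b ∉ U j := fun b hb h =>
    hRU b hb ((T.chainFun_mem_iff hr hj.isLim (hRF hb)).1 h)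
  let Z : Set E := P ∪ F '' R
  have hstep : ∀ a ∈ Z, ∀ b, adj a b → b ∉ L → b ∉ U j → b ∈ dm j ∧
      ∃ a ∈ P, Rt adj (dm j) F a b := by
    rintro a (ha | ⟨d, hd, rfl⟩) b hab hbL hbU
    · exact ⟨hj.poor a (hPp a ha).1 (hPp a ha).2.2 ⟨by rintro (h | h); exacts [hbL h, hbU h],
        a, rfl, hab⟩, a, ha, .of_adj hab⟩
    · refine ⟨⟨by rintro (h | h); exacts [hbL h, hbU h], F d, hwj.maps d hd.1, hab⟩, ?_⟩
      exact hd.2.2.imp fun a ha => ⟨ha.1, ha.2.step hd.1 hab⟩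
  have hnotL' : ∀ b, b ∉ L' → b ∉ L ∧ b ∉ U i ∧ b ∉ dm i ∧ b ∉ Y := by
    intro b hb
    simp only [hL', Set.mem_union, not_or] at hb
    exact ⟨hb.1.1.1, hb.1.1.2, hb.1.2, hb.2⟩
  have hD1 : ∀ b ∈ nb adj L' Z, b ∈ U j → b ∈ Dg := by
    rintro b ⟨hb, a, ha, hab⟩ hbU
    refine ⟨not_not.2 ⟨hbU, hb⟩, ?_⟩
    rcases ha with ha | ⟨d, hd, rfl⟩
    · exact ⟨a, ha, Or.inl hab⟩
    · obtain ⟨a, ha, hR⟩ := hd.2.2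
      exact ⟨a, ha, Or.inr (hj.virt a (hPp a ha).1 b hbU (hR.step hd.1 hab))⟩
  have hD2 : ∀ b ∈ nb adj L' Z, b ∉ U j → b ∈ R := by
    rintro b ⟨hb, a, ha, hab⟩ hbU
    obtain ⟨h1, h2⟩ := hstep a ha b hab (hnotL' b hb).1 hbU
    exact ⟨h1, (hnotL' b hb).2.2.1, h2⟩
  have hD3 : R ⊆ nb adj L' Z := by
    intro b hb
    refine ⟨?_, F b, Or.inr ⟨b, hb, rfl⟩, chainFun_rel hr (hRF hb)⟩
    rintro (((h | h) | h) | h)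
    exacts [(notMem_of_mem_waveDom hb.1).1 h, hRU b hb (T.mono hij.le h), hb.2.1 h,
      hRU b hb (hY h)]
  -- virtual edges of `g`
  let I : Set E := {d | d ∈ Dg ∧ ¬ adj (g d) d}
  have hUS : ∀ b ∈ U j, b ∈ ⋃ i, S i := fun b hb => by
    obtain ⟨k, -, h⟩ := T.exists_mem hb
    exact Set.mem_iUnion.2 ⟨k, h⟩
  obtain ⟨φ, t', hφ, ht'⟩ := T.exists_routes H (α := I)
    ((mk_le_mk_of_subset fun b hb => hUS b (hDgU b hb.1).1).trans (H.mk_iUnion_le T.small))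
    (fun d => g d.1) (fun d => d.1) (fun d => hUS _ (hPp _ (hP.maps _ d.2.1)).1)
    (fun d => hUS _ (hDgU _ d.2.1).1) (fun d => (hP.rel _ d.2.1).resolve_left d.2.2)
    (H.eventually_limit.and (eventually_clubF_gt j))
  let ψ : E → ι := fun b => if h : b ∈ I then φ ⟨b, h⟩ else j
  let t : E → List E := fun b => if h : b ∈ I then t' ⟨b, h⟩ else []
  have hψ : ∀ b ∈ I, IsLim (ψ b) ∧ j < ψ b ∧ IsRoute adj (dm (ψ b)) F (g b) b (t b) ∧
      ∀ e ∈ t b, e ∈ S (ψ b) := by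
    intro b hb
    have := ht' ⟨b, hb⟩
    simp only [ψ, t, dif_pos hb]
    exact ⟨this.1.1, this.1.2, this.2⟩
  have hψinj : ∀ b ∈ I, ∀ b' ∈ I, ψ b = ψ b' → b = b' := by
    intro b hb b' hb' h
    simp only [ψ, dif_pos hb, dif_pos hb'] at h
    simpa using hφ h
  have htdm : ∀ b ∈ I, ∀ e ∈ t b, e ∈ dm (ψ b) := fun b hb => (hψ b hb).2.2.1.mem
  have htU' : ∀ b ∈ I, ∀ e ∈ t b, e ∉ U (ψ b) := fun b hb e he =>
    (notMem_of_mem_waveDom (htdm b hb e he)).2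
  have htU : ∀ b ∈ I, ∀ e ∈ t b, e ∉ U j := fun b hb e he h =>
    htU' b hb e he (T.mono (hψ b hb).2.1.le h)
  -- the routes stay inside the neighbourhood of `Z`
  have hlist : ∀ (l : List E) (b : E) (k : ι) (a : E), a ∈ P → j < k → b ∉ L' →
      (b :: l).IsChain (fun d d' => d' ∈ dm k ∧ adj (F d') d) →
      (∀ z ∈ (b :: l).getLast?, adj a z) → b ∈ nb adj L' Z ∧ ∀ e ∈ l, e ∈ R := by
    intro l
    induction l with
    | nil =>
      intro b k a ha _ hb _ hl
      exact ⟨⟨hb, a, Or.inl ha, hl b (by simp)⟩, by simp⟩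
    | cons z l ih =>
      intro b k a ha hk hb hc hl
      rw [List.isChain_cons_cons] at hc
      have hzL := notMem_of_mem_waveDom hc.1.1
      have hzU : z ∉ U j := fun h => hzL.2 (T.mono hk.le h)
      have hz : z ∉ L' := by
        rintro (((h | h) | h) | h)
        · exact hzL.1 h
        · exact hzU (T.mono hij.le h)
        · refine hb (Or.inl (Or.inr ⟨?_, F z, hwi.maps z h, hc.1.2⟩))
          have := hnotL' b hb
          rintro (h | h)
          exacts [this.1 h, this.2.1 h]
        · exact hzU (hY h)
      obtain ⟨h1, h2⟩ := ih z k a ha hk hz hc.2 fun z' hz' => hl z' (by simpa using hz')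
      have h3 := hD2 z h1 hzU
      refine ⟨⟨hb, F z, Or.inr ⟨z, h3, rfl⟩, hc.1.2⟩, ?_⟩
      intro e he
      rcases List.mem_cons.1 he with rfl | he
      exacts [h3, h2 e he]
  have hI : ∀ b ∈ I, b ∈ nb adj L' Z ∧ ∀ e ∈ t b, e ∈ R := fun b hb =>
    hlist (t b) b (ψ b) (g b) (hP.maps b hb.1) (hψ b hb).2.1 (hDgU b hb.1).2
      (hψ b hb).2.2.1.chain (hψ b hb).2.2.1.last
  have hteq : ∀ b ∈ I, ∀ b' ∈ I, ∀ e, e ∈ t b → e ∈ t b' → b = b' := fun b hb b' hb' e he he' =>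
    hψinj b hb b' hb' (T.level_eq ((hψ b hb).2.2.2 e he) (htU' b hb e he)
      ((hψ b' hb').2.2.2 e he') (htU' b' hb' e he'))
  let h : E → E := fun b => if b ∈ U j then g b else F b
  have hh1 : ∀ b ∈ Dg, h b = g b := fun b hb => if_pos (hDgU b hb).1
  have hh2 : ∀ b ∈ R, h b = F b := fun b hb => if_neg (hRU b hb)
  have hsplit : ∀ b ∈ nb adj L' Z, b ∈ Dg ∨ b ∈ R := fun b hb => by
    by_cases hbU : b ∈ U j
    exacts [Or.inl (hD1 b hb hbU), Or.inr (hD2 b hb hbU)]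
  have hhx : ∀ b ∈ nb adj L' Z, h b ≠ x := by
    intro b hb
    rcases hsplit b hb with h' | h'
    · rw [hh1 b h']; exact hxg b h'
    · rw [hh2 b h']
      exact fun he => hFU b h' (he ▸ (hPp x hx).1)
  have key := fun hray => IsWave.of_reroute (adj := adj) (K := K ∪ U i ∪ waveSet adj K L (U i))
    (L := L') (S := Z) (h := h) I (fun b => b :: t b) (fun b hb => (hψ b hb).2.2.1.nodup)
    (fun b hb b' hb' e he he' => by
      rcases List.mem_cons.1 he with rfl | he <;> rcases List.mem_cons.1 he' with rfl | he'
      · rfl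
      · exact absurd (hDgU _ hb.1).1 (htU _ hb' _ he')
      · exact absurd (hDgU _ hb'.1).1 (htU _ hb _ he)
      · exact hteq b hb b' hb' e he he')
    (by
      rintro a (ha | ⟨d, hd, rfl⟩)
      · exact (hPp a ha).2.1
      · have h1 := hwj.notMem _ (hwj.maps d hd.1)
        rintro ((h' | h') | h')
        · exact h1 (Or.inl h')
        · exact h1 (Or.inr (T.mono hij.le h'))
        · exact hd.2.1 (hdmi d (hRF hd) h'))
    (fun b hb e he => by
      rcases List.mem_cons.1 he with rfl | he
      exacts [(hI _ hb).1, hD3 ((hI b hb).2 e he)])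
    (fun b hb => by
      rcases hsplit b hb with h' | h'
      · rw [hh1 b h']; exact Or.inl (hP.maps b h')
      · rw [hh2 b h']; exact Or.inr ⟨b, h', rfl⟩)
    (fun b hb b' hb' he => by
      rcases hsplit b hb with h1 | h1 <;> rcases hsplit b' hb' with h2 | h2
      · rw [hh1 b h1, hh1 b' h2] at he
        exact hP.inj h1 h2 he
      · rw [hh1 b h1, hh2 b' h2] at he
        exact absurd (he ▸ (hPp _ (hP.maps b h1)).1) (hFU b' h2)
      · rw [hh2 b h1, hh1 b' h2] at he
        exact absurd (he ▸ (hPp _ (hP.maps b' h2)).1) (hFU b h1)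
      · rw [hh2 b h1, hh2 b' h2] at he
        exact T.injOn hr (hRF h1) (hRF h2) he)
    (fun b hb hn => by
      rcases hsplit b hb with h' | h'
      · rw [hh1 b h']
        by_contra hc
        exact hn b ⟨h', hc⟩ List.mem_cons_self
      · rw [hh2 b h']; exact chainFun_rel hr (hRF h'))
    (fun b hb => by
      have h1 := (hψ b hb).2.2.1.chain
      have h2 := (hI b hb).2
      refine List.isChain_iff_getElem.2 fun n hn => ?_
      have h5 := List.isChain_iff_getElem.1 h1 n hn
      have hmem : (b :: t b)[n + 1] ∈ t b := by simp
      rw [hh2 _ (h2 _ hmem)]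
      exact h5.2)
    (fun b hb l hl y hy => by
      obtain rfl : b = y := by simpa using hy
      rw [hh1 b hb.1]
      exact (hψ b hb).2.2.1.last l hl)
    hray
  suffices hray : _ by
    obtain ⟨k, hk, hkh⟩ := key hray
    refine hu ⟨Z, k, hk, x, Or.inl hx, fun b hb he => ?_⟩
    obtain ⟨b', hb', he'⟩ := hkh b hb
    exact hhx b' hb' (he' ▸ he)
  intro c hc1 hc2
  have hlev : ∀ b ∈ I, ∀ e ∈ t b, ∀ l, e ∈ U l ↔ ψ b < l := fun b hb e he l =>
    T.mem_iff_of_level ((hψ b hb).2.2.2 e he) (htU' b hb e he)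
  have hcU : ∀ b ∈ U j, (c b = b ∨ b ∈ I ∧ c b ∈ t b) := by
    intro b hb
    by_cases hex : ∃ q ∈ I, b ∈ q :: t q
    · obtain ⟨q, hq, hbq⟩ := hex
      rcases List.mem_cons.1 hbq with rfl | h'
      · rcases List.mem_cons.1 ((hc2 _ hq _).2 hbq) with h' | h'
        exacts [Or.inl h', Or.inr ⟨hq, h'⟩]
      · exact absurd hb (htU q hq b h')
    · push Not at hex
      exact Or.inl (hc1 b hex)
  have hcR : ∀ b, b ∉ U j → (c b = b ∨ ∃ q ∈ I, b ∈ t q ∧ (c b = q ∨ c b ∈ t q)) := by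
    intro b hb
    by_cases hex : ∃ q ∈ I, b ∈ q :: t q
    · obtain ⟨q, hq, hbq⟩ := hex
      refine Or.inr ⟨q, hq, ?_, List.mem_cons.1 ((hc2 q hq b).2 hbq)⟩
      rcases List.mem_cons.1 hbq with rfl | h'
      exacts [absurd (hDgU _ hq.1).1 hb, h']
    · push Not at hex
      exact Or.inl (hc1 b hex)
  have hFlim : ∀ b ∈ R, ∀ q ∈ I, (F b ∈ U (ψ q) ↔ b ∈ U (ψ q)) := fun b hb q hq =>
    T.chainFun_mem_iff hr (hψ q hq).1 (hRF hb)
  intro u huinj hu'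
  have hu' : ∀ n, u n ∈ nb adj L' Z ∧ u (n + 1) = h (c (u n)) := hu'
  have hret : ∀ N, u N ∈ U j → ∀ n > N, (∃ m > N, u m = g (u N)) ∨
      (u N ∈ I ∧ u n ∉ U j ∧ ∀ q ∈ I, (u n ∈ U (ψ q) ↔ ψ (u N) < ψ q)) := by
    intro N hN n hn
    have hNg := hD1 _ (hu' N).1 hN
    induction n, hn using Nat.le_induction with
    | base =>
      rcases hcU _ hN with h' | ⟨h1, h2⟩
      · refine Or.inl ⟨N + 1, by simp, ?_⟩
        rw [(hu' N).2, h', hh1 _ hNg]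
      · have h3 := (hI _ h1).2 _ h2
        have h4 : u (N + 1) = F (c (u N)) := by rw [(hu' N).2, hh2 _ h3]
        refine Or.inr ⟨h1, ?_⟩
        rw [Nat.succ_eq_add_one, h4]
        refine ⟨hFU _ h3, fun q hq => ?_⟩
        rw [hFlim _ h3 q hq, hlev _ h1 _ h2]
    | succ n hn ih =>
      rcases ih with ih | ⟨h1, h2, h3⟩
      · exact Or.inl ih
      have hnR := hD2 _ (hu' n).1 h2
      rcases hcR _ h2 with h' | ⟨q, hq, hq1, hq2⟩
      · refine Or.inr ⟨h1, ?_⟩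
        have h4 : u (n + 1) = F (u n) := by rw [(hu' n).2, h', hh2 _ hnR]
        rw [h4]
        refine ⟨hFU _ hnR, fun q hq => ?_⟩
        rw [hFlim _ hnR q hq, h3 q hq]
      · have hqN : q = u N := by
          refine hψinj q hq _ h1 ?_
          have e1 := h3 q hq
          have e2 := h3 _ h1
          rw [hlev q hq _ hq1] at e1 e2
          exact le_antisymm (not_lt.1 fun h => lt_irrefl _ (e1.2 h))
            (not_lt.1 fun h => lt_irrefl _ (e2.1 h))
        subst hqN
        rcases hq2 with hq2 | hq2
        · refine Or.inl ⟨n + 1, by omega, ?_⟩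
          rw [(hu' n).2, hq2, hh1 _ hNg]
        · have h5 := (hI _ h1).2 _ hq2
          have h4 : u (n + 1) = F (c (u n)) := by rw [(hu' n).2, hh2 _ h5]
          refine Or.inr ⟨h1, ?_⟩
          rw [h4]
          refine ⟨hFU _ h5, fun q hq => ?_⟩
          rw [hFlim _ h5 q hq, hlev _ h1 _ hq2]
  by_cases hinf : ∀ N, ∃ n ≥ N, u n ∈ U j
  · have hnext : ∀ N, ∃ m, u N ∈ U j → N < m ∧ u m = g (u N) := by
      intro N
      by_cases hN : u N ∈ U j
      · obtain ⟨n, hn, hnU⟩ := hinf (N + 1)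
        rcases hret N hN n hn with ⟨m, hm, he⟩ | h'
        · exact ⟨m, fun _ => ⟨hm, he⟩⟩
        · exact absurd hnU h'.2.1
      · exact ⟨0, fun h => absurd h hN⟩
    choose nx hnx using hnext
    obtain ⟨N, -, hN⟩ := hinf 0
    let s : ℕ → ℕ := fun n => nx^[n] N
    have hs1 : ∀ n, s (n + 1) = nx (s n) := fun n => Function.iterate_succ_apply' nx n N
    have hs : ∀ n, u (s n) ∈ U j := by
      intro n
      induction n with
      | zero => exact hN
      | succ n ih =>
        rw [hs1, (hnx _ ih).2]
        exact (hPp _ (hP.maps _ (hD1 _ (hu' _).1 ih))).1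
    have hmono : StrictMono s := strictMono_nat_of_lt_succ fun n => by
      rw [hs1]; exact (hnx _ (hs n)).1
    refine hP.noRay (fun n => u (s n)) (huinj.comp hmono.injective) fun n =>
      ⟨hD1 _ (hu' _).1 (hs n), ?_⟩
    simp only [hs1]
    exact (hnx _ (hs n)).2
  · push Not at hinf
    obtain ⟨N, hN⟩ := hinf
    let D' : Set E := {b | b ∈ R ∧ c b ∈ R}
    have hD' : NoRay D' fun b => F (c b) := by
      have hct : ∀ b ∈ D', c b = b ∨ ∃ q ∈ I, b ∈ t q ∧ c b ∈ t q := by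
        intro b hb
        rcases hcR b (hRU b hb.1) with h' | ⟨q, hq, h1, h2 | h2⟩
        · exact Or.inl h'
        · exact absurd (h2 ▸ (hDgU q hq.1).1) (hRU _ hb.2)
        · exact Or.inr ⟨q, hq, h1, h2⟩
      refine NoRay.of_levels (U := U) (F := F) (Lv := ψ '' I)
        (R := fun l => {e | ∃ b ∈ I, ψ b = l ∧ e ∈ t b}) ?_ ?_ ?_
        ((chainFun_noRay hr).mono fun b hb => ⟨hRF hb.1, rfl⟩) ?_ ?_
      · intro l hl
        refine Set.eq_empty_of_forall_notMem ?_
        rintro e ⟨⟨b, hb, rfl, he⟩, heU⟩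
        exact htU' b hb e he heU
      · rintro l hl k hk e ⟨b, hb, rfl, he⟩
        exact (hlev b hb e he k).2 hk
      · rintro _ ⟨q, hq, rfl⟩ b hb _
        rw [hFlim _ hb.2 q hq]
        rcases hct b hb with h' | ⟨q', hq', h1, h2⟩
        · rw [h']
        · rw [hlev q' hq' _ h1, hlev q' hq' _ h2]
      · intro b hb hn
        rcases hct b hb with h' | ⟨q', hq', h1, h2⟩
        · simp only [h']
        · exact absurd ⟨q', hq', rfl, h1⟩ (hn _ ⟨q', hq', rfl⟩)
      · rintro _ ⟨q, hq, rfl⟩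
        refine ⟨fun b => if b ∈ t q then F (c b) else F b,
          ((chainFun_noRay hr).mono (D' := D') fun b hb => ⟨hRF hb.1, rfl⟩).of_finite
            ((t q).finite_toSet.subset ?_), ?_⟩
        · rintro b ⟨hb, hb'⟩
          by_contra hbt
          exact hb' ⟨hb, if_neg hbt⟩
        · intro b hb hn
          by_cases hbq : b ∈ t q
          · simp only [hbq, if_true]
          · simp only [hbq, if_false]
            rcases hct b hb with h' | ⟨q', hq', h1, h2⟩
            · rw [h']
            · refine absurd ⟨q', hq', rfl, h1⟩ (hn (ψ q') ⟨q', hq', rfl⟩ fun he => hbq ?_)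
              rwa [← hψinj q' hq' q hq he]
    refine hD'.tail huinj N fun n hn => ?_
    have hnR := hD2 _ (hu' n).1 (hN n hn)
    have hcn : c (u n) ∈ R := by
      rcases hcR _ (hN n hn) with h' | ⟨q, hq, h1, h2 | h2⟩
      · rwa [h']
      · refine absurd ?_ (hN (n + 1) (by omega))
        rw [(hu' n).2, h2, hh1 _ hq.1]
        exact (hPp _ (hP.maps _ hq.1)).1
      · exact (hI q hq).2 _ h2
    exact ⟨⟨hnR, hcn⟩, by rw [(hu' n).2, hh2 _ hcn]⟩

end IsTower

end Web

namespace Web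

section

variable {E : Type*}

/-- All vertices outside `K` can be matched injectively to vertices outside `L`. -/
def Linkable (adj : E → E → Prop) (K L : Set E) : Prop :=
  ∃ M : E → E, Set.InjOn M Kᶜ ∧ ∀ a, a ∉ K → M a ∉ L ∧ adj a (M a)

theorem sdiff_union_unhindered {adj : E → E → Prop} {K L W Y : Set E} {f : E → E}
    (hr : ∀ a, adj a a) (hu : ¬ Hindered adj K L) (hW : IsWave adj K L W f)
    (hmax : ∀ (S : Set E) (g : E → E), IsWave adj K L S g → S ⊆ W) (hY : Y.Subsingleton)
    (hYW : ∀ b ∈ Y, b ∉ nb adj L W) :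
    ¬ Hindered adj (K ∪ W) (L ∪ nb adj L W ∪ Y) := by
  rcases hY.eq_empty_or_singleton with rfl | ⟨b, rfl⟩
  · rw [Set.union_empty]
    exact IsWave.sdiff_unhindered hr hu hW
  · have hb := hYW b rfl
    have h := IsWave.sdiff_unhindered hr (not_hindered_insert_right hr hu hW hmax hb)
      (hW.mono_right Set.subset_union_left)
    rwa [nb_eq_of_notMem hb, Set.union_right_comm] at h

end

namespace IsTower

variable {E : Type u} {ι : Type u} [LinearOrder ι] [WellFoundedLT ι] {μ : Cardinal.{u}}
  {adj : E → E → Prop} {K L : Set E} {X S U : ι → Set E}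

/-- A matching using virtual edges: the pairs that are not adjacent are joined by routes at
stationarily many stages. -/
theorem exists_virtual_matching (T : IsTower μ adj K L X S U) (H : RegularOrder μ ι)
    (hr : ∀ a, adj a a)
    (hlink : ∀ (adj' : E → E → Prop) (K' L' : Set E), (∀ a, adj' a a) → #(K'ᶜ : Set E) < μ →
      ¬ Hindered adj' K' L' → Linkable adj' K' L') {h : ι → ι}
    (hun : ∀ j, IsCl h j → IsLim j ∧ ¬ Hindered adj (K ∪ U j) (L ∪ U j))
    (href : ∀ j, IsCl h j → (∃ i, i < j) → Reflects adj K L U j) :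
    ∃ M : E → E, Set.InjOn M ((⋃ i, S i) \ K) ∧ (∀ a ∈ (⋃ i, S i) \ K, M a ∈ ⋃ i, S i) ∧
      (∀ a ∈ (⋃ i, S i) \ K, M a ∉ L) ∧
      (∀ a ∈ (⋃ i, S i) \ K, adj a (M a) ∨
        Virt adj K L U a (M a) ∧ ∀ j, IsCl h j → M a ∉ waveDom adj K L (U j)) ∧
      ∀ j, IsCl h j → ∀ b ∈ waveDom adj K L (U j), M (chainFun adj K L U b) = b := by
  classical
  have := H.neBot
  set F := chainFun adj K L U with hF
  set dm : ι → Set E := fun j => waveDom adj K L (U j) with hdm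
  have hdmU : ∀ k, dm k ⊆ ⋃ k, waveDom adj K L (U k) := fun k =>
    Set.subset_iUnion (fun k => waveDom adj K L (U k)) k
  have hwave := fun j (hj : IsCl h j) => T.isWave_chainFun (K := K) (L := L) hr (hun j hj).1
  have hlt : ∀ {i j : ι} {b : E}, b ∈ U j → b ∉ U i → i < j := fun {i j b} hb hn =>
    not_le.1 fun hle => hn (T.mono hle hb)
  have hUS : ∀ j, ∀ b ∈ U j, b ∈ ⋃ i, S i := fun j b hb => by
    obtain ⟨k, -, h⟩ := T.exists_mem hb
    exact Set.mem_iUnion.2 ⟨k, h⟩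
  have hlev : ∀ a ∈ ⋃ i, S i, ∃ l, a ∈ S l ∧ a ∉ U l := by
    intro a ha
    have hne : {l | a ∈ S l}.Nonempty := Set.mem_iUnion.1 ha
    refine ⟨_, wellFounded_lt.min_mem _ hne, fun hU => ?_⟩
    obtain ⟨k, hk, hk'⟩ := T.exists_mem hU
    exact wellFounded_lt.not_lt_min {l | a ∈ S l} hk' hk
  have hnext : ∀ i, ∃ j, i < j ∧ IsCl h j ∧ ∀ k, IsCl h k → k < j → k ≤ i := by
    intro i
    have hne : {j | i < j ∧ IsCl h j}.Nonempty := H.exists_isCl h i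
    have hm := wellFounded_lt.min_mem _ hne
    exact ⟨_, hm.1, hm.2, fun k hk hlt =>
      not_lt.1 fun hik => wellFounded_lt.not_lt_min _ (show k ∈ {j | i < j ∧ IsCl h j} from
        ⟨hik, hk⟩) hlt⟩
  choose nx hnx hnxcl hnxle using hnext
  -- vertices that are not poor
  have hgood : ∀ᶠ j in clubF ι, IsCl h j := eventually_clubF.2 ⟨h, fun j _ hj => hj⟩
  let A₂ : Set E := {a | a ∈ ⋃ i, S i ∧ ¬ Poor adj K L U a}
  obtain ⟨φ, hφ, hφ'⟩ := H.exists_injective_choice (α := A₂)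
    ((mk_le_mk_of_subset fun b hb => hb.1).trans (H.mk_iUnion_le T.small))
    (fun a => {l | IsCl h l ∧ ∃ y ∈ nb adj (L ∪ U l) {a.1}, y ∉ dm l ∧ y ∈ S l}) (fun a i => by
      have h1 : ∃ᶠ l in clubF ι, ¬ nb adj (L ∪ U l) {a.1} ⊆ waveDom adj K L (U l) :=
        not_eventually.1 a.2.2
      obtain ⟨j, hj, ⟨⟨h1, h2⟩, h3⟩⟩ := frequently_exists_gt
        ((h1.and_eventually hgood).and_eventually (T.eventually_mem a.2.1)) i
      refine ⟨j, ⟨h2, (T.stage j).rich a.1 h3 ?_⟩, hj⟩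
      obtain ⟨y, hy, hy'⟩ := Set.not_subset.1 h1
      exact ⟨y, hy, hy'⟩)
  choose hφcl y hy hydm hyS using hφ'
  have hyU : ∀ a, y a ∉ U (φ a) := fun a hU => (hy a).1 (Or.inr hU)
  have hyn : ∀ a, ∀ i, IsCl h i → y a ∉ dm i := by
    intro a i hi hyi
    refine hydm a (T.waveDom_diff_subset hr (hun _ (hφcl a)).1 (k := i) ?_ ⟨hyi, hyU a⟩)
    refine not_lt.1 fun hlt => (notMem_of_mem_waveDom hyi).2 ?_
    exact T.subset_of_lt hlt (hyS a)
  -- local matchings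
  let Y : ι → Set E := fun i => {b | ∃ a, φ a = i ∧ y a = b}
  have hYss : ∀ i, (Y i).Subsingleton := by
    rintro i _ ⟨a, rfl, rfl⟩ _ ⟨a', h', rfl⟩
    rw [hφ h']
  let A : ι → Set E := fun i =>
    {a | a ∈ U (nx i) ∧ a ∉ K ∪ U i ∪ waveSet adj K L (U i) ∧ Poor adj K L U a}
  have hloc : ∀ i, ∃ m : E → E, IsCl h i → Set.InjOn m (A i) ∧ ∀ a ∈ A i,
      (m a ∈ U (nx i) ∧ m a ∉ L ∪ U i ∪ dm i ∪ Y i) ∧ AdjVirt adj K L U a (m a) := by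
    intro i
    by_cases hi : IsCl h i
    · have hYU : Y i ⊆ U (nx i) := by
        rintro _ ⟨a, rfl, rfl⟩
        exact T.subset_of_lt (hnx _) (hyS a)
      have h1 := sdiff_union_unhindered hr (hun i hi).2 (isWave_waveSet hr (U i))
        (fun S g hS => subset_waveSet hr hS) (hYss i) (by
          rintro _ ⟨a, rfl, rfl⟩
          exact hydm a)
      have h2 := T.not_hindered_adjVirt H hr (href _ (hnxcl i) ⟨i, hnx i⟩) (hnx i) (hun i hi).1
        (hun i hi).2 hYU h1
      obtain ⟨m, hm, hm'⟩ := hlink _ _ _ (fun a => Or.inl (hr a)) (by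
        rw [compl_compl]
        refine (mk_le_mk_of_subset (fun b hb => hb.1)).trans_lt (?_ : #(U (nx i)) < μ)
        rw [T.eq]
        exact H.mk_biUnion_lt T.small _) h2
      rw [compl_compl] at hm
      refine ⟨m, fun _ => ⟨hm, fun a ha => ?_⟩⟩
      obtain ⟨h3, h4⟩ := hm' a (not_not.2 ha)
      exact ⟨not_not.1 h3, h4⟩
    · exact ⟨id, fun h => absurd h hi⟩
  choose m hm using hloc
  have hnot : ∀ i a, IsCl h i → a ∈ A i → m i a ∉ U i ∧ m i a ∉ L ∧ m i a ∉ Y i := by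
    intro i a hi ha
    have := ((hm i hi).2 a ha).1.2
    simp only [Set.mem_union, not_or] at this
    exact ⟨this.1.1.2, this.1.1.1, this.2⟩
  have hmdm : ∀ i a, IsCl h i → a ∈ A i → ∀ k, IsCl h k → m i a ∉ dm k := by
    intro i a hi ha k hk hmk
    have h1 := ((hm i hi).2 a ha).1
    have hk' : k ≤ i := hnxle i k hk (hlt h1.1 (notMem_of_mem_waveDom hmk).2)
    exact h1.2 (Or.inl (Or.inr (T.waveDom_diff_subset hr (hun i hi).1 hk'
      ⟨hmk, (hnot i a hi ha).1⟩)))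
  -- the block of a vertex
  have hblock : ∀ a, ∃ i, a ∈ (⋃ i, S i) \ K →
      (∀ i, IsCl h i → a ∉ waveSet adj K L (U i)) → Poor adj K L U a → IsCl h i ∧ a ∈ A i := by
    intro a
    by_cases ha : a ∈ ⋃ i, S i
    · obtain ⟨l, hl, hl'⟩ := hlev a ha
      obtain ⟨i, hil, hi, hmaxi⟩ := H.exists_greatest_isCl h l
      refine ⟨i, fun h1 h2 h3 => ⟨hi, T.subset_of_lt ?_ hl, ?_, h3⟩⟩
      · exact not_le.1 fun hle => (hnx i).not_ge (hmaxi _ (hnxcl i) hle)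
      · rintro ((h' | h') | h')
        exacts [h1.2 h', hl' (T.mono hil h'), h2 i hi h']
    · have ⟨i⟩ := H.nonempty
      exact ⟨i, fun h => absurd h.1 ha⟩
  choose ib hib using hblock
  have hinv : ∀ a, ∃ b, (∃ i, IsCl h i ∧ a ∈ waveSet adj K L (U i)) →
      (∃ i, IsCl h i ∧ b ∈ dm i) ∧ F b = a := by
    intro a
    by_cases ha : ∃ i, IsCl h i ∧ a ∈ waveSet adj K L (U i)
    · obtain ⟨i, hi, hai⟩ := ha
      obtain ⟨b, hb, he⟩ := (hwave i hi).surj (hun i hi).2 hai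
      exact ⟨b, fun _ => ⟨⟨i, hi, hb⟩, he⟩⟩
    · exact ⟨a, fun h => absurd h ha⟩
  choose inv hinv using hinv
  let M : E → E := fun a =>
    if ∃ i, IsCl h i ∧ a ∈ waveSet adj K L (U i) then inv a
    else if ha : a ∈ A₂ then y ⟨a, ha⟩ else m (ib a) a
  have hcase : ∀ a ∈ (⋃ i, S i) \ K,
      ((∃ i, IsCl h i ∧ M a ∈ dm i) ∧ F (M a) = a) ∨
      (∃ ha : a ∈ A₂, M a = y ⟨a, ha⟩) ∨ (IsCl h (ib a) ∧ a ∈ A (ib a) ∧ M a = m (ib a) a) := by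
    intro a ha
    by_cases h1 : ∃ i, IsCl h i ∧ a ∈ waveSet adj K L (U i)
    · simp only [M, if_pos h1]
      exact Or.inl (hinv a h1)
    · by_cases h2 : a ∈ A₂
      · exact Or.inr (Or.inl ⟨h2, by simp only [M, if_neg h1, dif_pos h2]⟩)
      · have h3 := hib a ha (fun i hi h => h1 ⟨i, hi, h⟩) (by
          by_contra hP
          exact h2 ⟨ha.1, hP⟩)
        exact Or.inr (Or.inr ⟨h3.1, h3.2, by simp only [M, if_neg h1, dif_neg h2]⟩)
  have hlimU : ∀ a ∈ ⋃ i, S i, ∃ k, IsLim k ∧ a ∈ U k := fun a ha =>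
    (H.eventually_limit.and (T.eventually_mem ha)).exists
  have hyne : ∀ a i a', IsCl h i → a' ∈ A i → y a ≠ m i a' := by
    intro a i a' hi ha' he
    have h1 := ((hm i hi).2 a' ha').1.1
    have h2 := hnot i a' hi ha'
    rw [← he] at h1 h2
    have h3 : φ a ≤ i := hnxle i _ (hφcl a) (hlt h1 (hyU a))
    have h4 : i ≤ φ a := not_lt.1 fun h => h2.1 (T.subset_of_lt h (hyS a))
    exact h2.2.2 ⟨a, le_antisymm h3 h4, rfl⟩
  refine ⟨M, ?_, ?_, ?_, ?_, ?_⟩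
  · intro a ha a' ha' he
    rcases hcase a ha with ⟨⟨i, hi, hd⟩, hFa⟩ | ⟨h2, h2'⟩ | ⟨h3, h3', h3''⟩ <;>
    rcases hcase a' ha' with ⟨⟨i', hi', hd'⟩, hFa'⟩ | ⟨k2, k2'⟩ | ⟨k3, k3', k3''⟩
    · rw [← hFa, ← hFa', he]
    · rw [he, k2'] at hd
      exact absurd hd (hyn _ i hi)
    · rw [he, k3''] at hd
      exact absurd hd (hmdm _ _ k3 k3' i hi)
    · rw [← he, h2'] at hd'
      exact absurd hd' (hyn _ i' hi')
    · rw [h2', k2'] at he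
      have hφe : φ ⟨a, h2⟩ = φ ⟨a', k2⟩ :=
        T.level_eq (hyS _) (hyU _) (he ▸ hyS _) (he ▸ hyU _)
      simpa using hφ hφe
    · exact absurd (h2' ▸ he ▸ k3'') (hyne _ _ _ k3 k3')
    · rw [← he, h3''] at hd'
      exact absurd hd' (hmdm _ _ h3 h3' i' hi')
    · exact absurd (k2' ▸ he ▸ h3'') (hyne _ _ _ h3 h3')
    · rw [h3'', k3''] at he
      have e1 := ((hm _ h3).2 a h3').1.1
      have e2 := ((hm _ k3).2 a' k3').1.1
      have n1 := (hnot _ _ h3 h3').1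
      have n2 := (hnot _ _ k3 k3').1
      have hieq : ib a = ib a' := by
        refine le_antisymm ?_ ?_
        · exact hnxle _ _ h3 (hlt e2 (he ▸ n1))
        · exact hnxle _ _ k3 (hlt e1 (he.symm ▸ n2))
      rw [← hieq] at he k3'
      exact (hm _ h3).1 h3' k3' he
  · intro a ha
    rcases hcase a ha with ⟨⟨i, hi, hd⟩, hFa⟩ | ⟨h2, h2'⟩ | ⟨h3, h3', h3''⟩
    · obtain ⟨k, hk, hak⟩ := hlimU a ha.1
      rw [← hFa] at hak
      exact hUS k _ ((T.chainFun_mem_iff hr hk (hdmU i hd)).1 hak)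
    · rw [h2']
      exact Set.mem_iUnion.2 ⟨_, hyS _⟩
    · rw [h3'']
      exact hUS _ _ ((hm _ h3).2 a h3').1.1
  · intro a ha
    rcases hcase a ha with ⟨⟨i, hi, hd⟩, hFa⟩ | ⟨h2, h2'⟩ | ⟨h3, h3', h3''⟩
    · exact (notMem_of_mem_waveDom hd).1
    · rw [h2']
      exact fun hL => (hy _).1 (Or.inl hL)
    · rw [h3'']
      exact (hnot _ _ h3 h3').2.1
  · intro a ha
    rcases hcase a ha with ⟨⟨i, hi, hd⟩, hFa⟩ | ⟨h2, h2'⟩ | ⟨h3, h3', h3''⟩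
    · left
      have := chainFun_rel hr (hdmU i hd)
      rwa [← hF, hFa] at this
    · left
      rw [h2']
      obtain ⟨-, a', rfl, hadj⟩ := hy ⟨a, h2⟩
      exact hadj
    · rw [h3'']
      exact ((hm _ h3).2 a h3').2.imp_right fun h => ⟨h, hmdm _ _ h3 h3'⟩
  · intro j hj b hb
    have h1 : ∃ i, IsCl h i ∧ F b ∈ waveSet adj K L (U i) := ⟨j, hj, (hwave j hj).maps b hb⟩
    simp only [M, if_pos h1]
    obtain ⟨⟨i, hi, hd⟩, he⟩ := hinv _ h1
    exact T.injOn hr (hdmU i hd) (hdmU j hb) he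

theorem exists_matching (T : IsTower μ adj K L X S U) (H : RegularOrder μ ι)
    (hr : ∀ a, adj a a) (hu : ¬ Hindered adj K L)
    (hlink : ∀ (adj' : E → E → Prop) (K' L' : Set E), (∀ a, adj' a a) → #(K'ᶜ : Set E) < μ →
      ¬ Hindered adj' K' L' → Linkable adj' K' L') :
    ∃ M : E → E, Set.InjOn M ((⋃ i, S i) \ K) ∧
      ∀ a ∈ (⋃ i, S i) \ K, M a ∈ (⋃ i, S i) ∧ M a ∉ L ∧ adj a (M a) := by
  classical
  have := H.neBot
  obtain ⟨h, hh⟩ := eventually_clubF.1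
    ((T.eventually_reflects H).and (T.eventually_not_hindered H hr hu))
  have hmin : ∀ j, (¬ ∃ i, i < j) → U j = ∅ := by
    intro j hj
    rw [T.eq]
    push Not at hj
    refine Set.eq_empty_of_forall_notMem fun b hb => ?_
    simp only [Set.mem_iUnion] at hb
    obtain ⟨i, hi, -⟩ := hb
    exact (hj i).not_gt hi
  have hun : ∀ j, IsCl h j → IsLim j ∧ ¬ Hindered adj (K ∪ U j) (L ∪ U j) := by
    intro j hj
    by_cases hex : ∃ i, i < j
    · exact ⟨(hh j hex hj).1.isLim, (hh j hex hj).2⟩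
    · refine ⟨fun i hi => absurd ⟨i, hi⟩ hex, ?_⟩
      rwa [hmin j hex, Set.union_empty, Set.union_empty]
  obtain ⟨M, hM, hMV, hML, hMadj, hMF⟩ := T.exists_virtual_matching H hr hlink hun
    fun j hj hex => (hh j hex hj).1
  set V := ⋃ i, S i with hV
  set F := chainFun adj K L U with hF
  let I : Set E := {a | a ∈ V \ K ∧ ¬ adj a (M a)}
  have hgood : ∀ᶠ j in clubF ι, IsCl h j := eventually_clubF.2 ⟨h, fun j _ hj => hj⟩
  have hIv : ∀ a ∈ I, Virt adj K L U a (M a) ∧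
      ∀ j, IsCl h j → M a ∉ waveDom adj K L (U j) := fun a ha =>
    (hMadj a ha.1).resolve_left ha.2
  obtain ⟨φ, t', hφ, ht'⟩ := T.exists_routes H (α := I)
    ((mk_le_mk_of_subset fun b hb => hb.1.1).trans (H.mk_iUnion_le T.small))
    (fun d => d.1) (fun d => M d.1) (fun d => d.2.1.1) (fun d => hMV _ d.2.1)
    (fun d => (hIv d.1 d.2).1) hgood
  let t : E → List E := fun b => if h : b ∈ I then t' ⟨b, h⟩ else []
  have ht : ∀ a (ha : a ∈ I), IsCl h (φ ⟨a, ha⟩) ∧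
      IsRoute adj (waveDom adj K L (U (φ ⟨a, ha⟩))) F a (M a) (t a) ∧
      ∀ e ∈ t a, e ∈ S (φ ⟨a, ha⟩) := by
    intro a ha
    simp only [t, dif_pos ha]
    exact ht' ⟨a, ha⟩
  have htV : ∀ a ∈ I, ∀ e ∈ M a :: t a, e ∈ V ∧ e ∉ L := by
    intro a ha e he
    rcases List.mem_cons.1 he with rfl | he
    · exact ⟨hMV a ha.1, hML a ha.1⟩
    · exact ⟨Set.mem_iUnion.2 ⟨_, (ht a ha).2.2 e he⟩,
        (notMem_of_mem_waveDom ((ht a ha).2.1.mem e he)).1⟩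
  obtain ⟨cyc, hc1, hc2, hc3⟩ := exists_reroute I (fun a => M a :: t a)
    (fun a ha => (ht a ha).2.1.nodup) (fun a ha a' ha' e he he' => by
      rcases List.mem_cons.1 he with rfl | he <;> rcases List.mem_cons.1 he' with he' | he'
      · exact hM ha.1 ha'.1 he'
      · exact absurd ((ht a' ha').2.1.mem _ he') ((hIv a ha).2 _ (ht a' ha').1)
      · subst he'
        exact absurd ((ht a ha).2.1.mem _ he) ((hIv a' ha').2 _ (ht a ha).1)
      · have hU : ∀ a (ha : a ∈ I), ∀ e ∈ t a, e ∉ U (φ ⟨a, ha⟩) := fun a ha e he =>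
          (notMem_of_mem_waveDom ((ht a ha).2.1.mem e he)).2
        have := hφ (T.level_eq ((ht a ha).2.2 e he) (hU a ha e he)
          ((ht a' ha').2.2 e he') (hU a' ha' e he'))
        simpa using this)
  have hR : ∀ a ∈ I, ∀ e ∈ M a :: t a, ∃ a' ∈ V \ K, M a' = cyc e ∧ adj a' e := by
    intro a ha
    refine hc3 (fun e e' => ∃ a' ∈ V \ K, M a' = e' ∧ adj a' e) a ha ?_ ?_
    · refine (List.isChain_iff_getElem.2 fun n hn => ?_)
      have h1 := List.isChain_iff_getElem.1 (ht a ha).2.1.chain n hn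
      have hmem : (M a :: t a)[n + 1] ∈ t a := by simp
      refine ⟨F (M a :: t a)[n + 1], ⟨?_, ?_⟩, hMF _ (ht a ha).1 _ h1.1, h1.2⟩
      · obtain ⟨k, hk, hak⟩ := (H.eventually_limit.and (T.eventually_mem
          (htV a ha _ (List.mem_cons_of_mem _ hmem)).1)).exists
        have h2 := (T.chainFun_mem_iff hr hk (Set.mem_iUnion.2 ⟨_, h1.1⟩)).2 hak
        obtain ⟨i, -, hi⟩ := T.exists_mem h2
        exact Set.mem_iUnion.2 ⟨i, hi⟩
      · have hw := T.isWave_chainFun (K := K) (L := L) hr (hun _ (ht a ha).1).1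
        exact fun hK => hw.notMem _ (hw.maps _ h1.1) (Or.inl hK)
    · intro l hl x hx
      obtain rfl : M a = x := by simpa using hx
      exact ⟨a, ha.1, rfl, (ht a ha).2.1.last l hl⟩
  refine ⟨fun a => cyc.symm (M a), fun a ha a' ha' he => hM ha ha' (cyc.symm.injective he), ?_⟩
  intro a ha
  have hce : cyc (cyc.symm (M a)) = M a := cyc.apply_symm_apply _
  by_cases hex : ∃ d ∈ I, cyc.symm (M a) ∈ M d :: t d
  · obtain ⟨d, hd, hmem⟩ := hex
    obtain ⟨a', ha', h1, h2⟩ := hR d hd _ hmem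
    rw [hce] at h1
    obtain rfl := hM ha' ha h1
    exact ⟨(htV d hd _ hmem).1, (htV d hd _ hmem).2, h2⟩
  · push Not at hex
    have h1 := hc1 _ hex
    rw [hce] at h1
    show cyc.symm (M a) ∈ V ∧ cyc.symm (M a) ∉ L ∧ adj a (cyc.symm (M a))
    rw [← h1]
    refine ⟨hMV a ha, hML a ha, ?_⟩
    by_contra hn
    exact hex a ⟨ha, hn⟩ (h1 ▸ List.mem_cons_self)

end IsTower

end Web

namespace Web

section

variable {E : Type*} {adj : E → E → Prop} {K L : Set E}

/-- `M` matches `U \ K` into `U \ L` and what remains is not hindered. -/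
structure IsMatched (adj : E → E → Prop) (K L U : Set E) (M : E → E) : Prop where
  inj : Set.InjOn M (U \ K)
  mem : ∀ a ∈ U, a ∉ K → M a ∈ U
  notMem : ∀ a ∈ U, a ∉ K → M a ∉ L
  rel : ∀ a ∈ U, a ∉ K → adj a (M a)
  unhindered : ¬ Hindered adj (K ∪ U) (L ∪ U)

theorem isMatched_empty (hu : ¬ Hindered adj K L) : IsMatched adj K L ∅ id :=
  ⟨by simp, by simp, by simp, by simp, by simpa using hu⟩

theorem IsMatched.extend {U W : Set E} {M N : E → E} (h : IsMatched adj K L U M)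
    (h' : IsMatched adj (K ∪ U) (L ∪ U) W N) :
    ∃ M' : E → E, IsMatched adj K L (U ∪ W) M' ∧ Set.EqOn M' M U := by
  classical
  refine ⟨fun a => if a ∈ U then M a else N a, ⟨?_, ?_, ?_, ?_, ?_⟩, fun a ha => if_pos ha⟩
  · have hne : ∀ a a', a ∈ U → a ∉ K → a' ∈ W → a' ∉ U → a' ∉ K → M a ≠ N a' :=
      fun a a' ha haK ha' hU hK he =>
        h'.notMem a' ha' (by rintro (h | h); exacts [hK h, hU h]) (Or.inr (he ▸ h.mem a ha haK))
    intro a ha a' ha' he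
    by_cases h1 : a ∈ U <;> by_cases h2 : a' ∈ U <;> simp only [h1, h2, if_true, if_false] at he
    · exact h.inj ⟨h1, ha.2⟩ ⟨h2, ha'.2⟩ he
    · exact absurd he (hne _ _ h1 ha.2 (ha'.1.resolve_left h2) h2 ha'.2)
    · exact absurd he.symm (hne _ _ h2 ha'.2 (ha.1.resolve_left h1) h1 ha.2)
    · refine h'.inj ⟨ha.1.resolve_left h1, ?_⟩ ⟨ha'.1.resolve_left h2, ?_⟩ he
      · rintro (h | h); exacts [ha.2 h, h1 h]
      · rintro (h | h); exacts [ha'.2 h, h2 h]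
  · intro a ha hK
    by_cases h1 : a ∈ U
    · simp only [h1, if_true]; exact Or.inl (h.mem a h1 hK)
    · simp only [h1, if_false]
      exact Or.inr (h'.mem a (ha.resolve_left h1) (by rintro (h | h); exacts [hK h, h1 h]))
  · intro a ha hK
    by_cases h1 : a ∈ U
    · simp only [h1, if_true]; exact h.notMem a h1 hK
    · simp only [h1, if_false]
      exact fun hL =>
        h'.notMem a (ha.resolve_left h1) (by rintro (h | h); exacts [hK h, h1 h]) (Or.inl hL)
  · intro a ha hK
    by_cases h1 : a ∈ U
    · simp only [h1, if_true]; exact h.rel a h1 hK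
    · simp only [h1, if_false]
      exact h'.rel a (ha.resolve_left h1) (by rintro (h | h); exacts [hK h, h1 h])
  · rw [← Set.union_assoc, ← Set.union_assoc]
    exact h'.unhindered

theorem linkable_of_countable (hr : ∀ a, adj a a) (hK : (Kᶜ : Set E).Countable)
    (hu : ¬ Hindered adj K L) : Linkable adj K L := by
  classical
  rcases (Kᶜ : Set E).eq_empty_or_nonempty with hE | hne
  · exact ⟨id, by simp [hE], fun a ha => absurd (hE ▸ ha : a ∈ (∅ : Set E)) (by simp)⟩
  obtain ⟨s, hs⟩ := hK.exists_eq_range hne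
  let P : Set E × (E → E) → Prop := fun p => Set.InjOn p.2 p.1 ∧
    (∀ a ∈ p.1, p.2 a ∉ L ∧ adj a (p.2 a)) ∧ ¬ Hindered adj (K ∪ p.1) (L ∪ p.2 '' p.1)
  have hstep : ∀ (p : {p // P p}) (a : E), ∃ q : {p // P p}, p.1.1 ⊆ q.1.1 ∧
      Set.EqOn q.1.2 p.1.2 p.1.1 ∧ (a ∉ K → a ∈ q.1.1) := by
    rintro ⟨⟨A, f⟩, h1, h2, h3⟩ a
    by_cases ha : a ∈ K ∪ A
    · exact ⟨⟨⟨A, f⟩, h1, h2, h3⟩, subset_rfl, fun _ _ => rfl, fun h => ha.resolve_left h⟩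
    obtain ⟨b, hb, hab, hb'⟩ := exists_match_not_hindered hr h3 ha
    have haA : a ∉ A := fun h => ha (Or.inr h)
    have hEq : Set.EqOn (Function.update f a b) f A := fun x hx => by
      have hxa : x ≠ a := by rintro rfl; exact haA hx
      rw [Function.update_of_ne hxa]
    refine ⟨⟨⟨insert a A, Function.update f a b⟩, ?_, ?_, ?_⟩, Set.subset_insert _ _, hEq,
      fun _ => Set.mem_insert _ _⟩
    · refine (Set.injOn_insert haA).2 ⟨h1.congr hEq.symm, ?_⟩
      show Function.update f a b a ∉ Function.update f a b '' A
      rw [hEq.image_eq, Function.update_self]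
      exact fun h => hb (Or.inr h)
    · intro x hx
      by_cases hxa : x = a
      · subst hxa
        simp only [Function.update_self]
        exact ⟨fun h => hb (Or.inl h), hab⟩
      · simp only [Function.update_of_ne hxa]
        exact h2 x (hx.resolve_left hxa)
    · simp only [Set.image_insert_eq, Function.update_self, hEq.image_eq]
      rwa [← Set.union_singleton, ← Set.union_singleton, ← Set.union_assoc, ← Set.union_assoc]
  choose q hq1 hq2 hq3 using hstep
  let st : ℕ → {p // P p} := fun n => Nat.rec ⟨(∅, id), by simp [P, hu]⟩ (fun n p => q p (s n)) n
  have hmono : ∀ m n, m ≤ n → (st m).1.1 ⊆ (st n).1.1 ∧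
      Set.EqOn (st n).1.2 (st m).1.2 (st m).1.1 := by
    intro m n hmn
    induction n, hmn using Nat.le_induction with
    | base => exact ⟨subset_rfl, fun _ _ => rfl⟩
    | succ n _ ih =>
      exact ⟨ih.1.trans (hq1 (st n) (s n)), fun x hx =>
        (hq2 (st n) (s n) (ih.1 hx)).trans (ih.2 hx)⟩
  have hidx : ∀ a, ∃ n, a ∉ K → a ∈ (st n).1.1 := by
    intro a
    by_cases ha : a ∈ K
    · exact ⟨0, fun h => absurd ha h⟩
    · obtain ⟨n, rfl⟩ : a ∈ Set.range s := hs ▸ ha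
      exact ⟨n + 1, hq3 (st n) (s n)⟩
  choose idx hidx using hidx
  refine ⟨fun a => (st (idx a)).1.2 a, fun a ha a' ha' he => ?_, fun a ha => ?_⟩
  · have h1 := hmono (idx a) (max (idx a) (idx a')) (le_max_left _ _)
    have h2 := hmono (idx a') (max (idx a) (idx a')) (le_max_right _ _)
    refine (st (max (idx a) (idx a'))).2.1 (h1.1 (hidx a ha)) (h2.1 (hidx a' ha')) ?_
    rw [h1.2 (hidx a ha), h2.2 (hidx a' ha')]
    exact he
  · exact (st (idx a)).2.2.1 a (hidx a ha)

end

variable {E : Type u} {adj : E → E → Prop} {K L : Set E} {κ : Cardinal.{u}}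

/-- In every web on `E` with fewer than `κ` vertices to match, unhindered implies linkable. -/
def LinkableBelow (E : Type u) (κ : Cardinal.{u}) : Prop :=
  ∀ (adj : E → E → Prop) (K L : Set E), (∀ a, adj a a) → #(Kᶜ : Set E) < κ →
    ¬ Hindered adj K L → Linkable adj K L

theorem linkable_of_regular (hκ : κ.IsRegular) (h0 : ℵ₀ < κ) (hlink : LinkableBelow E κ)
    (hr : ∀ a, adj a a) (hu : ¬ Hindered adj K L) (hK : #(Kᶜ : Set E) ≤ κ) :
    Linkable adj K L := by
  obtain ⟨ι, _, H⟩ := exists_regularOrder hκ h0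
  have := H.wf
  rw [← H.mk_le] at hK
  obtain ⟨e⟩ := hK
  obtain ⟨S, U, T⟩ := H.exists_tower (adj := adj) (K := K) (L := L) hr
    (X := fun i => {a | ∃ h : a ∉ K, e ⟨a, h⟩ = i}) (fun i => by
      refine lt_of_le_of_lt ?_ (one_lt_aleph0.trans h0)
      refine mk_le_one_iff_set_subsingleton.2 ?_
      rintro a ⟨ha, rfl⟩ a' ⟨ha', he⟩
      simpa using e.injective he.symm)
  obtain ⟨M, hM, hM'⟩ := T.exists_matching H hr hu hlink
  have hsub : ∀ a ∉ K, a ∈ (⋃ i, S i) \ K := fun a ha =>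
    ⟨Set.mem_iUnion.2 ⟨(e ⟨a, ha⟩ : ι), (T.stage (e ⟨a, ha⟩)).target (by exact ⟨ha, rfl⟩)⟩, ha⟩
  exact ⟨M, hM.mono hsub, fun a ha => (hM' a (hsub a ha)).2⟩

theorem exists_isMatched (h0 : ℵ₀ ≤ κ) (hlink : LinkableBelow E (Order.succ κ))
    (hr : ∀ a, adj a a) (hu : ¬ Hindered adj K L) {X : Set E} (hX : #X ≤ κ) :
    ∃ (U : Set E) (M : E → E), X ⊆ U ∧ #U ≤ κ ∧ IsMatched adj K L U M := by
  obtain ⟨ι, _, H⟩ := exists_regularOrder (isRegular_succ h0) (Order.lt_succ_of_le h0)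
  have := H.wf
  have := H.neBot
  obtain ⟨S, U, T⟩ := H.exists_tower (adj := adj) (K := K) (L := L) hr
    (X := fun _ => X) (fun i => Order.lt_succ_of_le hX)
  obtain ⟨M, hM, hM'⟩ := T.exists_matching H hr hu hlink
  obtain ⟨i⟩ := H.nonempty
  have hcl : ∀ᶠ j in clubF ι, ∀ a ∈ U j, a ∉ K → M a ∈ U j :=
    T.eventually_forall H (p := fun a j => a ∉ K → M a ∈ U j) fun a ha => by
      by_cases haK : a ∈ K
      · exact Eventually.of_forall fun _ h => absurd haK h
      · filter_upwards [T.eventually_mem (hM' a ⟨ha, haK⟩).1] with j hj _ using hj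
  obtain ⟨j, ⟨h1, h2⟩, h3⟩ :=
    ((hcl.and (T.eventually_not_hindered H hr hu)).and (eventually_clubF_gt i)).exists
  have hUS : ∀ b ∈ U j, b ∈ ⋃ i, S i := fun b hb => by
    obtain ⟨k, -, h⟩ := T.exists_mem hb
    exact Set.mem_iUnion.2 ⟨k, h⟩
  have hsub : U j \ K ⊆ (⋃ i, S i) \ K := fun a ha => ⟨hUS a ha.1, ha.2⟩
  refine ⟨U j, M, ?_, Order.lt_succ_iff.1 ?_, hM.mono hsub, h1,
    fun a ha haK => (hM' a ⟨hUS a ha, haK⟩).2.1, fun a ha haK => (hM' a ⟨hUS a ha, haK⟩).2.2, h2⟩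
  · exact (T.stage i).target.trans (T.subset_of_lt h3)
  · rw [T.eq]
    exact H.mk_biUnion_lt T.small j

theorem linkable_of_singular (hκ : κ.IsSingular) (hlink : LinkableBelow E κ)
    (hr : ∀ a, adj a a) (hu : ¬ Hindered adj K L) (hK : #(Kᶜ : Set E) ≤ κ) :
    Linkable adj K L := by
  classical
  obtain ⟨s, hs, hs'⟩ := Order.exists_cof_eq κ.ord.ToType
  rw [Ordinal.cof_toType] at hs'
  rw [← mk_ord_toType κ] at hK
  obtain ⟨e⟩ := hK
  have hmk : ∀ j : κ.ord.ToType, #(Set.Iio j) < κ := fun j => by simpa using mk_Iio_lt j (by simp)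
  let c : s → Cardinal.{u} := fun j => max (max #(Set.Iic j.1) #s) ℵ₀
  have h0κ : ℵ₀ < κ := hκ.aleph0_le.lt_of_ne fun h => not_isSingular_aleph0 (h ▸ hκ)
  have hc : ∀ j, c j < κ := fun j => by
    refine max_lt (max_lt ?_ (hs' ▸ hκ.cof_ord_lt)) h0κ
    rw [← Set.Iio_insert]
    exact mk_insert_le.trans_lt (add_lt_of_lt hκ.aleph0_le (hmk _) (one_lt_aleph0.trans h0κ))
  have hc0 : ∀ j, ℵ₀ ≤ c j := fun j => le_max_right _ _
  have hcs : ∀ j, #s ≤ c j := fun j => (le_max_right _ _).trans (le_max_left _ _)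
  have hlinkc : ∀ j, LinkableBelow E (Order.succ (c j)) := fun j adj K L h1 h2 =>
    hlink adj K L h1 ((Order.lt_succ_iff.1 h2).trans_lt (hc j))
  let X : s → Set E := fun j => {a | ∃ h : a ∉ K, e ⟨a, h⟩ ≤ j}
  have hX : ∀ j, #(X j) ≤ c j := fun j => by
    refine le_trans ?_ ((le_max_left _ _).trans (le_max_left _ _))
    refine mk_le_of_injective (f := fun a : X j => (⟨e ⟨a.1, a.2.1⟩, a.2.2⟩ : Set.Iic j.1)) ?_
    intro a a' h
    simpa [Subtype.ext_iff] using e.injective (congrArg Subtype.val h)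
  have hXK : ∀ a ∉ K, ∃ j, a ∈ X j := fun a ha => by
    obtain ⟨j, hj, hle⟩ := hs (e ⟨a, ha⟩)
    exact ⟨⟨j, hj⟩, ha, hle⟩
  let P : (s → Set E) × (s → E → E) → Prop := fun p => ∀ j, #(p.1 j) ≤ c j ∧
    IsMatched adj K L (p.1 j) (p.2 j)
  have hstep : ∀ p : {p // P p}, ∃ q : {p // P p}, ∀ j, p.1.1 j ⊆ q.1.1 j ∧
      Set.EqOn (q.1.2 j) (p.1.2 j) (p.1.1 j) ∧ X j ⊆ q.1.1 j ∧
      ∀ k, ∀ a ∈ p.1.1 k, a ∉ K → p.1.2 k a ∈ p.1.1 j → a ∈ q.1.1 j := by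
    rintro ⟨⟨U, M⟩, hp⟩
    have hext : ∀ j, ∃ (U' : Set E) (M' : E → E), (#U' ≤ c j ∧ IsMatched adj K L U' M') ∧
        U j ⊆ U' ∧ Set.EqOn M' (M j) (U j) ∧ X j ⊆ U' ∧
        ∀ k, ∀ a ∈ U k, a ∉ K → M k a ∈ U j → a ∈ U' := by
      intro j
      let pre : s → Set E := fun k => {a | (a ∈ U k ∧ a ∉ K) ∧ M k a ∈ U j}
      have hpre : ∀ k, #(pre k) ≤ c j := fun k => by
        refine le_trans ?_ (hp j).1
        refine mk_le_of_injective (f := fun a : pre k => (⟨M k a.1, a.2.2⟩ : U j)) ?_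
        intro a a' h
        exact Subtype.ext ((hp k).2.inj a.2.1 a'.2.1 (congrArg Subtype.val h))
      have hcard : #(X j ∪ ⋃ k, pre k : Set E) ≤ c j := by
        refine (mk_union_le _ _).trans (add_le_of_le (hc0 j) (hX j) ?_)
        refine (mk_iUnion_le _).trans ((mul_le_mul' (hcs j) (ciSup_le' hpre)).trans ?_)
        exact (mul_eq_self (hc0 j)).le
      obtain ⟨W, N, hXW, hW, hN⟩ := exists_isMatched (hc0 j) (hlinkc j) hr (hp j).2.unhindered hcard
      obtain ⟨M', hM', heq⟩ := (hp j).2.extend hN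
      refine ⟨U j ∪ W, M', ⟨(mk_union_le _ _).trans (add_le_of_le (hc0 j) (hp j).1 hW), hM'⟩,
        Set.subset_union_left, heq, (Set.subset_union_left.trans hXW).trans Set.subset_union_right,
        fun k a ha haK hMa => Or.inr (hXW (Or.inr (Set.mem_iUnion.2 ⟨k, ⟨ha, haK⟩, hMa⟩)))⟩
    choose U' M' h1 h2 using hext
    exact ⟨⟨⟨U', M'⟩, h1⟩, h2⟩
  choose q hq using hstep
  let st : ℕ → {p // P p} := fun n => Nat.rec ⟨(fun _ => ∅, fun _ => id), fun j =>
    ⟨by simp, isMatched_empty hu⟩⟩ (fun _ p => q p) n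
  have hst : ∀ n, st (n + 1) = q (st n) := fun n => rfl
  have hmono : ∀ j m n, m ≤ n → (st m).1.1 j ⊆ (st n).1.1 j ∧
      Set.EqOn ((st n).1.2 j) ((st m).1.2 j) ((st m).1.1 j) := by
    intro j m n hmn
    induction n, hmn using Nat.le_induction with
    | base => exact ⟨subset_rfl, fun _ _ => rfl⟩
    | succ n _ ih =>
      rw [hst]
      exact ⟨ih.1.trans (hq (st n) j).1, fun x hx =>
        ((hq (st n) j).2.1 (ih.1 hx)).trans (ih.2 hx)⟩
  let U : s → Set E := fun j => ⋃ n, (st n).1.1 j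
  have hM : ∀ j, ∃ M : E → E, ∀ n, Set.EqOn M ((st n).1.2 j) ((st n).1.1 j) := by
    intro j
    refine ⟨fun a => if h : ∃ n, a ∈ (st n).1.1 j then (st h.choose).1.2 j a else a,
      fun n a ha => ?_⟩
    have h : ∃ n, a ∈ (st n).1.1 j := ⟨n, ha⟩
    simp only [dif_pos h]
    rw [← (hmono j _ _ (le_max_left h.choose n)).2 h.choose_spec,
      (hmono j _ _ (le_max_right h.choose n)).2 ha]
  choose M hM using hM
  have hMmem : ∀ j, ∀ a ∈ U j, a ∉ K → M j a ∈ U j ∧ M j a ∉ L ∧ adj a (M j a) := by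
    intro j a ha haK
    obtain ⟨n, hn⟩ := Set.mem_iUnion.1 ha
    rw [hM j n hn]
    have := ((st n).2 j).2
    exact ⟨Set.mem_iUnion.2 ⟨n, this.mem a hn haK⟩, this.notMem a hn haK, this.rel a hn haK⟩
  have hMinj : ∀ j, ∀ a ∈ U j, a ∉ K → ∀ a' ∈ U j, a' ∉ K → M j a = M j a' → a = a' := by
    intro j a ha haK a' ha' haK' he
    obtain ⟨n, hn⟩ := Set.mem_iUnion.1 ha
    obtain ⟨n', hn'⟩ := Set.mem_iUnion.1 ha'
    have h1 := (hmono j _ _ (le_max_left n n')).1 hn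
    have h2 := (hmono j _ _ (le_max_right n n')).1 hn'
    rw [hM j _ h1, hM j _ h2] at he
    exact ((st (max n n')).2 j).2.inj ⟨h1, haK⟩ ⟨h2, haK'⟩ he
  have hclosed : ∀ j k, ∀ a ∈ U k, a ∉ K → M k a ∈ U j → a ∈ U j := by
    intro j k a ha haK hMa
    obtain ⟨n, hn⟩ := Set.mem_iUnion.1 ha
    obtain ⟨n', hn'⟩ := Set.mem_iUnion.1 hMa
    have h1 := (hmono k _ _ (le_max_left n n')).1 hn
    have h2 := (hmono j _ _ (le_max_right n n')).1 hn'
    rw [hM k _ h1] at h2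
    exact Set.mem_iUnion.2 ⟨max n n' + 1, (hq _ j).2.2.2 k a h1 haK h2⟩
  have hfirst : ∀ a, ∃ j, a ∉ K → a ∈ U j ∧ ∀ k, a ∈ U k → j ≤ k := by
    intro a
    by_cases ha : a ∈ K
    · obtain ⟨i⟩ : Nonempty κ.ord.ToType := mk_ne_zero_iff.1 (by simpa using hκ.pos.ne')
      obtain ⟨j, hj, -⟩ := hs i
      exact ⟨⟨j, hj⟩, fun h => absurd ha h⟩
    · obtain ⟨j, hj⟩ := hXK a ha
      have hne : {j | a ∈ U j}.Nonempty := ⟨j, Set.mem_iUnion.2 ⟨1, (hq (st 0) j).2.2.1 hj⟩⟩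
      exact ⟨_, fun _ => ⟨wellFounded_lt.min_mem _ hne,
        fun k hk => not_lt.1 (wellFounded_lt.not_lt_min {j | a ∈ U j} hk)⟩⟩
  choose J hJ using hfirst
  refine ⟨fun a => M (J a) a, fun a ha a' ha' he => ?_, fun a ha => (hMmem _ a (hJ a ha).1 ha).2⟩
  have he : M (J a) a = M (J a') a' := he
  have h1 := (hJ a ha).2 (J a') (hclosed _ _ a (hJ a ha).1 ha
    (he ▸ (hMmem _ a' (hJ a' ha').1 ha').1))
  have h2 := (hJ a' ha').2 (J a) (hclosed _ _ a' (hJ a' ha').1 ha'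
    (he ▸ (hMmem _ a (hJ a ha).1 ha).1))
  have h3 := le_antisymm h1 h2
  rw [← h3] at he
  exact hMinj _ a (hJ a ha).1 ha a' (h3 ▸ (hJ a' ha').1) ha' he

/-- An unhindered web is linkable. -/
theorem linkable_of_not_hindered (hr : ∀ a, adj a a) (hu : ¬ Hindered adj K L) :
    Linkable adj K L := by
  have key : ∀ κ : Cardinal.{u}, ∀ (adj : E → E → Prop) (K L : Set E), (∀ a, adj a a) →
      #(Kᶜ : Set E) ≤ κ → ¬ Hindered adj K L → Linkable adj K L := by
    intro κ
    induction κ using WellFoundedLT.induction with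
    | _ κ ih =>
      intro adj K L hr hK hu
      have hlink : LinkableBelow E κ := fun adj K L h1 h2 h3 => ih _ h2 adj K L h1 le_rfl h3
      rcases le_or_gt κ ℵ₀ with h0 | h0
      · exact linkable_of_countable hr (le_aleph0_iff_set_countable.1 (hK.trans h0)) hu
      · rcases isRegular_or_isSingular h0.le with h | h
        · exact linkable_of_regular h h0 hlink hr hu hK
        · exact linkable_of_singular h hlink hr hu hK
  exact key _ adj K L hr le_rfl hu

end Web

end

namespace MultiDigraph

section

variable {V E : Type*} (D : MultiDigraph V E)

/-- `u` can be left towards `v` by a nonempty walk. -/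
def Before (u v : V) : Prop :=
  Relation.TransGen (fun u v => ∃ e, D.tail e = u ∧ D.head e = v) u v

variable {D}

theorem before_edge (e : E) : D.Before (D.tail e) (D.head e) := .single ⟨e, rfl, rfl⟩

theorem wellFounded_before (hacyclic : ¬ D.HasCycle) (hnoback : ¬ D.HasBackwardInfinitePath) :
    WellFounded D.Before := by
  classical
  refine WellFounded.transGen ?_
  rw [wellFounded_iff_isEmpty_descending_chain]
  refine ⟨fun ⟨x, hx⟩ => ?_⟩
  choose e he using hx
  by_cases hinj : Function.Injective x
  · exact hnoback ⟨e, fun n => (he n).1.trans (he (n + 1)).2.symm, by simpa [he] using hinj⟩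
  have hex : ∃ j, ∃ i < j, x i = x j := by
    by_contra! h
    refine hinj fun a b hab => ?_
    by_contra hne
    rcases lt_or_gt_of_ne hne with h' | h'
    exacts [h b a h' hab, h a b h' hab.symm]
  obtain ⟨i, hij, hx⟩ := Nat.find_spec hex
  have hmin : ∀ m < Nat.find hex, ∀ k < m, x k ≠ x m := fun m hm k hk h =>
    Nat.find_min hex hm ⟨k, hk, h⟩
  generalize Nat.find hex = j at hij hx hmin
  obtain ⟨n, rfl⟩ : ∃ n, j = i + (n + 1) := ⟨j - i - 1, by omega⟩
  have hne : (List.range (n + 1)).map (fun k => e (i + n - k)) ≠ [] := by simp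
  refine hacyclic ⟨(List.range (n + 1)).map fun k => e (i + n - k), hne, ?_, ?_, ?_⟩
  · refine List.isChain_iff_getElem.2 fun k hk => ?_
    simp only [List.length_map, List.length_range] at hk
    simp only [List.getElem_map, List.getElem_range, he]
    congr 1
    omega
  · rw [List.getLast_eq_getElem, List.head_eq_getElem]
    simp only [List.getElem_map, List.getElem_range, he]
    simpa [Nat.add_assoc] using hx
  · rw [List.map_map]
    refine List.Nodup.map_on (fun a ha b hb hab => ?_) List.nodup_range
    simp only [List.mem_range, Function.comp_apply, he] at ha hb hab
    by_contra h
    rcases lt_or_gt_of_ne h with h | h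
    · exact hmin (i + n - a) (by omega) (i + n - b) (by omega) hab.symm
    · exact hmin (i + n - b) (by omega) (i + n - a) (by omega) hab

theorem not_before_self (hwf : WellFounded D.Before) (v : V) : ¬ D.Before v v :=
  hwf.irrefl.irrefl v

/-- `y` is the predecessor of `e` under `p`. -/
def Pred (D : MultiDigraph V E) (r : V) (T : Set E) (p : E → E) (y e : E) : Prop :=
  e ∈ T ∧ D.tail e ≠ r ∧ p e = y

theorem head_eq_or_before {r : V} {T : Set E} {p : E → E}
    (hT : ∀ e ∈ T, D.tail e ≠ r → p e ∈ T ∧ D.head (p e) = D.tail e) {x e : E}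
    (h : Relation.ReflTransGen (Pred D r T p) x e) :
    D.head x = D.head e ∨ D.Before (D.head x) (D.head e) := by
  induction h with
  | refl => exact Or.inl rfl
  | @tail b c _ h ih =>
    obtain ⟨h1, h2, rfl⟩ := h
    have h3 := before_edge (D := D) c
    rw [← (hT _ h1 h2).2] at h3
    rcases ih with ih | ih
    · exact Or.inr (ih ▸ h3)
    · exact Or.inr (ih.trans h3)

theorem exists_path (hwf : WellFounded D.Before) {r : V} (hroot : ∀ e, D.head e ≠ r)
    {T : Set E} {p : E → E}
    (hT : ∀ e ∈ T, D.tail e ≠ r → p e ∈ T ∧ D.head (p e) = D.tail e) (e : E) (he : e ∈ T) :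
    ∃ q : List E, D.IsPathIn T r (D.head e) q ∧
      ∀ x, x ∈ q ↔ Relation.ReflTransGen (Pred D r T p) x e := by
  induction hv : D.head e using hwf.induction generalizing e with
  | _ v ih =>
    subst hv
    by_cases hr : D.tail e = r
    · refine ⟨[e], ⟨by simp, by simpa using hr, by simp, List.isChain_singleton _, ?_, by simpa using he⟩, ?_⟩
      · simpa using (hroot e).symm
      · intro x
        rw [List.mem_singleton, Relation.ReflTransGen.cases_tail_iff]
        constructor
        · exact fun h => Or.inl h.symm
        · rintro (h | ⟨_, _, _, h, _⟩)
          exacts [h.symm, absurd hr h]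
    · obtain ⟨hpT, hp⟩ := hT e he hr
      obtain ⟨q, ⟨hne, h1, h2, h3, h4, h5⟩, hq⟩ :=
        ih (D.head (p e)) (hp ▸ before_edge e) (p e) hpT rfl
      refine ⟨q ++ [e], ⟨by simp, ?_, by simp, ?_, ?_, ?_⟩, ?_⟩
      · rw [List.head_append_of_ne_nil hne, h1]
      · refine List.isChain_append.2 ⟨h3, by simp, fun x hx y hy => ?_⟩
        rw [List.getLast?_eq_some_getLast hne] at hx
        simp only [Option.mem_def, Option.some.injEq, List.head?_cons] at hx hy
        rw [← hx, ← hy, h2, hp]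
      · rw [List.map_append, ← List.cons_append]
        refine List.nodup_append.2 ⟨h4, by simp, fun a ha b hb hab => ?_⟩
        simp only [List.map_cons, List.map_nil, List.mem_singleton] at hb
        subst hb
        subst hab
        rcases List.mem_cons.1 ha with h | h
        · exact hroot e h
        · obtain ⟨x, hx, hxe⟩ := List.mem_map.1 h
          have hlt : D.Before (D.head (p e)) (D.head e) := hp ▸ before_edge e
          rcases head_eq_or_before hT ((hq x).1 hx) with h' | h'
          · rw [hxe] at h'
            rw [← h'] at hlt
            exact not_before_self hwf _ hlt
          · rw [hxe] at h'
            exact not_before_self hwf _ (h'.trans hlt)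
      · intro x hx
        rcases List.mem_append.1 hx with h | h
        · exact h5 x h
        · rw [List.mem_singleton.1 h]
          exact he
      · intro x
        rw [List.mem_append, List.mem_singleton, Relation.ReflTransGen.cases_tail_iff, hq]
        constructor
        · rintro (h | h)
          exacts [Or.inr ⟨p e, h, he, hr, rfl⟩, Or.inl h.symm]
        · rintro (h | ⟨y, h, -, -, rfl⟩)
          exacts [Or.inr h.symm, Or.inl h]

/-- Following predecessors from the edges of `T` at `v` produces disjoint paths with
transversal `C`. -/
theorem exists_paths (hwf : WellFounded D.Before) {r v : V} (hroot : ∀ e, D.head e ≠ r)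
    {T B C : Set E} {p : E → E}
    (hT : ∀ e ∈ T, D.tail e ≠ r → p e ∈ T ∧ D.head (p e) = D.tail e)
    (hv : ∀ e ∈ T, D.tail e ≠ r → D.head (p e) ≠ v)
    (hinj : ∀ e ∈ T, ∀ e' ∈ T, D.tail e ≠ r → D.tail e' ≠ r → p e = p e' → e = e')
    (hBv : ∀ e ∈ B, D.head e ≠ v)
    (hBC : ∀ e ∈ B, e ∉ C)
    (hCB : ∀ e ∈ T, D.tail e ≠ r → (e ∈ C ∨ e ∈ B) → p e ∈ B)
    (hTB : ∀ e ∈ T, e ∉ C → e ∉ B → D.tail e ≠ r ∧ p e ∉ B)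
    (hC : ∀ c ∈ C, ∃ s ∈ T, D.head s = v ∧ Relation.ReflTransGen (Pred D r T p) c s) :
    ∃ Ps : Set (List E), (∀ q ∈ Ps, D.IsPathIn T r v q) ∧
      Ps.Pairwise (fun p q => p.Disjoint q) ∧ IsTransversal Ps C ∧
      ∀ e ∈ T, D.head e = v → ∃ q ∈ Ps, e ∈ q := by
  choose! P hP hPmem using fun e he => exists_path hwf hroot hT e he
  have hR : Relator.RightUnique (Pred D r T p) := by
    rintro y e e' ⟨h1, h2, h3⟩ ⟨h1', h2', h3'⟩
    exact hinj e h1 e' h1' h2 h2' (h3.trans h3'.symm)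
  have hone : ∀ s s', D.head s = v → Relation.ReflTransGen (Pred D r T p) s s' → s = s' := by
    intro s s' hs h
    rcases Relation.ReflTransGen.cases_head h with h | ⟨c, ⟨h1, h2, h3⟩, -⟩
    · exact h
    · exact absurd (h3 ▸ hs) (hv c h1 h2)
  have hback : ∀ x e, Relation.ReflTransGen (Pred D r T p) x e → e ∈ B → x ∈ B := by
    intro x e h
    induction h with
    | refl => exact id
    | tail _ h ih =>
      obtain ⟨h1, h2, h3⟩ := h
      exact fun hB => ih (h3 ▸ hCB _ h1 h2 (Or.inr hB))
  have huniq : ∀ x e, Relation.ReflTransGen (Pred D r T p) x e → e ∈ C → x ∈ C → x = e := by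
    intro x e h he hx
    rcases Relation.ReflTransGen.cases_tail h with h | ⟨c, hc, h1, h2, h3⟩
    · exact h.symm
    · exact absurd hx (hBC _ (hback _ _ hc (h3 ▸ hCB e h1 h2 (Or.inl he))))
  have hcross : ∀ w e, D.head e = w → e ∈ T → e ∉ B →
      ∃ c ∈ C, Relation.ReflTransGen (Pred D r T p) c e ∧
        ∀ x ∈ C, Relation.ReflTransGen (Pred D r T p) x e → x = c := by
    intro w
    induction w using hwf.induction with
    | _ w ih =>
      rintro e rfl heT heB
      by_cases heC : e ∈ C
      · exact ⟨e, heC, .refl, fun x hx h => huniq x e h heC hx⟩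
      · obtain ⟨hr, hpB⟩ := hTB e heT heC heB
        obtain ⟨hpT, hp⟩ := hT e heT hr
        obtain ⟨c, hc, h1, h2⟩ := ih _ (hp ▸ before_edge e) (p e) rfl hpT hpB
        refine ⟨c, hc, h1.tail ⟨heT, hr, rfl⟩, fun x hx h => ?_⟩
        rcases Relation.ReflTransGen.cases_tail h with h | ⟨y, hy, -, -, rfl⟩
        · exact absurd (h ▸ hx) heC
        · exact h2 x hx hy
  refine ⟨P '' {s | s ∈ T ∧ D.head s = v}, ?_, ?_, ⟨?_, ?_⟩, ?_⟩
  · rintro _ ⟨s, ⟨hs, rfl⟩, rfl⟩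
    exact hP s hs
  · rintro _ ⟨s, ⟨hs, hsv⟩, rfl⟩ _ ⟨s', ⟨hs', hsv'⟩, rfl⟩ hne x hx hx'
    have h1 := (hPmem s hs x).1 hx
    have h2 := (hPmem s' hs' x).1 hx'
    rcases Relation.ReflTransGen.total_of_right_unique hR h1 h2 with h | h
    · exact hne (congrArg P (hone s s' hsv h))
    · exact hne (congrArg P (hone s' s hsv' h).symm)
  · rintro _ ⟨s, ⟨hs, hsv⟩, rfl⟩
    obtain ⟨c, hc, h1, h2⟩ := hcross _ s rfl hs fun h => hBv s h hsv
    exact ⟨c, ⟨hc, (hPmem s hs c).2 h1⟩, fun x hx => h2 x hx.1 ((hPmem s hs x).1 hx.2)⟩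
  · intro c hc
    obtain ⟨s, hs, hsv, h⟩ := hC c hc
    exact ⟨P s, ⟨s, ⟨hs, hsv⟩, rfl⟩, (hPmem s hs c).2 h⟩
  · intro e he hev
    exact ⟨P e, ⟨e, ⟨he, hev⟩, rfl⟩, (hPmem e he e).2 .refl⟩

/-- `e` is reached from `r` by a walk all of whose edges satisfy `Q`. -/
inductive Reach (D : MultiDigraph V E) (r : V) (Q : E → Prop) : E → Prop
  | base (e : E) : D.tail e = r → Q e → Reach D r Q e
  | step (e e' : E) : Reach D r Q e → D.head e = D.tail e' → Q e' → Reach D r Q e'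

theorem Reach.mono {r : V} {Q Q' : E → Prop} (h : ∀ e, Q e → Q' e) {e : E} (he : Reach D r Q e) :
    Reach D r Q' e := by
  induction he with
  | base e h1 h2 => exact .base e h1 (h e h2)
  | step e e' _ h1 h2 ih => exact .step e e' ih h1 (h e' h2)

theorem Reach.prop {r : V} {Q : E → Prop} {e : E} (he : Reach D r Q e) : Q e := by
  cases he <;> assumption

theorem reach_getLast {r : V} {Q : E → Prop} (q : List E) (e : E) (he : Reach D r Q e)
    (hq : (e :: q).IsChain (fun e f => D.head e = D.tail f)) (hQ : ∀ x ∈ q, Q x) :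
    Reach D r Q ((e :: q).getLast (by simp)) := by
  induction q generalizing e with
  | nil => simpa using he
  | cons a q ih =>
    rw [List.isChain_cons_cons] at hq
    rw [List.getLast_cons (by simp)]
    exact ih a (.step e a he hq.1 (hQ a (by simp))) hq.2 fun x hx => hQ x (by simp [hx])

theorem isCut_of_reach {r v : V} {C : Set E}
    (h : ∀ e, Reach D r (fun x => x ∉ C) e → D.head e ≠ v) : D.IsCut Set.univ r v C := by
  rintro q ⟨hne, h1, h2, h3, -, -⟩
  by_contra! hC
  cases q with
  | nil => exact hne rfl
  | cons a q =>
    exact h _ (reach_getLast q a (.base a h1 (hC a (by simp))) h3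
      fun x hx => hC x (by simp [hx])) h2

/-- A walk either stays out of `X` or has a first edge entering `X`. -/
theorem Reach.first {r : V} {Q : E → Prop} (X : Set V) (hr : r ∉ X) {e : E}
    (he : Reach D r Q e) : Reach D r (fun x => Q x ∧ D.head x ∉ X) e ∨
      ∃ e', Q e' ∧ D.head e' ∈ X ∧ D.tail e' ∉ X ∧
        (D.tail e' = r ∨ ∃ e'', Reach D r (fun x => Q x ∧ D.head x ∉ X) e'' ∧
          D.head e'' = D.tail e') := by
  induction he with
  | base e h1 h2 =>
    by_cases h : D.head e ∈ X
    · exact Or.inr ⟨e, h2, h, h1 ▸ hr, Or.inl h1⟩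
    · exact Or.inl (.base e h1 ⟨h2, h⟩)
  | step e e' _ h1 h2 ih =>
    rcases ih with ih | ih
    · by_cases h : D.head e' ∈ X
      · exact Or.inr ⟨e', h2, h, h1 ▸ ih.prop.2, Or.inr ⟨e, ih, h1⟩⟩
      · exact Or.inl (.step e e' ih h1 ⟨h2, h⟩)
    · exact Or.inr ih

end

end MultiDigraph

namespace MultiDigraph

section

open Web

variable {V E : Type*} (D : MultiDigraph V E) (r v : V) (A : Set E)

/-- The reflexive successor relation on edges: a matching along it either skips an edge or
selects an edge preceding it. -/
def Link (e b : E) : Prop := e = b ∨ D.head b = D.tail e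

/-- The edges that need no predecessor in the edge set `A`. -/
def Srcs : Set E := {e | e ∉ A ∨ D.tail e = r}

/-- The edges that cannot be a predecessor in the edge set `A`. -/
def Snks : Set E := {e | e ∉ A ∨ D.head e = v}

theorem exists_wave_matching : ∃ (Z : Set E) (f M : E → E),
    IsWave (Link D) (Srcs D r A) (Snks D v A) Z f ∧
    (∀ S g, IsWave (Link D) (Srcs D r A) (Snks D v A) S g → S ⊆ Z) ∧
    Set.InjOn M (Srcs D r A ∪ Z)ᶜ ∧
    ∀ a, a ∉ Srcs D r A ∪ Z → M a ∉ Snks D v A ∪ nb (Link D) (Snks D v A) Z ∧ Link D a (M a) := by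
  have hr : ∀ a, Link D a a := fun a => Or.inl rfl
  obtain ⟨Z, f, hZ, hmax⟩ := exists_largest hr (Srcs D r A) (Snks D v A)
  obtain ⟨M, hM⟩ := linkable_of_not_hindered (K := Srcs D r A ∪ Z)
    (L := Snks D v A ∪ nb (Link D) (Snks D v A) Z) hr (by
      rintro ⟨S, g, hS, x, hx, -⟩
      rw [hZ.sdiff_eq_empty hr hmax hS] at hx
      exact hx)
  exact ⟨Z, f, M, hZ, hmax, hM⟩

/-- The largest wave. -/
noncomputable def wZ : Set E := (exists_wave_matching D r v A).choose

/-- The matching of the largest wave. -/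
noncomputable def wf : E → E := (exists_wave_matching D r v A).choose_spec.choose

/-- A matching of the edges outside the largest wave. -/
noncomputable def wM : E → E := (exists_wave_matching D r v A).choose_spec.choose_spec.choose

theorem isWave_wZ : IsWave (Link D) (Srcs D r A) (Snks D v A) (wZ D r v A) (wf D r v A) :=
  (exists_wave_matching D r v A).choose_spec.choose_spec.choose_spec.1

theorem subset_wZ {S : Set E} {g : E → E}
    (h : IsWave (Link D) (Srcs D r A) (Snks D v A) S g) : S ⊆ wZ D r v A :=
  (exists_wave_matching D r v A).choose_spec.choose_spec.choose_spec.2.1 S g h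

/-- The neighbourhood of the largest wave. -/
def wN : Set E := nb (Link D) (Snks D v A) (wZ D r v A)

theorem injOn_wM : Set.InjOn (wM D r v A) (Srcs D r A ∪ wZ D r v A)ᶜ :=
  (exists_wave_matching D r v A).choose_spec.choose_spec.choose_spec.2.2.1

theorem wM_spec {a : E} (h : a ∉ Srcs D r A ∪ wZ D r v A) :
    wM D r v A a ∉ Snks D v A ∪ wN D r v A ∧ Link D a (wM D r v A a) :=
  (exists_wave_matching D r v A).choose_spec.choose_spec.choose_spec.2.2.2 a h

/-- The edges entering the wave from outside. -/
def wC : Set E :=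
  {e | e ∈ A ∧ e ∉ wZ D r v A ∧ (D.head e = v ∨ ∃ s ∈ wZ D r v A, D.tail s = D.head e)}

/-- The edges on a chain of the wave that starts in `wC`. -/
def wOn : Set E := {e | ∃ c ∈ wC D r v A,
  Relation.ReflTransGen (fun b e => b ∈ wN D r v A ∧ wf D r v A b = e) c e}

/-- The edges at `v` that are last on a chain. -/
def wI : Set E := {e | e ∈ wOn D r v A ∧ D.head e = v}

variable {D r v A}

theorem mem_of_mem_wZ {e : E} (h : e ∈ wZ D r v A) : e ∈ A ∧ D.tail e ≠ r := by
  have := (isWave_wZ D r v A).notMem e h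
  simpa [Srcs] using this

theorem mem_wN {e : E} : e ∈ wN D r v A ↔ e ∈ A ∧ D.head e ≠ v ∧
    ∃ s ∈ wZ D r v A, s = e ∨ D.head e = D.tail s := by
  simp only [wN, nb, Snks, Link, Set.mem_ofPred_eq, not_or, not_not, and_assoc]

theorem wC_subset : wC D r v A ⊆ wOn D r v A := fun c hc => ⟨c, hc, .refl⟩

theorem wf_mem_wOn {b : E} (h : b ∈ wOn D r v A) (hb : b ∈ wN D r v A) :
    wf D r v A b ∈ wOn D r v A :=
  h.imp fun _ h => ⟨h.1, h.2.tail ⟨hb, rfl⟩⟩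

theorem wf_mem {b : E} (hb : b ∈ wN D r v A) : wf D r v A b ∈ wZ D r v A :=
  (isWave_wZ D r v A).maps b hb

theorem injOn_wf : Set.InjOn (wf D r v A) (wN D r v A) := (isWave_wZ D r v A).inj

theorem mem_wOn_cases {e : E} (h : e ∈ wOn D r v A) : e ∈ wC D r v A ∨
    ∃ b ∈ wOn D r v A, b ∈ wN D r v A ∧ wf D r v A b = e := by
  obtain ⟨c, hc, h⟩ := h
  rcases Relation.ReflTransGen.cases_tail h with h | ⟨b, hb, h⟩
  · exact Or.inl (h ▸ hc)
  · exact Or.inr ⟨b, ⟨c, hc, hb⟩, h⟩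

theorem wf_ne {e : E} (h : e ∈ wOn D r v A) (he : e ∈ wN D r v A) : wf D r v A e ≠ e := by
  obtain ⟨c, hc, h⟩ := h
  induction h with
  | refl => exact fun h => hc.2.1 (h ▸ wf_mem he)
  | tail _ h ih =>
    obtain ⟨hb, rfl⟩ := h
    exact fun h => ih hb (injOn_wf he hb h)

theorem tail_wf {e : E} (h : e ∈ wOn D r v A) (he : e ∈ wN D r v A) :
    D.tail (wf D r v A e) = D.head e := by
  rcases (isWave_wZ D r v A).rel e he with h' | h'
  exacts [absurd h' (wf_ne h he), h'.symm]

theorem wOn_subset {e : E} (h : e ∈ wOn D r v A) : e ∈ A := by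
  rcases mem_wOn_cases h with h | ⟨b, -, hb, rfl⟩
  exacts [h.1, (mem_of_mem_wZ (wf_mem hb)).1]

theorem wOn_mem_wN {e : E} (h : e ∈ wOn D r v A) (hv : D.head e ≠ v) : e ∈ wN D r v A := by
  refine mem_wN.2 ⟨wOn_subset h, hv, ?_⟩
  rcases mem_wOn_cases h with h | ⟨b, -, hb, rfl⟩
  · obtain ⟨s, hs, h⟩ := h.2.2.resolve_left hv
    exact ⟨s, hs, Or.inr h.symm⟩
  · exact ⟨_, wf_mem hb, Or.inl rfl⟩

/-- The edges that may lie on the paths before they enter the wave. -/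
def wB (D : MultiDigraph V E) (r v : V) (A : Set E) : Set E :=
  {e | e ∈ A ∧ e ∉ wN D r v A ∧ D.head e ≠ v ∧ (D.tail e ≠ r → wM D r v A e ≠ e)}

theorem wB_notMem_wZ {e : E} (h : e ∈ wB D r v A) : e ∉ wZ D r v A :=
  fun hZ => h.2.1 (mem_wN.2 ⟨h.1, h.2.2.1, e, hZ, Or.inl rfl⟩)

theorem wB_notMem_wC {e : E} (h : e ∈ wB D r v A) : e ∉ wC D r v A :=
  fun hC => h.2.1 (wOn_mem_wN (wC_subset hC) h.2.2.1)

theorem wM_step {e : E} (h : e ∈ wC D r v A ∨ e ∈ wB D r v A) (hr : D.tail e ≠ r) :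
    e ∉ Srcs D r A ∪ wZ D r v A ∧ wM D r v A e ∈ wB D r v A ∧
      D.head (wM D r v A e) = D.tail e := by
  have hA : e ∈ A := h.elim (fun h => h.1) fun h => h.1
  have hZ : e ∉ wZ D r v A := h.elim (fun h => h.2.1) wB_notMem_wZ
  have hS : e ∉ Srcs D r A ∪ wZ D r v A := by simp [Srcs, hA, hZ, hr]
  obtain ⟨h1, h2⟩ := wM_spec D r v A hS
  have h3 : wM D r v A e ∈ A ∧ D.head (wM D r v A e) ≠ v ∧ wM D r v A e ∉ wN D r v A := by
    simpa [Snks, and_assoc] using h1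
  have hne : wM D r v A e ≠ e := by
    rcases h with h | h
    · intro he
      rw [he] at h3
      exact h3.2.2 (wOn_mem_wN (wC_subset h) h3.2.1)
    · exact h.2.2.2 hr
  refine ⟨hS, ⟨h3.1, h3.2.2, h3.2.1, fun hr' he => hne ?_⟩, ?_⟩
  · refine injOn_wM D r v A ?_ hS he
    have : wM D r v A e ∉ wZ D r v A :=
      fun h' => h3.2.2 (mem_wN.2 ⟨h3.1, h3.2.1, _, h', Or.inl rfl⟩)
    simp [Srcs, h3.1, this, hr']
  · rcases h2 with h2 | h2
    exacts [absurd h2.symm hne, h2]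

theorem exists_paths_wI (hwf : WellFounded D.Before) (hroot : ∀ e, D.head e ≠ r)
    {F : Set E} (hF : ∀ e ∈ A, D.head e ≠ v → e ∈ F) (hI : wI D r v A ⊆ F) :
    ∃ Ps : Set (List E), (∀ q ∈ Ps, D.IsPathIn F r v q) ∧
      Ps.Pairwise (fun p q => p.Disjoint q) ∧ IsTransversal Ps (wC D r v A) ∧
      ∀ e ∈ wI D r v A, ∃ q ∈ Ps, e ∈ q := by
  classical
  by_cases hE : Nonempty E
  swap
  · refine ⟨∅, by simp, by simp, ⟨by simp, fun e => (hE ⟨e⟩).elim⟩, fun e => (hE ⟨e⟩).elim⟩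
  let p : E → E := fun e => if e ∈ wZ D r v A then Function.invFunOn (wf D r v A) (wN D r v A) e
    else wM D r v A e
  have hpf : ∀ b ∈ wN D r v A, p (wf D r v A b) = b := by
    intro b hb
    simp only [p, if_pos (wf_mem hb)]
    exact injOn_wf.leftInvOn_invFunOn hb
  have hpM : ∀ e, e ∈ wC D r v A ∨ e ∈ wB D r v A → p e = wM D r v A e := fun e he =>
    if_neg (he.elim (fun h => h.2.1) wB_notMem_wZ)
  let T : Set E := wOn D r v A ∪ wB D r v A
  have hcases : ∀ e ∈ T, (∃ b ∈ wOn D r v A, b ∈ wN D r v A ∧ wf D r v A b = e) ∨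
      (e ∈ wC D r v A ∨ e ∈ wB D r v A) := by
    rintro e (h | h)
    · rcases mem_wOn_cases h with h | h
      exacts [Or.inr (Or.inl h), Or.inl h]
    · exact Or.inr (Or.inr h)
  have hTF : T ⊆ F := by
    rintro e (h | h)
    · by_cases hv : D.head e = v
      · exact hI ⟨h, hv⟩
      · exact hF e (wOn_subset h) hv
    · exact hF e h.1 h.2.2.1
  have hT : ∀ e ∈ T, D.tail e ≠ r → p e ∈ T ∧ D.head (p e) = D.tail e := by
    intro e he hr
    rcases hcases e he with ⟨b, hb, hbN, rfl⟩ | h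
    · rw [hpf b hbN]
      exact ⟨Or.inl hb, (tail_wf hb hbN).symm⟩
    · rw [hpM e h]
      exact ⟨Or.inr (wM_step h hr).2.1, (wM_step h hr).2.2⟩
  have hpv : ∀ e ∈ T, D.tail e ≠ r → D.head (p e) ≠ v := by
    intro e he hr
    rcases hcases e he with ⟨b, hb, hbN, rfl⟩ | h
    · rw [hpf b hbN]
      exact (mem_wN.1 hbN).2.1
    · rw [hpM e h]
      exact (wM_step h hr).2.1.2.2.1
  have hpinj : ∀ e ∈ T, ∀ e' ∈ T, D.tail e ≠ r → D.tail e' ≠ r → p e = p e' → e = e' := by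
    intro e he e' he' hr hr' hp
    rcases hcases e he with ⟨b, hb, hbN, rfl⟩ | h <;>
      rcases hcases e' he' with ⟨b', hb', hbN', rfl⟩ | h'
    · rw [hpf b hbN, hpf b' hbN'] at hp
      rw [hp]
    · rw [hpf b hbN, hpM e' h'] at hp
      exact absurd (hp ▸ hbN) (wM_step h' hr').2.1.2.1
    · rw [hpf b' hbN', hpM e h] at hp
      exact absurd (hp ▸ hbN') (wM_step h hr).2.1.2.1
    · rw [hpM e h, hpM e' h'] at hp
      exact injOn_wM D r v A (wM_step h hr).1 (wM_step h' hr').1 hp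
  have hpB : ∀ e ∈ T, e ∉ wC D r v A → e ∉ wB D r v A → D.tail e ≠ r ∧ p e ∉ wB D r v A := by
    intro e he hC hB
    obtain ⟨b, hb, hbN, rfl⟩ := (hcases e he).resolve_right (by simp [hC, hB])
    refine ⟨(mem_of_mem_wZ (wf_mem hbN)).2, ?_⟩
    rw [hpf b hbN]
    exact fun h => h.2.1 hbN
  have hpC : ∀ c ∈ wC D r v A, ∃ s ∈ T, D.head s = v ∧
      Relation.ReflTransGen (Pred D r T p) c s := by
    intro c hc
    by_contra! hno
    have hu : ∀ n, (wf D r v A)^[n] c ∈ wOn D r v A ∧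
        Relation.ReflTransGen (Pred D r T p) c ((wf D r v A)^[n] c) := by
      intro n
      induction n with
      | zero => exact ⟨wC_subset hc, .refl⟩
      | succ n ih =>
        have hN := wOn_mem_wN ih.1 fun h => hno _ (Or.inl ih.1) h ih.2
        rw [Function.iterate_succ_apply']
        exact ⟨wf_mem_wOn ih.1 hN, ih.2.tail ⟨Or.inl (wf_mem_wOn ih.1 hN),
          (mem_of_mem_wZ (wf_mem hN)).2, hpf _ hN⟩⟩
    have hN : ∀ n, (wf D r v A)^[n] c ∈ wN D r v A := fun n =>
      wOn_mem_wN (hu n).1 fun h => hno _ (Or.inl (hu n).1) h (hu n).2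
    have hlt : ∀ n k, D.Before (D.head ((wf D r v A)^[n] c))
        (D.head ((wf D r v A)^[n + (k + 1)] c)) := by
      intro n k
      have hs : ∀ m, D.Before (D.head ((wf D r v A)^[m] c)) (D.head ((wf D r v A)^[m + 1] c)) := by
        intro m
        rw [Function.iterate_succ_apply', ← tail_wf (hu m).1 (hN m)]
        exact before_edge _
      induction k with
      | zero => exact hs n
      | succ k ih => exact ih.trans (hs _)
    refine (isWave_wZ D r v A).noRay (fun n => (wf D r v A)^[n] c) (fun i j hij => ?_)
      fun n => ⟨hN n, Function.iterate_succ_apply' _ _ _⟩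
    have hij : (wf D r v A)^[i] c = (wf D r v A)^[j] c := hij
    by_contra hne
    rcases lt_or_gt_of_ne hne with h | h
    · obtain ⟨k, rfl⟩ := Nat.exists_eq_add_of_lt h
      exact not_before_self hwf _ (hij ▸ hlt i k)
    · obtain ⟨k, rfl⟩ := Nat.exists_eq_add_of_lt h
      exact not_before_self hwf _ (hij ▸ hlt j k)
  obtain ⟨Ps, h1, h2, h3, h4⟩ := exists_paths hwf (v := v) (B := wB D r v A)
    (C := wC D r v A) (p := p) hroot hT hpv hpinj (fun e h => h.2.2.1)
    (fun e h => wB_notMem_wC h) (fun e _ hr h => hpM e h ▸ (wM_step h hr).2.1) hpB hpC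
  refine ⟨Ps, fun q hq => ?_, h2, h3, fun e he => h4 e (Or.inl he.1) he.2⟩
  obtain ⟨hne, g1, g2, g3, g4, g5⟩ := h1 q hq
  exact ⟨hne, g1, g2, g3, g4, fun x hx => hTF (g5 x hx)⟩

end

end MultiDigraph

namespace MultiDigraph

section

open Web

variable {V E : Type*} {D : MultiDigraph V E} {r : V}

/-- All edges at `v` and the edges of `F` that lie strictly before. -/
def upTo (D : MultiDigraph V E) (F : Set E) (v : V) : Set E :=
  {e | D.head e = v ∨ D.Before (D.head e) v ∧ e ∈ F}

theorem exists_recursive_flame (hwf : WellFounded D.Before) :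
    ∃ F : Set E, ∀ e, e ∈ F ↔ e ∈ wOn D r (D.head e) (upTo D F (D.head e)) := by
  let I : V → Set E := hwf.fix fun v I =>
    wI D r v {e | D.head e = v ∨ ∃ h : D.Before (D.head e) v, e ∈ I (D.head e) h}
  have hI : ∀ v, I v = wI D r v (upTo D {e | e ∈ I (D.head e)} v) := by
    intro v
    have h : I v = _ := hwf.fix_eq _ v
    rw [h]
    congr 1
    ext e
    simp only [upTo, Set.mem_ofPred_eq, exists_prop]
    rfl
  refine ⟨{e | e ∈ I (D.head e)}, fun e => ?_⟩
  rw [Set.mem_ofPred_eq, hI]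
  exact and_iff_left rfl

variable {F : Set E}

theorem mem_of_mem_wOn (hF : ∀ e, e ∈ F ↔ e ∈ wOn D r (D.head e) (upTo D F (D.head e)))
    {v : V} {e : E} (h : e ∈ wOn D r v (upTo D F v)) : e ∈ F := by
  rcases wOn_subset h with rfl | h'
  exacts [(hF e).2 h, h'.2]

theorem wZ_inter_subset
    (hF : ∀ e, e ∈ F ↔ e ∈ wOn D r (D.head e) (upTo D F (D.head e))) {v : V} {s : E}
    (hs : s ∈ wZ D r v (upTo D F v)) :
    wZ D r (D.tail s) (upTo D F (D.tail s)) ∩ F ⊆ wZ D r v (upTo D F v) := by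
  classical
  generalize hu : D.tail s = u
  have hsv : D.Before u v := by
    have h := before_edge (D := D) s
    rw [hu] at h
    rcases (mem_of_mem_wZ hs).1 with h' | h'
    exacts [h' ▸ h, h.trans h'.1]
  have hup : ∀ a ∈ F, (D.head a = u ∨ D.Before (D.head a) u) → a ∈ upTo D F v := by
    rintro a ha (h | h)
    exacts [Or.inr ⟨h ▸ hsv, ha⟩, Or.inr ⟨h.trans hsv, ha⟩]
  have hle : ∀ a ∈ upTo D F u, D.head a = u ∨ D.Before (D.head a) u := fun a ha =>
    ha.imp id And.left
  let S : Set E := wZ D r u (upTo D F u) ∩ F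
  let g : E → E := fun b => if b ∈ wOn D r u (upTo D F u) then wf D r u (upTo D F u) b else b
  have hr : ∀ a, Link D a a := fun a => Or.inl rfl
  have hN : ∀ b ∈ nb (Link D) (Snks D v (upTo D F v) ∪ wN D r v (upTo D F v)) S,
      b ∈ wN D r u (upTo D F u) ∧ (b ∉ wOn D r u (upTo D F u) → b ∈ S) := by
    rintro b ⟨hb, a, ⟨haZ, haF⟩, hab⟩
    have hb' : b ∈ upTo D F v ∧ D.head b ≠ v ∧ b ∉ wN D r v (upTo D F v) := by
      simpa [Snks, and_assoc] using hb
    have hbF : b ∈ F := (hb'.1.resolve_left hb'.2.1).2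
    have hbu : D.head b = u ∨ D.Before (D.head b) u := by
      rcases hab with rfl | h
      · exact hle _ (mem_of_mem_wZ haZ).1
      · rw [h]
        refine Or.inr ?_
        rcases hle _ (mem_of_mem_wZ haZ).1 with h' | h'
        exacts [h' ▸ before_edge a, (before_edge a).trans h']
    have hbne : D.head b ≠ u := fun h =>
      hb'.2.2 (mem_wN.2 ⟨hb'.1, hb'.2.1, s, hs, Or.inr (h.trans hu.symm)⟩)
    have hbN : b ∈ wN D r u (upTo D F u) :=
      mem_wN.2 ⟨hbu.imp id fun h => ⟨h, hbF⟩, hbne, a, haZ, hab⟩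
    refine ⟨hbN, fun hon => ⟨?_, hbF⟩⟩
    by_contra hbZ
    obtain ⟨h1, -, t, ht, hbt⟩ := mem_wN.1 hbN
    rcases hbt with rfl | hbt
    · exact hbZ ht
    · exact hon (wC_subset ⟨h1, hbZ, Or.inr ⟨t, ht, hbt.symm⟩⟩)
  have hwave : IsWave (Link D) (Srcs D r (upTo D F v))
      (Snks D v (upTo D F v) ∪ nb (Link D) (Snks D v (upTo D F v)) (wZ D r v (upTo D F v))) S g := by
    refine ⟨?_, ?_, ?_, ?_, ?_⟩
    · rintro a ⟨haZ, haF⟩ (h | h)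
      · exact h (hup a haF (hle a (mem_of_mem_wZ haZ).1))
      · exact (mem_of_mem_wZ haZ).2 h
    · intro b hb
      obtain ⟨hbN, hbS⟩ := hN b hb
      by_cases hon : b ∈ wOn D r u (upTo D F u)
      · simp only [g, if_pos hon]
        exact ⟨wf_mem hbN, mem_of_mem_wOn hF (wf_mem_wOn hon hbN)⟩
      · simp only [g, if_neg hon]
        exact hbS hon
    · intro b hb
      by_cases hon : b ∈ wOn D r u (upTo D F u)
      · simp only [g, if_pos hon]
        exact (isWave_wZ D r u _).rel b (hN b hb).1
      · simp only [g, if_neg hon]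
        exact hr b
    · intro b hb b' hb' h
      by_cases hon : b ∈ wOn D r u (upTo D F u) <;> by_cases hon' : b' ∈ wOn D r u (upTo D F u) <;>
        simp only [g, hon, hon', if_true, if_false] at h
      · exact injOn_wf (hN b hb).1 (hN b' hb').1 h
      · exact absurd (h ▸ wf_mem_wOn hon (hN b hb).1) hon'
      · exact absurd (h ▸ wf_mem_wOn hon' (hN b' hb').1) hon
      · exact h
    · intro x hx h
      have hon : ∀ n, x n ∈ wOn D r u (upTo D F u) := by
        intro n
        by_contra hon
        have h1 : x (n + 1) = x n := by
          rw [(h n).2]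
          exact if_neg hon
        exact absurd (hx h1) (by simp)
      exact (isWave_wZ D r u (upTo D F u)).noRay x hx fun n =>
        ⟨(hN _ (h n).1).1, (h n).2.trans (if_pos (hon n))⟩
  exact fun a ha => subset_wZ D r v (upTo D F v)
    ((isWave_wZ D r v (upTo D F v)).ext hr hwave) (Or.inr ha)

theorem not_reach (hwf : WellFounded D.Before)
    (hF : ∀ e, e ∈ F ↔ e ∈ wOn D r (D.head e) (upTo D F (D.head e))) (v : V) (hv : v ≠ r) (e : E)
    (he : Reach D r (fun x => x ∉ wC D r v (upTo D F v)) e) : D.head e ≠ v := by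
  induction v using hwf.induction generalizing e with
  | _ v ih =>
    intro hev
    let X : Set V := {w | w = v ∨ ∃ s ∈ wZ D r v (upTo D F v), D.tail s = w}
    have hrX : r ∉ X := by
      rintro (h | ⟨s, hs, h⟩)
      exacts [hv h.symm, (mem_of_mem_wZ hs).2 h]
    rcases he.first X hrX with h | ⟨e, heC, heX, htX, hpre⟩
    · exact h.prop.2 (Or.inl hev)
    · have heZ : e ∉ wZ D r v (upTo D F v) := fun h => htX (Or.inr ⟨e, h, rfl⟩)
      have heA : e ∉ upTo D F v := fun h => heC ⟨h, heZ, heX⟩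
      obtain ⟨s, hs, hse⟩ := heX.resolve_left fun h => heA (Or.inl h)
      have hlt : D.Before (D.head e) v := by
        have h := before_edge (D := D) s
        rw [hse] at h
        rcases (mem_of_mem_wZ hs).1 with h' | h'
        exacts [h' ▸ h, h.trans h'.1]
      have heF : e ∉ F := fun h => heA (Or.inr ⟨hlt, h⟩)
      have hlast : e ∉ wC D r (D.head e) (upTo D F (D.head e)) := fun h =>
        heF ((hF e).2 (wC_subset h))
      have hsub := wZ_inter_subset hF hs
      rw [hse] at hsub
      have hmono : ∀ x, (x ∉ wC D r v (upTo D F v) ∧ D.head x ∉ X) →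
          x ∉ wC D r (D.head e) (upTo D F (D.head e)) := by
        rintro x ⟨-, hxX⟩ hx
        have hxe : D.head x ≠ D.head e := fun h => hxX (h ▸ Or.inr ⟨s, hs, hse⟩)
        have hxN := wOn_mem_wN (wC_subset hx) hxe
        refine hxX (Or.inr ⟨_, hsub ⟨wf_mem hxN, ?_⟩, tail_wf (wC_subset hx) hxN⟩)
        exact mem_of_mem_wOn hF (wf_mem_wOn (wC_subset hx) hxN)
      refine ih (D.head e) hlt ?_ e ?_ rfl
      · rw [← hse]
        exact (mem_of_mem_wZ hs).2
      · rcases hpre with h | ⟨e', h, h'⟩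
        · exact .base e h hlast
        · exact .step e' e (h.mono hmono) h' hlast

end

end MultiDigraph

/-- Every acyclic `r`-rooted digraph without backward-infinite paths
admits a large flame. -/
theorem stmt2 {V E : Type*} (D : MultiDigraph V E) (r : V)
    (hroot : ∀ e, D.head e ≠ r)
    (hacyclic : ¬ D.HasCycle)
    (hnoback : ¬ D.HasBackwardInfinitePath) :
    ∃ L : Set E, D.IsFlame r L ∧ D.Large r L := by
  have hwf := MultiDigraph.wellFounded_before hacyclic hnoback
  obtain ⟨F, hF⟩ := MultiDigraph.exists_recursive_flame (r := r) hwf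
  have hpaths := fun v => MultiDigraph.exists_paths_wI (r := r) (v := v) (A := D.upTo F v)
    (F := F) hwf hroot (fun e he hv => (he.resolve_left hv).2)
    (fun e he => MultiDigraph.mem_of_mem_wOn hF he.1)
  refine ⟨F, ⟨subset_rfl, fun e _ => hroot e, fun v hv => ⟨subset_rfl, ?_⟩⟩, fun v hv => ?_⟩
  · obtain ⟨Ps, h1, h2, -, h3⟩ := hpaths v
    refine ⟨Ps, h1, h2, ?_⟩
    rintro e ⟨he, rfl⟩
    exact h3 e ⟨(hF e).1 he, rfl⟩
  · obtain ⟨Ps, h1, h2, h3, -⟩ := hpaths v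
    exact ⟨Ps, _, h1, h2, h3,
      MultiDigraph.isCut_of_reach fun e he => MultiDigraph.not_reach hwf hF v hv e he⟩
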